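/- F^Λ = R^Λ(β+α_i) e(β,α_i) is a finitely generated projective right R^Λ(β)-module, and e(β,α_i) R^Λ(β+α_i) is a finitely generated projective left R^Λ(β)-module. -/

import Mathlib

/- ## Scaffold: Khovanov–Lauda–Rouquier algebras -/

open scoped TensorProduct

/-- A symmetrizable Cartan datum together with the structure constants of the
family of polynomials `Q`. -/
structure CartanDatum (k : Type) [Field k] (I : Type) [Fintype I] [DecidableEq I] : Type where
  a : I → I → ℤ
  d : I → ℤ
  t : I → I → ℕ → ℕ → k
  a_diag : ∀ i, a i i = 2
  a_nonpos : ∀ i j, i ≠ j → a i j ≤ 0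
  a_zero_iff : ∀ i j, a i j = 0 ↔ a j i = 0
  d_pos : ∀ i, 0 < d i
  symmetrize : ∀ i j, d i * a i j = d j * a j i
  t_symm : ∀ i j p q, t i j p q = t j i q p
  t_lead : ∀ i j, i ≠ j → t i j (-(a i j)).toNat 0 ≠ 0

namespace KLR

variable {k : Type} [Field k] {I : Type} [Fintype I] [DecidableEq I]

/-- The symmetric bilinear form `(α_i, α_j) = d_i a_{ij}`. -/
def B (C : CartanDatum k I) (i j : I) : ℤ := C.d i * C.a i j

/-- Generators of the KLR algebra `R(n)`. -/
inductive Gen (I : Type) (n : ℕ) : Type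
  | e (ν : Fin n → I) : Gen I n
  | x (a : Fin n) : Gen I n
  | tau (l : ℕ) (h : l + 1 < n) : Gen I n

variable (k) in
/-- The free algebra on the generators. -/
abbrev FA (I : Type) (n : ℕ) : Type := FreeAlgebra k (Gen I n)

variable (k) in
def ge {n : ℕ} (ν : Fin n → I) : FA k I n := FreeAlgebra.ι k (Gen.e ν)

variable (k) in
def gx {n : ℕ} (a : Fin n) : FA k I n := FreeAlgebra.ι k (Gen.x a)

variable (k) in
def gt {n : ℕ} (l : ℕ) (h : l + 1 < n) : FA k I n := FreeAlgebra.ι k (Gen.tau l h)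

/-- The polynomial `Q_{ij}(u,v)` evaluated on two elements of an algebra. -/
def Qel (C : CartanDatum k I) {A : Type} [Ring A] [Algebra k A] (i j : I) (u v : A) : A :=
  if i = j then 0 else
    ∑ p ∈ Finset.range ((-(C.a i j)).toNat + 1), ∑ q ∈ Finset.range ((-(C.a j i)).toNat + 1),
      if C.d i * (p : ℤ) + C.d j * (q : ℤ) = -(C.d i * C.a i j) then
        C.t i j p q • (u ^ p * v ^ q) else 0

/-- The divided difference `(Q_{ij}(u,v) - Q_{ij}(w,v))/(u - w)` evaluated on elements. -/
def Qdiff (C : CartanDatum k I) {A : Type} [Ring A] [Algebra k A] (i j : I) (u v w : A) : A :=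
  if i = j then 0 else
    ∑ p ∈ Finset.range ((-(C.a i j)).toNat + 1), ∑ q ∈ Finset.range ((-(C.a j i)).toNat + 1),
      if C.d i * (p : ℤ) + C.d j * (q : ℤ) = -(C.d i * C.a i j) then
        C.t i j p q • ((∑ c ∈ Finset.range p, u ^ c * w ^ (p - 1 - c)) * v ^ q) else 0

/-- The defining relations of the KLR algebra `R(n)`. -/
inductive Rel (C : CartanDatum k I) (n : ℕ) : FA k I n → FA k I n → Prop
  | ee : ∀ ν ν' : Fin n → I, Rel C n (ge k ν * ge k ν') (if ν = ν' then ge k ν else 0)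
  | esum : Rel C n (∑ ν : Fin n → I, ge k ν) 1
  | xx : ∀ a b : Fin n, Rel C n (gx k a * gx k b) (gx k b * gx k a)
  | xe : ∀ (a : Fin n) (ν : Fin n → I), Rel C n (gx k a * ge k ν) (ge k ν * gx k a)
  | taue : ∀ (l : ℕ) (h : l + 1 < n) (ν : Fin n → I),
      Rel C n (gt k l h * ge k ν)
        (ge k (ν ∘ Equiv.swap (⟨l, Nat.lt_of_succ_lt h⟩ : Fin n) ⟨l + 1, h⟩) * gt k l h)
  | tautau : ∀ (l : ℕ) (h : l + 1 < n) (l' : ℕ) (h' : l' + 1 < n),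
      (l + 1 < l' ∨ l' + 1 < l) →
      Rel C n (gt k l h * gt k l' h') (gt k l' h' * gt k l h)
  | tausq : ∀ (l : ℕ) (h : l + 1 < n) (ν : Fin n → I),
      Rel C n (gt k l h ^ 2 * ge k ν)
        (Qel C (ν ⟨l, Nat.lt_of_succ_lt h⟩) (ν ⟨l + 1, h⟩)
          (gx k ⟨l, Nat.lt_of_succ_lt h⟩) (gx k ⟨l + 1, h⟩) * ge k ν)
  | taux : ∀ (l : ℕ) (h : l + 1 < n) (m : Fin n) (ν : Fin n → I),
      Rel C n ((gt k l h * gx k m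
          - gx k (Equiv.swap (⟨l, Nat.lt_of_succ_lt h⟩ : Fin n) ⟨l + 1, h⟩ m) * gt k l h) * ge k ν)
        (if m = ⟨l, Nat.lt_of_succ_lt h⟩ ∧ ν ⟨l, Nat.lt_of_succ_lt h⟩ = ν ⟨l + 1, h⟩ then
            -(ge k ν)
          else if m = (⟨l + 1, h⟩ : Fin n) ∧ ν ⟨l, Nat.lt_of_succ_lt h⟩ = ν ⟨l + 1, h⟩ then
            ge k ν
          else 0)
  | braid : ∀ (l : ℕ) (h2 : l + 2 < n) (ν : Fin n → I),
      Rel C n ((gt k (l + 1) h2 * gt k l (Nat.lt_of_succ_lt h2) * gt k (l + 1) h2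
          - gt k l (Nat.lt_of_succ_lt h2) * gt k (l + 1) h2 * gt k l (Nat.lt_of_succ_lt h2))
          * ge k ν)
        (if ν ⟨l, Nat.lt_of_succ_lt (Nat.lt_of_succ_lt h2)⟩ = ν ⟨l + 2, h2⟩ then
            Qdiff C (ν ⟨l, Nat.lt_of_succ_lt (Nat.lt_of_succ_lt h2)⟩)
              (ν ⟨l + 1, Nat.lt_of_succ_lt h2⟩)
              (gx k ⟨l, Nat.lt_of_succ_lt (Nat.lt_of_succ_lt h2)⟩)
              (gx k ⟨l + 1, Nat.lt_of_succ_lt h2⟩)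
              (gx k ⟨l + 2, h2⟩) * ge k ν
          else 0)

/-- The Khovanov–Lauda–Rouquier algebra `R(n)`. -/
abbrev Alg (C : CartanDatum k I) (n : ℕ) : Type := RingQuot (Rel C n)

variable (C : CartanDatum k I)

/-- The generator `e(ν)` of `R(n)`. -/
noncomputable def Ee {n : ℕ} (ν : Fin n → I) : Alg C n :=
  RingQuot.mkAlgHom k (Rel C n) (ge k ν)

/-- The generator `x_a` of `R(n)`. -/
noncomputable def Xx {n : ℕ} (a : Fin n) : Alg C n :=
  RingQuot.mkAlgHom k (Rel C n) (gx k a)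

/-- The generator `τ_l` of `R(n)`. -/
noncomputable def Tt {n : ℕ} (l : ℕ) (h : l + 1 < n) : Alg C n :=
  RingQuot.mkAlgHom k (Rel C n) (gt k l h)

variable (I) in
/-- The height of `β = Σ k_i α_i`. -/
def ht (β : I → ℕ) : ℕ := ∑ i, β i

/-- The content of a sequence `ν`. -/
def content {m : ℕ} (ν : Fin m → I) : I → ℕ :=
  fun i => (Finset.univ.filter (fun a => ν a = i)).card

/-- The set `I^β` of sequences of length `m` with content `β`. -/
def seqs (β : I → ℕ) (m : ℕ) : Finset (Fin m → I) :=
  Finset.univ.filter (fun ν => content ν = β)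

/-- The central idempotent `e(β)` in `R(n)`. -/
noncomputable def eIdem (n : ℕ) (β : I → ℕ) : Alg C n := ∑ ν ∈ seqs β n, Ee C ν

/-- `β + α_i`. -/
def addA (β : I → ℕ) (i : I) : I → ℕ := fun j => β j + if j = i then 1 else 0

/-- The idempotent `e(β, α_i)` of `R(n+1)` (sum over `ν ∈ I^{β+α_i}` with `ν_{n+1} = i`). -/
noncomputable def eR (n : ℕ) (β : I → ℕ) (i : I) : Alg C (n + 1) :=
  ∑ ν ∈ (seqs (addA β i) (n + 1)).filter (fun ν => ν (Fin.last n) = i), Ee C ν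

/-- The idempotent `e(α_i, β)` of `R(n+1)` (sum over `ν ∈ I^{β+α_i}` with `ν_1 = i`). -/
noncomputable def eL (n : ℕ) (β : I → ℕ) (i : I) : Alg C (n + 1) :=
  ∑ ν ∈ (seqs (addA β i) (n + 1)).filter (fun ν => ν 0 = i), Ee C ν

/-- The idempotent `e(β - α_i, α_i)` of `R(n)`: sum over `ν ∈ I^β` with last entry `i`;
this is `0` when the coefficient of `α_i` in `β` is `0` or `n = 0`. -/
noncomputable def eD (n : ℕ) (β : I → ℕ) (i : I) : Alg C n :=
  ∑ ν ∈ (seqs β n).filter (fun ν => if h : 0 < n then ν ⟨n - 1, Nat.sub_lt h one_pos⟩ = i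
      else False), Ee C ν

/-- The relations defining `R(β) = R(n)e(β)` (a unital ring with unit the image of
`e(β)`): the KLR relations together with the relation `e(β) = 1`. -/
inductive URel (n : ℕ) (β : I → ℕ) : FA k I n → FA k I n → Prop
  | base : ∀ {x y : FA k I n}, Rel C n x y → URel n β x y
  | unit : URel n β (∑ ν ∈ seqs β n, ge k ν) 1

/-- The algebra `R(β)`, realized as the quotient of `R(n)` identifying `e(β)` with `1`. -/
abbrev bAlg (n : ℕ) (β : I → ℕ) : Type := RingQuot (URel C n β)

/-- The canonical projection `R(n) → R(β)`. -/
noncomputable def toB {n : ℕ} {β : I → ℕ} : Alg C n →ₐ[k] bAlg C n β :=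
  RingQuot.liftAlgHom (S := k)
    ⟨RingQuot.mkAlgHom k (URel C n β),
      fun _ _ h => RingQuot.mkAlgHom_rel k (URel.base h)⟩

/-- The element `a^Λ(x_1)` at the level of the free algebra. -/
noncomputable def aLamF (Λ : I → ℕ) (n : ℕ) (β : I → ℕ) : FA k I n :=
  if h : 0 < n then
    ∑ ν ∈ seqs β n, (gx k (⟨0, h⟩ : Fin n)) ^ (Λ (ν ⟨0, h⟩)) * ge k ν
  else 0

/-- The element `a^Λ(x_1)` of `R(β)`. -/
noncomputable def aLam (Λ : I → ℕ) (n : ℕ) (β : I → ℕ) : bAlg C n β :=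
  RingQuot.mkAlgHom k (URel C n β) (aLamF Λ n β)

/-- The relations defining the cyclotomic quotient `R^Λ(β)`. -/
inductive CRel (Λ : I → ℕ) (n : ℕ) (β : I → ℕ) : FA k I n → FA k I n → Prop
  | base : ∀ {x y : FA k I n}, Rel C n x y → CRel Λ n β x y
  | unit : CRel Λ n β (∑ ν ∈ seqs β n, ge k ν) 1
  | cyc : CRel Λ n β (aLamF Λ n β) 0

/-- The cyclotomic KLR algebra `R^Λ(β)`. -/
abbrev cAlg (Λ : I → ℕ) (n : ℕ) (β : I → ℕ) : Type := RingQuot (CRel C Λ n β)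

/-- The canonical projection `R(β) → R^Λ(β)`. -/
noncomputable def toC {Λ : I → ℕ} {n : ℕ} {β : I → ℕ} : bAlg C n β →ₐ[k] cAlg C Λ n β :=
  RingQuot.liftAlgHom (S := k)
    ⟨RingQuot.mkAlgHom k (CRel C Λ n β),
      fun _ _ h => by
        cases h with
        | base hb => exact RingQuot.mkAlgHom_rel k (CRel.base hb)
        | unit => exact RingQuot.mkAlgHom_rel k CRel.unit⟩

/-- The canonical projection `R(n) → R^Λ(β)`. -/
noncomputable def toCB (Λ : I → ℕ) {n : ℕ} {β : I → ℕ} : Alg C n →ₐ[k] cAlg C Λ n β :=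
  (toC C).comp (toB C)

end KLR
namespace KLR

variable {k : Type} [Field k] {I : Type} [Fintype I] [DecidableEq I] (C : CartanDatum k I)

section Homs

/-- Characterization of the non-unital algebra homomorphism `R(n) → R(n+1)` adding `i`
on the right: `e(ν) ↦ e(ν∗(i))`, `x_a ↦ x_a e(…,α_i)`, `τ_l ↦ τ_l e(…,α_i)`,
where the relevant idempotent is supplied as `e`. -/
def IsUpR {n : ℕ} (i : I) (e : Alg C (n + 1)) (φ : Alg C n →ₙₐ[k] Alg C (n + 1)) : Prop :=
  (∀ ν : Fin n → I, φ (Ee C ν) = Ee C (Fin.snoc ν i)) ∧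
  (∀ a : Fin n, φ (Xx C a) = Xx C a.castSucc * e) ∧
  (∀ (l : ℕ) (h : l + 1 < n), φ (Tt C l h) = Tt C l (Nat.lt_succ_of_lt h) * e)

/-- Characterization of the non-unital algebra homomorphism `R(n) → R(n+1)` adding `i`
on the left: `e(ν) ↦ e((i)∗ν)`, `x_a ↦ x_{a+1} e(α_i,…)`, `τ_l ↦ τ_{l+1} e(α_i,…)`. -/
def IsUpL {n : ℕ} (i : I) (e : Alg C (n + 1)) (φ : Alg C n →ₙₐ[k] Alg C (n + 1)) : Prop :=
  (∀ ν : Fin n → I, φ (Ee C ν) = Ee C (Fin.cons i ν)) ∧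
  (∀ a : Fin n, φ (Xx C a) = Xx C a.succ * e) ∧
  (∀ (l : ℕ) (h : l + 1 < n), φ (Tt C l h) = Tt C (l + 1) (Nat.succ_lt_succ h) * e)

/-- Characterization of the non-unital homomorphism `R(β) → R(β+α_i)` (right version). -/
def IsUpRb {n : ℕ} {β γ' : I → ℕ} (i : I)
    (φ : bAlg C n β →ₙₐ[k] bAlg C (n + 1) γ') : Prop :=
  (∀ ν : Fin n → I, φ (toB C (Ee C ν)) = toB C (Ee C (Fin.snoc ν i))) ∧
  (∀ a : Fin n, φ (toB C (Xx C a)) = toB C (Xx C a.castSucc * eR C n β i)) ∧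
  (∀ (l : ℕ) (h : l + 1 < n),
    φ (toB C (Tt C l h)) = toB C (Tt C l (Nat.lt_succ_of_lt h) * eR C n β i))

/-- Characterization of the non-unital homomorphism `R(β) → R(β+α_i)` (left version). -/
def IsUpLb {n : ℕ} {β γ' : I → ℕ} (i : I)
    (φ : bAlg C n β →ₙₐ[k] bAlg C (n + 1) γ') : Prop :=
  (∀ ν : Fin n → I, φ (toB C (Ee C ν)) = toB C (Ee C (Fin.cons i ν))) ∧
  (∀ a : Fin n, φ (toB C (Xx C a)) = toB C (Xx C a.succ * eL C n β i)) ∧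
  (∀ (l : ℕ) (h : l + 1 < n),
    φ (toB C (Tt C l h)) = toB C (Tt C (l + 1) (Nat.succ_lt_succ h) * eL C n β i))

/-- Characterization of the non-unital homomorphism `R^Λ(β) → R^Λ(β+α_i)` (right version). -/
def IsUpRc (Λ : I → ℕ) {n : ℕ} {β γ' : I → ℕ} (i : I)
    (φ : cAlg C Λ n β →ₙₐ[k] cAlg C Λ (n + 1) γ') : Prop :=
  (∀ ν : Fin n → I, φ (toCB C Λ (Ee C ν)) = toCB C Λ (Ee C (Fin.snoc ν i))) ∧
  (∀ a : Fin n, φ (toCB C Λ (Xx C a)) = toCB C Λ (Xx C a.castSucc * eR C n β i)) ∧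
  (∀ (l : ℕ) (h : l + 1 < n),
    φ (toCB C Λ (Tt C l h)) = toCB C Λ (Tt C l (Nat.lt_succ_of_lt h) * eR C n β i))

end Homs

section Tensor

open scoped TensorProduct

variable (S B M : Type) [Ring S] [Algebra k S] [Ring B] [Algebra k B]
  [AddCommGroup M] [Module k M] [Module S M] [IsScalarTower k S M]

variable (k) in
/-- The relation submodule defining the balanced tensor product `B ⊗_S M` where `S`
acts on `B` on the right through the (non-unital) homomorphism `φ : S → B`. -/
def TRel (φ : S →ₙₐ[k] B) : Submodule B (B ⊗[k] M) :=
  Submodule.span B {z | ∃ (b : B) (r : S) (m : M), z = (b * φ r) ⊗ₜ[k] m - b ⊗ₜ[k] (r • m)}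

variable (k) in
/-- The balanced tensor product `B ⊗_S M` (over the homomorphism `φ : S → B`). -/
abbrev OT (φ : S →ₙₐ[k] B) : Type := (B ⊗[k] M) ⧸ TRel k S B M φ

variable (k) in
/-- The canonical projection onto the balanced tensor product. -/
def OTmk (φ : S →ₙₐ[k] B) (z : B ⊗[k] M) : OT k S B M φ := Submodule.Quotient.mk z

end Tensor

section ESub

variable (A : Type) [Ring A] [Algebra k A] (N : Type) [AddCommGroup N] [Module k N]
  [Module A N] [IsScalarTower k A N]

variable (k) in
/-- Multiplication by `e` as a `k`-linear endomorphism of an `A`-module. -/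
def eMap (e : A) : N →ₗ[k] N where
  toFun x := e • x
  map_add' x y := smul_add e x y
  map_smul' c x := by
    simp only [RingHom.id_apply]
    rw [← algebraMap_smul A c x, ← mul_smul, ← Algebra.commutes, mul_smul, algebraMap_smul]

variable (k) in
/-- The `k`-submodule `eN` of an `A`-module `N`. -/
def eSub (e : A) : Submodule k N := LinearMap.range (eMap k A N e)

end ESub

section Grading

variable {A M : Type}

variable (k) in
/-- `𝒜` is an algebra grading of `A`. -/
def IsAlgGrading [Ring A] [Algebra k A] (𝒜 : ℤ → Submodule k A) : Prop :=
  (1 : A) ∈ 𝒜 0 ∧ (∀ {c₁ c₂ : ℤ} {a b : A}, a ∈ 𝒜 c₁ → b ∈ 𝒜 c₂ → a * b ∈ 𝒜 (c₁ + c₂)) ∧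
    DirectSum.IsInternal 𝒜

variable (k) in
/-- `gr` is a grading of the `A`-module `M` compatible with the algebra grading `𝒜`. -/
def IsModGrading [Ring A] [Algebra k A] [AddCommGroup M] [Module k M] [Module A M]
    (𝒜 : ℤ → Submodule k A) (gr : ℤ → Submodule k M) : Prop :=
  DirectSum.IsInternal gr ∧
    ∀ {c m : ℤ} {a : A} {x : M}, a ∈ 𝒜 c → x ∈ gr m → a • x ∈ gr (c + m)

end Grading

section KLRGrading

/-- The canonical grading property for `R(n)`-type quotients: images of `e(ν)` have degree 0,
`x_a e(ν)` has degree `(α_{ν_a}, α_{ν_a})`, and `τ_l e(ν)` has degree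
`-(α_{ν_l}, α_{ν_{l+1}})`.  Here `p : R(n) → A` is the canonical projection onto the
quotient under consideration. -/
def IsKLRGrading {n : ℕ} {A : Type} [Ring A] [Algebra k A] (p : Alg C n →ₐ[k] A)
    (𝒜 : ℤ → Submodule k A) : Prop :=
  IsAlgGrading k 𝒜 ∧
  (∀ ν : Fin n → I, p (Ee C ν) ∈ 𝒜 0) ∧
  (∀ (a : Fin n) (ν : Fin n → I), p (Xx C a * Ee C ν) ∈ 𝒜 (B C (ν a) (ν a))) ∧
  (∀ (l : ℕ) (h : l + 1 < n) (ν : Fin n → I),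
    p (Tt C l h * Ee C ν) ∈ 𝒜 (-(B C (ν ⟨l, Nat.lt_of_succ_lt h⟩) (ν ⟨l + 1, h⟩))))

end KLRGrading

end KLR
namespace KLR

open scoped TensorProduct

variable {k : Type} [Field k] {I : Type} [Fintype I] [DecidableEq I] (C : CartanDatum k I)

section IndGrading

variable (S B M : Type) [Ring S] [Algebra k S] [Ring B] [Algebra k B]
  [AddCommGroup M] [Module k M] [Module S M] [IsScalarTower k S M]

variable (k) in
/-- The induced grading on the balanced tensor product `B ⊗_S M`. -/
def otGr (φ : S →ₙₐ[k] B) (𝒜 : ℤ → Submodule k B) (gr : ℤ → Submodule k M)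
    (c : ℤ) : Submodule k (OT k S B M φ) :=
  Submodule.span k {z | ∃ (c₁ c₂ : ℤ) (b : B) (m : M),
    c₁ + c₂ = c ∧ b ∈ 𝒜 c₁ ∧ m ∈ gr c₂ ∧ z = OTmk k S B M φ (b ⊗ₜ[k] m)}

end IndGrading

section ESubGrading

variable (A N : Type) [Ring A] [Algebra k A] [AddCommGroup N] [Module k N]
  [Module A N] [IsScalarTower k A N]

variable (k) in
/-- The induced grading on the submodule `eN ⊆ N`. -/
def eSubGr (e : A) (gr : ℤ → Submodule k N) (c : ℤ) : Submodule k ↥(eSub k A N e) :=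
  (gr c).comap (eSub k A N e).subtype

end ESubGrading

section Instances

variable (n : ℕ) (β : I → ℕ) (Λ : I → ℕ)

noncomputable instance : Module (bAlg C n β) (cAlg C Λ n β) :=
  Module.compHom _ (toC C (Λ := Λ) (n := n) (β := β)).toRingHom

instance : IsScalarTower k (bAlg C n β) (cAlg C Λ n β) := by
  constructor
  intro c s m
  show (toC C (c • s)) * m = c • (toC C s * m)
  rw [map_smul, Algebra.smul_mul_assoc]

end Instances


end KLR
namespace KLR

open scoped TensorProduct

variable {k : Type} [Field k] {I : Type} [Fintype I] [DecidableEq I] (C : CartanDatum k I)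

/-- `⟨h_i, β⟩ = Σ_j k_j a_{ij}`. -/
def pairH (i : I) (β : I → ℕ) : ℤ := ∑ j, (β j : ℤ) * C.a i j

/-- `(α_i, β) = Σ_j k_j (α_i, α_j)`. -/
def pairB (i : I) (β : I → ℕ) : ℤ := ∑ j, (β j : ℤ) * B C i j

/-- The ordered product `τ_1 τ_2 ⋯ τ_n` in `R(β+α_i)`-type quotients. -/
noncomputable def tauProd (n : ℕ) (γ : I → ℕ) : bAlg C (n + 1) γ :=
  (List.ofFn (fun l : Fin n => toB C (Tt C l.val (Nat.succ_lt_succ l.isLt)))).prod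

/-- The right ideal `Ae` as a `k`-submodule. -/
noncomputable def rId {A : Type} [Ring A] [Algebra k A] (e : A) : Submodule k A :=
  LinearMap.range (LinearMap.mulRight k e)

/-- The left ideal `eA` as a `k`-submodule. -/
noncomputable def lId {A : Type} [Ring A] [Algebra k A] (e : A) : Submodule k A :=
  LinearMap.range (LinearMap.mulLeft k e)

variable (k) in
/-- Characterization of the module structure on `eN` over `S'` acting through
the (non-unital) homomorphism `φ : S' → A`. -/
def IsEAction {A N S' : Type} [Ring A] [Algebra k A] [AddCommGroup N] [Module k N]
    [Module A N] [IsScalarTower k A N] [Ring S'] [Algebra k S']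
    (e : A) (φ : S' →ₙₐ[k] A) (inst : Module S' ↥(eSub k A N e)) : Prop :=
  letI := inst
  ∀ (r : S') (x : ↥(eSub k A N e)), ((r • x : ↥(eSub k A N e)) : N) = φ r • (x : N)

end KLR

namespace KLR

variable {k : Type} [Field k] {I : Type} [Fintype I] [DecidableEq I] (C : CartanDatum k I)

/-- The image of `e(β,α_i)` in `R(β+α_i)`. -/
noncomputable def eRb (n : ℕ) (β : I → ℕ) (i : I) : bAlg C (n + 1) (addA β i) :=
  toB C (eR C n β i)

/-- The image of `e(α_i,β)` in `R(β+α_i)`. -/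
noncomputable def eLb (n : ℕ) (β : I → ℕ) (i : I) : bAlg C (n + 1) (addA β i) :=
  toB C (eL C n β i)

/-- The image of `e(β-α_i,α_i)` in `R(β)`. -/
noncomputable def eDb (n : ℕ) (β : I → ℕ) (i : I) : bAlg C n β :=
  toB C (eD C n β i)

/-- The image of `e(β,α_i)` in `R^Λ(β+α_i)`. -/
noncomputable def eRc (Λ : I → ℕ) (n : ℕ) (β : I → ℕ) (i : I) :
    cAlg C Λ (n + 1) (addA β i) :=
  toCB C Λ (eR C n β i)

/-- The image of `e(β-α_i,α_i)` in `R^Λ(β)`. -/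
noncomputable def eDc (Λ : I → ℕ) (n : ℕ) (β : I → ℕ) (i : I) : cAlg C Λ n β :=
  toCB C Λ (eD C n β i)

end KLR

namespace KLR
variable {k : Type} [Field k] {I : Type} [Fintype I] [DecidableEq I]

section QelBasic
variable (C : CartanDatum k I) {A A' : Type} [Ring A] [Algebra k A] [Ring A'] [Algebra k A']

lemma Qel_map (F : A →ₐ[k] A') (i j : I) (u v : A) :
    F (Qel C i j u v) = Qel C i j (F u) (F v) := by
  unfold Qel
  split_ifs
  · simp
  · simp only [map_sum]
    refine Finset.sum_congr rfl fun p _ => Finset.sum_congr rfl fun q _ => ?_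
    split_ifs <;> simp

lemma Qdiff_map (F : A →ₐ[k] A') (i j : I) (u v w : A) :
    F (Qdiff C i j u v w) = Qdiff C i j (F u) (F v) (F w) := by
  unfold Qdiff
  split_ifs
  · simp
  · simp only [map_sum]
    refine Finset.sum_congr rfl fun p _ => Finset.sum_congr rfl fun q _ => ?_
    split_ifs <;> simp [map_sum]

@[simp] lemma Qel_self (i : I) (u v : A) : Qel C i i u v = 0 := by simp [Qel]
@[simp] lemma Qdiff_self (i : I) (u v w : A) : Qdiff C i i u v w = 0 := by simp [Qdiff]

lemma Qel_symm (i j : I) (u v : A) (h : Commute u v) : Qel C i j u v = Qel C j i v u := by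
  unfold Qel
  by_cases hij : i = j
  · subst hij; simp
  rw [if_neg hij, if_neg (Ne.symm hij), Finset.sum_comm]
  refine Finset.sum_congr rfl fun q _ => Finset.sum_congr rfl fun p _ => ?_
  have e1 := C.symmetrize i j
  by_cases h1 : C.d i * (p : ℤ) + C.d j * (q : ℤ) = -(C.d i * C.a i j)
  · rw [if_pos h1, if_pos (by rw [← e1, ← h1]; ring), C.t_symm i j p q, (h.pow_pow p q).eq]
  · rw [if_neg h1, if_neg (by rw [← e1]; intro h2; apply h1; rw [← h2]; ring)]

/-- `Qdiff` times the difference is the difference of the `Qel`. -/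
lemma Qdiff_mul (i j : I) (u v w : A) (huw : Commute u w) (huv : Commute u v)
    (hvw : Commute v w) :
    Qdiff C i j u v w * (u - w) = Qel C i j u v - Qel C i j w v := by
  unfold Qel Qdiff
  by_cases hij : i = j
  · simp [hij]
  simp only [if_neg hij]
  rw [Finset.sum_mul, ← Finset.sum_sub_distrib]
  refine Finset.sum_congr rfl fun p _ => ?_
  rw [Finset.sum_mul, ← Finset.sum_sub_distrib]
  refine Finset.sum_congr rfl fun q _ => ?_
  split_ifs
  · rw [← smul_sub, ← sub_mul, Algebra.smul_mul_assoc, mul_assoc,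
      ((huv.symm.sub_right hvw).pow_left q).eq, ← mul_assoc, huw.geom_sum₂_mul]
  · simp

/-- moving an element `T` with `T u = w T + s` past `Qel`. -/
lemma mul_Qel (i j : I) (T u v w e : A) (s : k) (huw : Commute u w)
    (hTv : T * v = v * T) (heu : Commute e u) (hev : Commute e v)
    (h : T * u * e = w * T * e + s • e) :
    T * Qel C i j u v * e = Qel C i j w v * T * e + s • (Qdiff C i j u v w * e) := by
  have hp : ∀ p : ℕ, T * u ^ p * e =
      w ^ p * T * e + s • ((∑ c ∈ Finset.range p, u ^ c * w ^ (p - 1 - c)) * e) := by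
    intro p
    induction p with
    | zero => simp
    | succ p ih =>
      have e1 : T * u ^ (p+1) * e = T * u ^ p * e * u := by
        rw [pow_succ, mul_assoc, mul_assoc _ e u, heu.eq]; simp only [mul_assoc]
      have e2 : ∑ c ∈ Finset.range (p+1), u ^ c * w ^ (p + 1 - 1 - c) =
          (∑ c ∈ Finset.range p, u ^ c * w ^ (p - 1 - c)) * u + w ^ p := by
        rw [Finset.sum_range_succ', Finset.sum_mul]
        congr 1
        · refine Finset.sum_congr rfl fun c hc => ?_
          rw [pow_succ, mul_assoc, mul_assoc, (huw.pow_right _).eq]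
          congr 3
          have := Finset.mem_range.1 hc
          omega
        · simp
      have e3 : w ^ p * T * e * u = w ^ p * (T * u * e) := by
        rw [mul_assoc _ e u, heu.eq]; simp only [mul_assoc]
      rw [e1, ih, e2, add_mul, e3, h, pow_succ, Algebra.smul_mul_assoc, mul_assoc _ e u, heu.eq]
      simp only [add_mul, mul_add, smul_add, mul_smul_comm, mul_assoc]
      abel
  unfold Qel Qdiff
  by_cases hij : i = j
  · simp [hij]
  simp only [if_neg hij]
  simp only [Finset.mul_sum, Finset.sum_mul, Finset.smul_sum, ← Finset.sum_add_distrib]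
  refine Finset.sum_congr rfl fun p _ => Finset.sum_congr rfl fun q _ => ?_
  split_ifs
  · have hTq : T * v ^ q = v ^ q * T := (show Commute T v from hTv).pow_right q
    have e1 : T * (u ^ p * v ^ q) * e = T * u ^ p * e * v ^ q := by
      rw [mul_assoc _ e, (hev.pow_right q).eq]; simp only [mul_assoc]
    have e2 : w ^ p * T * e * v ^ q = w ^ p * v ^ q * T * e := by
      rw [mul_assoc _ e, (hev.pow_right q).eq, mul_assoc, ← mul_assoc T, hTq]
      simp only [mul_assoc]
    rw [mul_smul_comm, smul_mul_assoc, e1, hp, add_mul, e2]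
    simp only [smul_add, smul_mul_assoc, Finset.sum_mul, ← Finset.smul_sum]
    rw [smul_comm s]
    congr 3
    refine Finset.sum_congr rfl fun c _ => ?_
    rw [mul_assoc _ e, (hev.pow_right q).eq]; simp only [mul_assoc]
  · simp

lemma Qdiff_symm (i j : I) (u v w : A) (huw : Commute u w) :
    Qdiff C i j u v w = Qdiff C i j w v u := by
  unfold Qdiff
  split_ifs
  · rfl
  refine Finset.sum_congr rfl fun p _ => Finset.sum_congr rfl fun q _ => ?_
  split_ifs
  · congr 2
    rw [← Finset.sum_range_reflect]
    refine Finset.sum_congr rfl fun c hc => ?_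
    have := Finset.mem_range.1 hc
    rw [(huw.pow_pow _ _).eq, show p - 1 - (p - 1 - c) = c by omega]
  · rfl

lemma Qel_commute (i j : I) (u v z : A) (h1 : Commute z u) (h2 : Commute z v) :
    Commute z (Qel C i j u v) := by
  unfold Qel
  split_ifs
  · exact Commute.zero_right _
  refine Commute.sum_right _ _ _ fun p _ => Commute.sum_right _ _ _ fun q _ => ?_
  split_ifs
  · exact ((h1.pow_right p).mul_right (h2.pow_right q)).smul_right _
  · exact Commute.zero_right _

lemma Qdiff_commute (i j : I) (u v w z : A) (h1 : Commute z u) (h2 : Commute z v)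
    (h3 : Commute z w) : Commute z (Qdiff C i j u v w) := by
  unfold Qdiff
  split_ifs
  · exact Commute.zero_right _
  refine Commute.sum_right _ _ _ fun p _ => Commute.sum_right _ _ _ fun q _ => ?_
  split_ifs
  · exact ((Commute.sum_right _ _ _ fun c _ =>
      (h1.pow_right c).mul_right (h3.pow_right _)).mul_right (h2.pow_right q)).smul_right _
  · exact Commute.zero_right _

lemma Qel_mem (S : Subalgebra k A) (i j : I) (u v : A) (h1 : u ∈ S) (h2 : v ∈ S) :
    Qel C i j u v ∈ S := by
  have := Qel_map C S.val i j ⟨u, h1⟩ ⟨v, h2⟩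
  simp only [Subalgebra.coe_val] at this
  rw [← this]; exact Subtype.mem _

lemma Qdiff_mem (S : Subalgebra k A) (i j : I) (u v w : A) (h1 : u ∈ S) (h2 : v ∈ S)
    (h3 : w ∈ S) : Qdiff C i j u v w ∈ S := by
  have := Qdiff_map C S.val i j ⟨u, h1⟩ ⟨v, h2⟩ ⟨w, h3⟩
  simp only [Subalgebra.coe_val] at this
  rw [← this]; exact Subtype.mem _

/-- `Q_{ij}(u,v) = c u^m + v * (stuff)` with `c ≠ 0`. -/
lemma Qel_lead (i j : I) (hij : i ≠ j) (u v : A) (huv : Commute u v) :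
    ∃ (c : k) (m : ℕ) (s : A), c ≠ 0 ∧ Commute u s ∧ Commute v s ∧
      Qel C i j u v = c • u ^ m + v * s := by
  refine ⟨C.t i j (-(C.a i j)).toNat 0, (-(C.a i j)).toNat,
    ∑ p ∈ Finset.range ((-(C.a i j)).toNat + 1), ∑ q ∈ Finset.range (-(C.a j i)).toNat,
      if C.d i * (p : ℤ) + C.d j * ((q + 1 : ℕ) : ℤ) = -(C.d i * C.a i j) then
        C.t i j p (q + 1) • (u ^ p * v ^ q) else 0, C.t_lead i j hij, ?_, ?_, ?_⟩
  · refine Commute.sum_right _ _ _ fun p _ => Commute.sum_right _ _ _ fun q _ => ?_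
    split_ifs
    · exact (((Commute.refl u).pow_right p).mul_right (huv.pow_right q)).smul_right _
    · exact Commute.zero_right _
  · refine Commute.sum_right _ _ _ fun p _ => Commute.sum_right _ _ _ fun q _ => ?_
    split_ifs
    · exact ((huv.symm.pow_right p).mul_right ((Commute.refl v).pow_right q)).smul_right _
    · exact Commute.zero_right _
  · unfold Qel
    rw [if_neg hij]
    have e1 : ∀ p ∈ Finset.range ((-(C.a i j)).toNat + 1),
        (∑ q ∈ Finset.range ((-(C.a j i)).toNat + 1),
          if C.d i * (p : ℤ) + C.d j * (q : ℤ) = -(C.d i * C.a i j) then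
            C.t i j p q • (u ^ p * v ^ q) else 0) =
        v * (∑ q ∈ Finset.range (-(C.a j i)).toNat,
          if C.d i * (p : ℤ) + C.d j * ((q + 1 : ℕ) : ℤ) = -(C.d i * C.a i j) then
            C.t i j p (q + 1) • (u ^ p * v ^ q) else 0) +
        (if p = (-(C.a i j)).toNat then C.t i j p 0 • u ^ p else 0) := by
      intro p _
      rw [Finset.sum_range_succ', Finset.mul_sum]
      congr 1
      · refine Finset.sum_congr rfl fun q _ => ?_
        split_ifs
        · rw [mul_smul_comm, ← mul_assoc, (huv.symm.pow_right p).eq, mul_assoc, pow_succ']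
        · simp
      · have hd := C.d_pos i
        have ha := C.a_nonpos i j hij
        have : (C.d i * (p : ℤ) + C.d j * ((0 : ℕ) : ℤ) = -(C.d i * C.a i j)) ↔
            p = (-(C.a i j)).toNat := by
          constructor
          · intro h
            have h2 : C.d i * (p : ℤ) = C.d i * (-(C.a i j)) := by
              simp only [Nat.cast_zero, mul_zero, add_zero] at h; rw [h]; ring
            have h3 := mul_left_cancel₀ (ne_of_gt hd) h2
            omega
          · intro h
            have h3 : (p : ℤ) = -(C.a i j) := by omega
            rw [h3]; simp
        by_cases hp : p = (-(C.a i j)).toNat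
        · rw [if_pos (this.2 hp), if_pos hp]; simp
        · rw [if_neg (fun h => hp (this.1 h)), if_neg hp]
    rw [Finset.sum_congr rfl e1, Finset.sum_add_distrib, ← Finset.mul_sum, add_comm]
    congr 1
    rw [Finset.sum_ite_eq' _ _ (fun p => C.t i j p 0 • u ^ p)]
    simp

end QelBasic
end KLR

namespace KLR
variable {k : Type} [Field k] {I : Type} [Fintype I] [DecidableEq I]

/-- swap of the entries `l, l+1`. -/
def sw {n : ℕ} (ν : Fin n → I) (l : ℕ) (h : l + 1 < n) : Fin n → I :=
  ν ∘ Equiv.swap (⟨l, Nat.lt_of_succ_lt h⟩ : Fin n) ⟨l + 1, h⟩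

lemma sw_apply {n : ℕ} (ν : Fin n → I) (l : ℕ) (h : l + 1 < n) (a : ℕ) (ha : a < n) :
    sw ν l h ⟨a, ha⟩ = if a = l then ν ⟨l + 1, h⟩ else if a = l + 1 then ν ⟨l, by omega⟩
      else ν ⟨a, ha⟩ := by
  unfold sw
  simp only [Function.comp, Equiv.swap_apply_def, Fin.mk.injEq]
  split_ifs <;> rfl

lemma sw_left {n : ℕ} (ν : Fin n → I) (l : ℕ) (h : l + 1 < n) :
    sw ν l h ⟨l, by omega⟩ = ν ⟨l + 1, h⟩ := by simp [sw_apply]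

lemma sw_right {n : ℕ} (ν : Fin n → I) (l : ℕ) (h : l + 1 < n) :
    sw ν l h ⟨l + 1, h⟩ = ν ⟨l, by omega⟩ := by simp [sw_apply]

lemma sw_sw {n : ℕ} (ν : Fin n → I) (l : ℕ) (h : l + 1 < n) : sw (sw ν l h) l h = ν := by
  funext ⟨a, ha⟩
  simp only [sw_apply]
  split_ifs <;> (try rfl) <;> (try omega) <;> (try (congr 1; simp; omega))

/-- A family of elements satisfying the KLR relations. -/
structure IsKLR (C : CartanDatum k I) (n : ℕ) {L : Type} [Ring L] [Algebra k L]
    (E : (Fin n → I) → L) (X : ℕ → L) (T : ℕ → L) : Prop where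
  ee : ∀ ν ν', E ν * E ν' = if ν = ν' then E ν else 0
  esum : ∑ ν, E ν = 1
  xx : ∀ a b, a < n → b < n → X a * X b = X b * X a
  xe : ∀ a ν, a < n → X a * E ν = E ν * X a
  te : ∀ l (h : l + 1 < n) ν, T l * E ν = E (sw ν l h) * T l
  tt : ∀ l l', l + 1 < n → l' + 1 < n → l + 1 < l' → T l * T l' = T l' * T l
  tsq : ∀ l (h : l + 1 < n) ν, T l * T l * E ν =
    Qel C (ν ⟨l, by omega⟩) (ν ⟨l + 1, h⟩) (X l) (X (l + 1)) * E ν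
  tx1 : ∀ l (h : l + 1 < n) ν, T l * X l * E ν = X (l + 1) * T l * E ν -
    (if ν ⟨l, by omega⟩ = ν ⟨l + 1, h⟩ then E ν else 0)
  tx2 : ∀ l (h : l + 1 < n) ν, T l * X (l + 1) * E ν = X l * T l * E ν +
    (if ν ⟨l, by omega⟩ = ν ⟨l + 1, h⟩ then E ν else 0)
  tx : ∀ l m, l + 1 < n → m < n → m ≠ l → m ≠ l + 1 → T l * X m = X m * T l
  braid : ∀ l (h : l + 2 < n) ν, (T (l + 1) * T l * T (l + 1) - T l * T (l + 1) * T l) * E ν =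
    if ν ⟨l, by omega⟩ = ν ⟨l + 2, h⟩ then
      Qdiff C (ν ⟨l, by omega⟩) (ν ⟨l + 1, by omega⟩) (X l) (X (l + 1)) (X (l + 2)) * E ν else 0

section
variable (C : CartanDatum k I)

/-- total version of the generators -/
noncomputable def XN (n : ℕ) (a : ℕ) : Alg C n := if h : a < n then Xx C ⟨a, h⟩ else 0
noncomputable def TN (n : ℕ) (l : ℕ) : Alg C n := if h : l + 1 < n then Tt C l h else 0

lemma XN_eq {n a : ℕ} (h : a < n) : XN C n a = Xx C ⟨a, h⟩ := dif_pos h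
lemma TN_eq {n a : ℕ} (h : a + 1 < n) : TN C n a = Tt C a h := dif_pos h

variable {C} in
lemma eq_of_mul_E {n : ℕ} {L : Type} [Ring L] {E : (Fin n → I) → L} (hE : ∑ ν, E ν = 1)
    {a b : L} (h : ∀ ν, a * E ν = b * E ν) : a = b := by
  rw [← mul_one a, ← mul_one b, ← hE, Finset.mul_sum, Finset.mul_sum]
  exact Finset.sum_congr rfl fun ν _ => h ν

lemma alg_isKLR (n : ℕ) : IsKLR C n (Ee C (n := n)) (XN C n) (TN C n) := by
  have hsum : ∑ ν, Ee C (n := n) ν = 1 := by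
    have := RingQuot.mkAlgHom_rel k (Rel.esum (C := C) (n := n))
    rw [map_sum, map_one] at this
    exact this
  have htx : ∀ l (h : l + 1 < n) (m : ℕ) (hm : m < n) ν,
      (Tt C l h * Xx C ⟨m, hm⟩ - Xx C (Equiv.swap (⟨l, Nat.lt_of_succ_lt h⟩ : Fin n) ⟨l + 1, h⟩
        ⟨m, hm⟩) * Tt C l h) * Ee C ν = if m = l ∧ ν ⟨l, by omega⟩ = ν ⟨l + 1, h⟩ then -(Ee C ν)
          else if m = l + 1 ∧ ν ⟨l, by omega⟩ = ν ⟨l + 1, h⟩ then Ee C ν else 0 := by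
    intro l h m hm ν
    have := RingQuot.mkAlgHom_rel k (Rel.taux (C := C) l h ⟨m, hm⟩ ν)
    simp only [map_mul, map_sub, apply_ite (RingQuot.mkAlgHom k (Rel C n)), map_neg, map_zero,
      Fin.mk.injEq] at this
    exact this
  constructor
  · intro ν ν'
    have := RingQuot.mkAlgHom_rel k (Rel.ee (C := C) ν ν')
    simp only [map_mul, apply_ite (RingQuot.mkAlgHom k (Rel C n)), map_zero] at this
    exact this
  · exact hsum
  · intro a b ha hb
    have := RingQuot.mkAlgHom_rel k (Rel.xx (C := C) ⟨a, ha⟩ ⟨b, hb⟩)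
    simp only [map_mul] at this
    rw [XN_eq C ha, XN_eq C hb]; exact this
  · intro a ν ha
    have := RingQuot.mkAlgHom_rel k (Rel.xe (C := C) ⟨a, ha⟩ ν)
    simp only [map_mul] at this
    rw [XN_eq C ha]; exact this
  · intro l h ν
    have := RingQuot.mkAlgHom_rel k (Rel.taue (C := C) l h ν)
    simp only [map_mul] at this
    rw [TN_eq C h]; exact this
  · intro l l' h h' hl
    have := RingQuot.mkAlgHom_rel k (Rel.tautau (C := C) l h l' h' (Or.inl hl))
    simp only [map_mul] at this
    rw [TN_eq C h, TN_eq C h']; exact this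
  · intro l h ν
    have := RingQuot.mkAlgHom_rel k (Rel.tausq (C := C) l h ν)
    simp only [map_mul, Qel_map, pow_two] at this
    rw [TN_eq C h, XN_eq C h, XN_eq C (by omega : l < n)]; exact this
  · intro l h ν
    have := htx l h l (by omega) ν
    simp only [Equiv.swap_apply_left, true_and, Nat.left_eq_add, one_ne_zero, false_and,
      if_false] at this
    rw [TN_eq C h, XN_eq C h, XN_eq C (by omega : l < n)]
    rw [sub_mul] at this
    split_ifs at this ⊢
    · rw [sub_eq_iff_eq_add.1 this]; abel
    · rw [sub_eq_iff_eq_add.1 this]; abel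
  · intro l h ν
    have := htx l h (l+1) h ν
    simp only [Equiv.swap_apply_right, true_and, Nat.add_eq_left, one_ne_zero, false_and,
      if_false] at this
    rw [TN_eq C h, XN_eq C h, XN_eq C (by omega : l < n)]
    rw [sub_mul] at this
    rw [sub_eq_iff_eq_add.1 this, add_comm]
  · intro l m h hm h1 h2
    refine eq_of_mul_E hsum fun ν => ?_
    have := htx l h m hm ν
    rw [if_neg (by tauto), if_neg (by tauto), Equiv.swap_apply_of_ne_of_ne (by simpa using h1)
      (by simpa using h2), sub_mul, sub_eq_zero] at this
    rw [TN_eq C h, XN_eq C hm]; exact this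
  · intro l h ν
    have := RingQuot.mkAlgHom_rel k (Rel.braid (C := C) l h ν)
    simp only [map_mul, map_sub, apply_ite (RingQuot.mkAlgHom k (Rel C n)), map_zero,
      Qdiff_map] at this
    rw [TN_eq C (show l + 1 + 1 < n from h), TN_eq C (show l + 1 < n by omega), XN_eq C h,
      XN_eq C (by omega : l < n), XN_eq C (by omega : l + 1 < n)]; exact this

variable {C} in
lemma IsKLR.map {n : ℕ} {L L' : Type} [Ring L] [Algebra k L] [Ring L'] [Algebra k L']
    {E : (Fin n → I) → L} {X : ℕ → L} {T : ℕ → L} (H : IsKLR C n E X T) (F : L →ₐ[k] L') :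
    IsKLR C n (fun ν => F (E ν)) (fun a => F (X a)) (fun l => F (T l)) := by
  constructor
  · intro ν ν'; rw [← map_mul, H.ee]; split_ifs <;> simp
  · rw [← map_sum, H.esum, map_one]
  · intro a b ha hb; rw [← map_mul, H.xx a b ha hb, map_mul]
  · intro a b ha; rw [← map_mul, H.xe a b ha, map_mul]
  · intro l h ν; rw [← map_mul, H.te l h, map_mul]
  · intro l l' h h' hl; rw [← map_mul, H.tt l l' h h' hl, map_mul]
  · intro l h ν; rw [← map_mul, ← map_mul, H.tsq l h, map_mul, Qel_map]
  · intro l h ν; rw [← map_mul, ← map_mul, H.tx1 l h, map_sub, map_mul, map_mul]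
    split_ifs <;> simp
  · intro l h ν; rw [← map_mul, ← map_mul, H.tx2 l h, map_add, map_mul, map_mul]
    split_ifs <;> simp
  · intro l m h hm h1 h2; rw [← map_mul, H.tx l m h hm h1 h2, map_mul]
  · intro l h ν
    have := congrArg F (H.braid l h ν)
    rw [map_mul, map_sub] at this
    simp only [map_mul] at this
    rw [this]
    split_ifs
    · rw [map_mul, Qdiff_map]
    · simp

/-- free-algebra level map -/
noncomputable def genMap {n : ℕ} {L : Type} [Ring L] [Algebra k L]
    (E : (Fin n → I) → L) (X : ℕ → L) (T : ℕ → L) : FA k I n →ₐ[k] L :=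
  FreeAlgebra.lift k (fun g => match g with
    | Gen.e ν => E ν
    | Gen.x a => X a
    | Gen.tau l _ => T l)

section
variable {n : ℕ} {L : Type} [Ring L] [Algebra k L]
    (E : (Fin n → I) → L) (X : ℕ → L) (T : ℕ → L)
@[simp] lemma genMap_e (ν) : genMap (k := k) E X T (ge k ν) = E ν := by simp [genMap, ge]
@[simp] lemma genMap_x (a) : genMap (k := k) E X T (gx k a) = X a := by simp [genMap, gx]
@[simp] lemma genMap_t (l) (h) : genMap (k := k) E X T (gt k l h) = T l := by simp [genMap, gt]
end

variable {C} in
lemma IsKLR.rel {n : ℕ} {L : Type} [Ring L] [Algebra k L]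
    {E : (Fin n → I) → L} {X : ℕ → L} {T : ℕ → L} (H : IsKLR C n E X T) ⦃x y : FA k I n⦄
    (h : Rel C n x y) : genMap (k := k) E X T x = genMap E X T y := by
  cases h with
  | ee ν ν' =>
    simp only [map_mul, genMap_e, apply_ite (genMap (k := k) E X T), map_zero]
    exact H.ee ν ν'
  | esum => simp [H.esum]
  | xx a b => simp [H.xx a b a.2 b.2]
  | xe a ν => simp [H.xe a ν a.2]
  | taue l h ν => simp [H.te l h ν]; rfl
  | tautau l h l' h' hl =>
    rcases hl with hl | hl
    · simp [H.tt l l' h h' hl]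
    · simp [H.tt l' l h' h hl]
  | tausq l h ν => simp [Qel_map, pow_two, H.tsq l h ν]
  | taux l h m ν =>
    obtain ⟨m, hm⟩ := m
    simp only [map_mul, map_sub, genMap_t, genMap_x, genMap_e, apply_ite (genMap (k := k) E X T),
      map_neg, map_zero, Fin.mk.injEq]
    by_cases h1 : m = l
    · subst h1
      rw [Equiv.swap_apply_left, sub_mul, H.tx1 m h ν]
      simp only [true_and]
      split_ifs with h1 h2
      · simp
      · exact absurd h2.1 (by omega)
      · simp
    by_cases h2 : m = l + 1
    · subst h2
      rw [Equiv.swap_apply_right, sub_mul, H.tx2 l h ν]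
      simp
    rw [Equiv.swap_apply_of_ne_of_ne (by simpa using h1) (by simpa using h2), H.tx l m h hm h1 h2]
    simp [h1, h2]
  | braid l h ν =>
    simp only [map_mul, map_sub, genMap_t, genMap_x, genMap_e, apply_ite (genMap (k := k) E X T),
      map_zero, Qdiff_map]
    exact H.braid l h ν

variable {C} in
/-- The representation given by a KLR family. -/
noncomputable def IsKLR.hom {n : ℕ} {L : Type} [Ring L] [Algebra k L]
    {E : (Fin n → I) → L} {X : ℕ → L} {T : ℕ → L} (H : IsKLR C n E X T) : Alg C n →ₐ[k] L :=
  RingQuot.liftAlgHom k ⟨genMap E X T, H.rel⟩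

section
variable {n : ℕ} {L : Type} [Ring L] [Algebra k L]
    {E : (Fin n → I) → L} {X : ℕ → L} {T : ℕ → L} (H : IsKLR C n E X T)
lemma IsKLR.hom_E (ν) : H.hom (Ee C ν) = E ν := by
  simp [IsKLR.hom, Ee]
lemma IsKLR.hom_X (a) (h : a < n) : H.hom (XN C n a) = X a := by
  rw [XN_eq C h]
  simp [IsKLR.hom, Xx]
lemma IsKLR.hom_T (a) (h : a + 1 < n) : H.hom (TN C n a) = T a := by
  rw [TN_eq C h]
  simp [IsKLR.hom, Tt]
end

lemma mkFA (n : ℕ) (x : FA k I n) :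
    RingQuot.mkAlgHom k (Rel C n) x = genMap (k := k) (Ee C) (XN C n) (TN C n) x := by
  have : RingQuot.mkAlgHom k (Rel C n) = genMap (k := k) (Ee C) (XN C n) (TN C n) := by
    apply FreeAlgebra.hom_ext
    funext g
    cases g with
    | e ν => simp [genMap, Ee, ge]
    | x a => simp [genMap, XN_eq C a.2, Xx, gx]
    | tau l h => simp [genMap, TN_eq C h, Tt, gt]
  rw [this]

/-- induction principle for `Alg C n`. -/
lemma alg_induction {n : ℕ} {P : Alg C n → Prop} (hc : ∀ c : k, P (algebraMap k _ c))
    (hE : ∀ ν, P (Ee C ν)) (hX : ∀ a, a < n → P (XN C n a)) (hT : ∀ l, l + 1 < n → P (TN C n l))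
    (ha : ∀ x y, P x → P y → P (x + y)) (hm : ∀ x y, P x → P y → P (x * y)) (x) : P x := by
  obtain ⟨y, rfl⟩ := RingQuot.mkAlgHom_surjective k (Rel C n) x
  induction y using FreeAlgebra.induction with
  | grade0 c => rw [AlgHom.commutes]; exact hc c
  | grade1 g =>
    cases g with
    | e ν => exact hE ν
    | x a => have := hX a a.2; rw [XN_eq C a.2] at this; exact this
    | tau l h => have := hT l h; rw [TN_eq C h] at this; exact this
  | mul a b iha ihb => rw [map_mul]; exact hm _ _ iha ihb
  | add a b iha ihb => rw [map_add]; exact ha _ _ iha ihb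

end
end KLR

set_option linter.unusedSectionVars false
namespace KLR
variable {k : Type} [Field k] {I : Type} [Fintype I] [DecidableEq I]

/-- `Σ_ν c(ν) e(ν)`. -/
def sS {n : ℕ} {L : Type} [Ring L] (E : (Fin n → I) → L) (c : (Fin n → I) → L) : L :=
  ∑ ν, c ν * E ν

/-- A KLR family together with a commuting invertible-shift variable `t`. -/
structure Loc (C : CartanDatum k I) (n : ℕ) {L : Type} [Ring L] [Algebra k L]
    (E : (Fin n → I) → L) (X T : ℕ → L) (t : L) (Y : ℕ → L) : Prop extends IsKLR C n E X T where
  tE : ∀ ν, Commute t (E ν)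
  tX : ∀ a, a < n → Commute t (X a)
  tT : ∀ l, l + 1 < n → Commute t (T l)
  Y1 : ∀ a, a < n → Y a * (t - X a) = 1
  Y2 : ∀ a, a < n → (t - X a) * Y a = 1

section
variable {C : CartanDatum k I} {n : ℕ} {L : Type} [Ring L] [Algebra k L]
    {E : (Fin n → I) → L} {X T : ℕ → L} {t : L} {Y : ℕ → L}

lemma IsKLR.sS_mul_E (H : IsKLR C n E X T) (c : (Fin n → I) → L) (ν) :
    sS E c * E ν = c ν * E ν := by
  simp only [sS, Finset.sum_mul, mul_assoc, H.ee]
  rw [Finset.sum_eq_single ν]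
  · simp
  · intro b _ hb; simp [hb]
  · simp

lemma IsKLR.sS_mul_E' (H : IsKLR C n E X T) (c : (Fin n → I) → L) (ν) (z : L) :
    sS E c * (E ν * z) = c ν * (E ν * z) := by
  rw [← mul_assoc, H.sS_mul_E, mul_assoc]

lemma IsKLR.sS_comm_E (H : IsKLR C n E X T) (c : (Fin n → I) → L)
    (hc : ∀ μ ν, Commute (c μ) (E ν)) (ν) : Commute (sS E c) (E ν) := by
  show _ = _
  rw [H.sS_mul_E]
  simp only [sS, Finset.mul_sum]
  rw [Finset.sum_eq_single ν]
  · rw [← mul_assoc, ← (hc ν ν).eq, mul_assoc, H.ee, if_pos rfl]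
  · intro b _ hb; rw [← mul_assoc, ← (hc b ν).eq, mul_assoc, H.ee, if_neg (Ne.symm hb), mul_zero]
  · simp

lemma IsKLR.E_sS (H : IsKLR C n E X T) (c : (Fin n → I) → L)
    (hc : ∀ μ ν, Commute (c μ) (E ν)) (ν) : E ν * sS E c = c ν * E ν := by
  rw [← (H.sS_comm_E c hc ν).eq, H.sS_mul_E]

lemma IsKLR.sS_mul (H : IsKLR C n E X T) (c d : (Fin n → I) → L)
    (hd : ∀ μ ν, Commute (d μ) (E ν)) : sS E c * sS E d = sS E (fun ν => c ν * d ν) := by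
  refine eq_of_mul_E H.esum fun ν => ?_
  rw [mul_assoc, H.sS_mul_E, H.sS_mul_E, (hd ν ν).eq, H.sS_mul_E', mul_assoc, (hd ν ν).eq]

lemma sS_add (c d : (Fin n → I) → L) : sS E c + sS E d = sS E (fun ν => c ν + d ν) := by
  simp [sS, add_mul, Finset.sum_add_distrib]

lemma sS_sub (c d : (Fin n → I) → L) : sS E c - sS E d = sS E (fun ν => c ν - d ν) := by
  simp [sS, sub_mul, Finset.sum_sub_distrib]

lemma IsKLR.sS_one (H : IsKLR C n E X T) : sS E (fun _ => 1) = 1 := by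
  simp [sS, H.esum]

lemma sS_zero : sS E (fun _ => 0) = 0 := by
  simp [sS]

lemma IsKLR.sS_commute (H : IsKLR C n E X T) (c d : (Fin n → I) → L)
    (hc : ∀ μ ν, Commute (c μ) (E ν)) (hd : ∀ μ ν, Commute (d μ) (E ν))
    (h : ∀ ν, Commute (c ν) (d ν)) : Commute (sS E c) (sS E d) := by
  show _ = _
  rw [H.sS_mul _ _ hd, H.sS_mul _ _ hc]
  congr 1; funext ν; exact (h ν).eq

lemma sS_commute_left (z : L) (c : (Fin n → I) → L) (hz : ∀ ν, Commute z (E ν))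
    (h : ∀ ν, Commute z (c ν)) : Commute z (sS E c) :=
  Commute.sum_right _ _ _ fun ν _ => (h ν).mul_right (hz ν)

lemma IsKLR.T_sS (H : IsKLR C n E X T) (l : ℕ) (h : l + 1 < n) (c d g : (Fin n → I) → L)
    (hcd : ∀ ν, T l * c ν * E ν = d (sw ν l h) * T l * E ν + g ν * E ν) :
    T l * sS E c = sS E d * T l + sS E g := by
  refine eq_of_mul_E H.esum fun ν => ?_
  rw [add_mul, mul_assoc, H.sS_mul_E, H.sS_mul_E, mul_assoc, H.te l h, H.sS_mul_E', ← H.te l h,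
    ← mul_assoc, hcd ν, mul_assoc (d _)]

/-- An element commuting with the invertible `t - X a` commutes with `Y a`. -/
lemma Loc.Y_commute (H : Loc C n E X T t Y) {a : ℕ} (ha : a < n) {z : L} (h1 : Commute z t)
    (h2 : Commute z (X a)) : Commute z (Y a) := by
  have h3 : Commute z (t - X a) := h1.sub_right h2
  show z * Y a = Y a * z
  calc z * Y a = (Y a * (t - X a)) * z * Y a := by rw [H.Y1 a ha, one_mul]
    _ = Y a * ((z * (t - X a))) * Y a := by rw [h3.eq]; simp only [mul_assoc]
    _ = Y a * z * ((t - X a) * Y a) := by simp only [mul_assoc]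
    _ = Y a * z := by rw [H.Y2 a ha, mul_one]

lemma Loc.YE (H : Loc C n E X T t Y) {a : ℕ} (ha : a < n) (ν) : Commute (Y a) (E ν) :=
  (H.Y_commute ha (H.tE ν).symm (H.xe a ν ha).symm).symm

lemma Loc.XX (H : Loc C n E X T t Y) {a b : ℕ} (ha : a < n) (hb : b < n) : Commute (X a) (X b) :=
  H.xx a b ha hb

lemma Loc.XY (H : Loc C n E X T t Y) {a b : ℕ} (ha : a < n) (hb : b < n) : Commute (X a) (Y b) :=
  H.Y_commute hb (H.tX a ha).symm (H.XX ha hb)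

lemma Loc.tY (H : Loc C n E X T t Y) {b : ℕ} (hb : b < n) : Commute t (Y b) :=
  H.Y_commute hb (Commute.refl _) (H.tX b hb)

lemma Loc.YY (H : Loc C n E X T t Y) {a b : ℕ} (ha : a < n) (hb : b < n) : Commute (Y a) (Y b) :=
  H.Y_commute hb (H.tY ha).symm (H.XY hb ha).symm

variable (E Y) in
/-- `α_l` -/
def al (i : I) (l : ℕ) : L :=
  if h : l < n then sS E (fun ν => if ν ⟨l, h⟩ = i then Y l else 0) else 0
variable (E) in
/-- `δ_l` -/
def de (i : I) (l : ℕ) : L :=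
  if h : l < n then sS E (fun ν => if ν ⟨l, h⟩ = i then 0 else 1) else 0
variable (C E X t) in
/-- `Q_l` -/
def qq (i : I) (l : ℕ) : L :=
  if h : l < n then sS E (fun ν => Qel C i (ν ⟨l, h⟩) t (X l)) else 0
variable (C E X t) in
/-- `D_l` -/
def dd (i : I) (l : ℕ) : L :=
  if h : l + 1 < n then sS E (fun ν => if ν ⟨l, by omega⟩ = ν ⟨l+1, h⟩ then
    Qdiff C (ν ⟨l, by omega⟩) i (X l) t (X (l+1)) else 0) else 0

variable (i : I)

end
end KLR

set_option linter.unusedSectionVars false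
namespace KLR
variable {k : Type} [Field k] {I : Type} [Fintype I] [DecidableEq I]
section
variable {C : CartanDatum k I} {n : ℕ} {L : Type} [Ring L] [Algebra k L]
    {E : (Fin n → I) → L} {X T : ℕ → L} {t : L} {Y : ℕ → L}

variable (k E X t Y) in
/-- The commutative subalgebra of polynomial elements. -/
def pol : Subalgebra k L :=
  Algebra.adjoin k (insert t (Set.range E ∪ X '' {a | a < n} ∪ Y '' {a | a < n}))

lemma Loc.commute_of_mem (H : Loc C n E X T t Y) {a b : L} (ha : a ∈ pol k E X t Y)
    (hb : b ∈ pol k E X t Y) : Commute a b := by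
  refine Algebra.commute_of_mem_adjoin_of_forall_mem_commute hb fun b hb => ?_
  refine (Algebra.commute_of_mem_adjoin_of_forall_mem_commute ha fun a ha => ?_).symm
  have key : ∀ c ∈ (insert t (Set.range E ∪ X '' {a | a < n} ∪ Y '' {a | a < n})),
      Commute c t ∧ (∀ ν, Commute c (E ν)) ∧ (∀ x, x < n → Commute c (X x)) := by
    rintro c (rfl | ((⟨ν, rfl⟩ | ⟨x, hx, rfl⟩) | ⟨x, hx, rfl⟩))
    · exact ⟨Commute.refl _, H.tE, H.tX⟩
    · refine ⟨(H.tE ν).symm, fun μ => ?_, fun x hx => (H.xe x ν hx).symm⟩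
      show _ = _
      rw [H.ee, H.ee]
      by_cases h : ν = μ
      · subst h; rfl
      · rw [if_neg h, if_neg (Ne.symm h)]
    · exact ⟨(H.tX x hx).symm, fun μ => H.xe x μ hx, fun y hy => H.XX hx hy⟩
    · exact ⟨(H.tY hx).symm, fun μ => H.YE hx μ, fun y hy => (H.XY hy hx).symm⟩
  obtain ⟨k1, k2, k3⟩ := key b hb
  rcases ha with (rfl | ((⟨ν, rfl⟩ | ⟨x, hx, rfl⟩) | ⟨x, hx, rfl⟩))
  · exact k1
  · exact k2 _
  · exact k3 _ hx
  · exact H.Y_commute hx k1 (k3 _ hx)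

lemma pol_t : t ∈ pol k E X t Y := Algebra.subset_adjoin (by simp)
lemma pol_E (ν) : E ν ∈ pol k E X t Y := Algebra.subset_adjoin (by simp)
lemma pol_X {a} (h : a < n) : X a ∈ pol k E X t Y :=
  Algebra.subset_adjoin (Or.inr (Or.inl (Or.inr ⟨a, h, rfl⟩)))
lemma pol_Y {a} (h : a < n) : Y a ∈ pol k E X t Y :=
  Algebra.subset_adjoin (Or.inr (Or.inr ⟨a, h, rfl⟩))
lemma pol_sS {c} (h : ∀ ν, c ν ∈ pol k E X t Y) : sS E c ∈ pol k E X t Y :=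
  Subalgebra.sum_mem _ fun ν _ => Subalgebra.mul_mem _ (h ν) (pol_E ν)

variable (i : I)

lemma pol_al (l : ℕ) : al E Y i l ∈ pol k E X t Y := by
  unfold al
  split_ifs with h
  · refine pol_sS fun ν => ?_
    split_ifs
    · exact pol_Y h
    · exact zero_mem _
  · exact zero_mem _
lemma pol_de (l : ℕ) : de E i l ∈ pol k E X t Y := by
  unfold de
  split_ifs with h
  · refine pol_sS fun ν => ?_
    split_ifs
    · exact zero_mem _
    · exact one_mem _
  · exact zero_mem _
lemma pol_qq (l : ℕ) : qq C E X t i l ∈ pol k E X t Y := by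
  unfold qq
  split_ifs with h
  · exact pol_sS fun ν => Qel_mem C _ _ _ _ _ pol_t (pol_X h)
  · exact zero_mem _
lemma pol_dd (l : ℕ) : dd C E X t i l ∈ pol k E X t Y := by
  unfold dd
  split_ifs with h
  · refine pol_sS fun ν => ?_
    split_ifs
    · exact Qdiff_mem C _ _ _ _ _ _ (pol_X (by omega)) pol_t (pol_X h)
    · exact zero_mem _
  · exact zero_mem _

lemma Loc.sS_mul' (H : Loc C n E X T t Y) {c d : (Fin n → I) → L}
    (hd : ∀ ν, d ν ∈ pol k E X t Y) : sS E c * sS E d = sS E (fun ν => c ν * d ν) :=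
  H.sS_mul _ _ fun μ ν => H.commute_of_mem (hd μ) (pol_E ν)

lemma Loc.E_al (H : Loc C n E X T t Y) {l : ℕ} (h : l < n) (ν) :
    al E Y i l * E ν = if ν ⟨l, h⟩ = i then Y l * E ν else 0 := by
  simp only [al, dif_pos h, H.sS_mul_E]; split_ifs <;> simp
lemma Loc.E_de (H : Loc C n E X T t Y) {l : ℕ} (h : l < n) (ν) :
    de E i l * E ν = if ν ⟨l, h⟩ = i then 0 else E ν := by
  simp only [de, dif_pos h, H.sS_mul_E]; split_ifs <;> simp
lemma Loc.E_qq (H : Loc C n E X T t Y) {l : ℕ} (h : l < n) (ν) :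
    qq C E X t i l * E ν = Qel C i (ν ⟨l, h⟩) t (X l) * E ν := by
  simp only [qq, dif_pos h, H.sS_mul_E]
lemma Loc.E_dd (H : Loc C n E X T t Y) {l : ℕ} (h : l + 1 < n) (ν) :
    dd C E X t i l * E ν = if ν ⟨l, by omega⟩ = ν ⟨l+1, h⟩ then
    Qdiff C (ν ⟨l, by omega⟩) i (X l) t (X (l+1)) * E ν else 0 := by
  simp only [dd, dif_pos h, H.sS_mul_E]; split_ifs <;> simp

lemma Loc.al_de (H : Loc C n E X T t Y) (l : ℕ) : al E Y i l * de E i l = 0 := by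
  by_cases h : l < n
  · refine eq_of_mul_E H.esum fun ν => ?_
    rw [mul_assoc, H.E_de i h]
    split_ifs with h1
    · simp
    · rw [H.E_al i h, if_neg h1, zero_mul]
  · simp [al, dif_neg h]

lemma Loc.al_qq (H : Loc C n E X T t Y) (l : ℕ) : al E Y i l * qq C E X t i l = 0 := by
  by_cases h : l < n
  · refine eq_of_mul_E H.esum fun ν => ?_
    rw [(H.commute_of_mem (pol_al i l) (pol_qq i l)).eq, mul_assoc, H.E_al i h]
    split_ifs with h1
    · rw [(H.YE h ν).eq, ← mul_assoc, H.E_qq i h, h1]; simp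
    · simp
  · simp [al, dif_neg h]

lemma Loc.de_qq (H : Loc C n E X T t Y) (l : ℕ) :
    de E i l * qq C E X t i l = qq C E X t i l := by
  by_cases h : l < n
  · refine eq_of_mul_E H.esum fun ν => ?_
    rw [(H.commute_of_mem (pol_de i l) (pol_qq i l)).eq, mul_assoc, H.E_de i h]
    split_ifs with h1
    · rw [H.E_qq i h, h1]; simp
    · rfl
  · simp [qq, dif_neg h]

lemma Loc.de_de (H : Loc C n E X T t Y) (l : ℕ) :
    de E i l * de E i l = de E i l := by
  by_cases h : l < n
  · refine eq_of_mul_E H.esum fun ν => ?_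
    rw [mul_assoc, H.E_de i h]
    split_ifs with h1
    · simp
    · rw [H.E_de i h, if_neg h1]
  · simp [de, dif_neg h]

lemma Loc.al_dd (H : Loc C n E X T t Y) (l : ℕ) :
    al E Y i l * dd C E X t i l = 0 := by
  by_cases h : l + 1 < n
  · refine eq_of_mul_E H.esum fun ν => ?_
    rw [(H.commute_of_mem (pol_al i l) (pol_dd i l)).eq, mul_assoc, H.E_al i (by omega)]
    split_ifs with h1
    · rw [(H.YE (by omega) ν).eq, ← mul_assoc, H.E_dd i h, h1]; simp
    · simp
  · simp [dd, dif_neg h]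

lemma Loc.al2_dd (H : Loc C n E X T t Y) (l : ℕ) (h : l + 1 < n) :
    al E Y i (l+1) * dd C E X t i l = 0 := by
  refine eq_of_mul_E H.esum fun ν => ?_
  rw [(H.commute_of_mem (pol_al i _) (pol_dd i l)).eq, mul_assoc, H.E_al i h]
  split_ifs with h1
  · rw [(H.YE (by omega) ν).eq, ← mul_assoc, H.E_dd i h, h1]
    split_ifs with h2
    · rw [h2]; simp
    · simp
  · simp

lemma Loc.de2_dd (H : Loc C n E X T t Y) (l : ℕ) (h : l + 1 < n) :
    de E i (l+1) * dd C E X t i l = dd C E X t i l := by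
  refine eq_of_mul_E H.esum fun ν => ?_
  rw [(H.commute_of_mem (pol_de i _) (pol_dd i l)).eq, mul_assoc, H.E_de i h]
  split_ifs with h1
  · rw [H.E_dd i h, h1]
    split_ifs with h2
    · rw [h2]; simp
    · simp
  · simp

/-! ### relations with `T l` -/

lemma Loc.TY1 (H : Loc C n E X T t Y) (l : ℕ) (h : l + 1 < n) (ν) :
    T l * Y l * E ν = Y (l+1) * T l * E ν - (if ν ⟨l, by omega⟩ = ν ⟨l+1, h⟩ then
      Y l * Y (l+1) * E ν else 0) := by
  have hl : l < n := by omega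
  have h1 : T l * (t - X l) * E ν = (t - X (l+1)) * T l * E ν +
      (if ν ⟨l, hl⟩ = ν ⟨l+1, h⟩ then E ν else 0) := by
    rw [mul_sub, sub_mul, sub_mul, sub_mul, H.tx1 l h, (H.tT l h).eq]; abel
  have h2 : Y (l+1) * (T l * (t - X l) * E ν) * Y l = T l * Y l * E ν +
      (if ν ⟨l, hl⟩ = ν ⟨l+1, h⟩ then Y l * Y (l+1) * E ν else 0) := by
    rw [h1, mul_add, ← mul_assoc, ← mul_assoc, H.Y1 _ h, one_mul, add_mul, mul_assoc,
      ← (H.YE hl ν).eq, ← mul_assoc]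
    split_ifs
    · rw [mul_assoc (Y (l+1)), ← (H.YE hl ν).eq, ← mul_assoc (Y (l+1)), (H.YY hl h).eq]
    · simp
  rw [← sub_eq_iff_eq_add] at h2
  rw [← h2]
  congr 1
  rw [mul_assoc (T l), mul_assoc (Y (l+1)), mul_assoc (T l), mul_assoc _ (E ν),
    ← (H.YE hl ν).eq, ← mul_assoc _ (Y l), H.Y2 l hl, one_mul, mul_assoc]

lemma Loc.TY2 (H : Loc C n E X T t Y) (l : ℕ) (h : l + 1 < n) (ν) :
    T l * Y (l+1) * E ν = Y l * T l * E ν + (if ν ⟨l, by omega⟩ = ν ⟨l+1, h⟩ then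
      Y l * Y (l+1) * E ν else 0) := by
  have hl : l < n := by omega
  have h1 : T l * (t - X (l+1)) * E ν = (t - X l) * T l * E ν -
      (if ν ⟨l, hl⟩ = ν ⟨l+1, h⟩ then E ν else 0) := by
    rw [mul_sub, sub_mul, sub_mul, sub_mul, H.tx2 l h, (H.tT l h).eq]; abel
  have h2 : Y l * (T l * (t - X (l+1)) * E ν) * Y (l+1) = T l * Y (l+1) * E ν -
      (if ν ⟨l, hl⟩ = ν ⟨l+1, h⟩ then Y l * Y (l+1) * E ν else 0) := by
    rw [h1, mul_sub, ← mul_assoc, ← mul_assoc, H.Y1 _ hl, one_mul, sub_mul, mul_assoc,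
      ← (H.YE h ν).eq, ← mul_assoc]
    split_ifs
    · rw [mul_assoc (Y l), ← (H.YE h ν).eq, ← mul_assoc (Y l)]
    · simp
  rw [eq_sub_iff_add_eq] at h2
  rw [← h2]
  congr 1
  rw [mul_assoc (T l), mul_assoc (Y l), mul_assoc (T l), mul_assoc _ (E ν),
    ← (H.YE h ν).eq, ← mul_assoc _ (Y (l+1)), H.Y2 _ h, one_mul, mul_assoc]

lemma Loc.T_al (H : Loc C n E X T t Y) (l : ℕ) (h : l + 1 < n) :
    T l * al E Y i l = al E Y i (l+1) * T l - al E Y i l * al E Y i (l+1) := by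
  have hl : l < n := by omega
  refine eq_of_mul_E H.esum fun ν => ?_
  rw [sub_mul, mul_assoc, mul_assoc, mul_assoc, H.te l h, H.E_al i h, H.E_al i hl,
    ← mul_assoc (al E Y i (l+1)), H.E_al i h, sw_right]
  by_cases h1 : ν ⟨l, hl⟩ = i
  · rw [if_pos h1, if_pos h1, mul_assoc, ← H.te l h, ← mul_assoc, H.TY1 l h, mul_assoc, h1]
    congr 1
    by_cases h2 : i = ν ⟨l+1, h⟩
    · rw [if_pos h2, if_pos h2.symm, (H.YE h ν).eq, ← mul_assoc, H.E_al i hl, if_pos h1,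
        mul_assoc, mul_assoc, (H.YE h ν).eq]
    · rw [if_neg h2, if_neg (Ne.symm h2), mul_zero]
  · rw [if_neg h1, if_neg h1]
    split_ifs
    · rw [(H.YE h ν).eq, ← mul_assoc, H.E_al i hl, if_neg h1]; simp
    · simp

lemma Loc.T_al2 (H : Loc C n E X T t Y) (l : ℕ) (h : l + 1 < n) :
    T l * al E Y i (l+1) = al E Y i l * T l + al E Y i l * al E Y i (l+1) := by
  have hl : l < n := by omega
  refine eq_of_mul_E H.esum fun ν => ?_
  rw [add_mul, mul_assoc, mul_assoc, mul_assoc, H.te l h, H.E_al i h,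
    ← mul_assoc (al E Y i l), H.E_al i hl, sw_left]
  by_cases h1 : ν ⟨l+1, h⟩ = i
  · rw [if_pos h1, if_pos h1, mul_assoc, ← H.te l h, ← mul_assoc, H.TY2 l h, mul_assoc, h1]
    congr 1
    by_cases h2 : ν ⟨l, hl⟩ = i
    · rw [if_pos h2, (H.YE h ν).eq, ← mul_assoc, H.E_al i hl, if_pos h2,
        mul_assoc, mul_assoc, (H.YE h ν).eq]
    · rw [if_neg h2, (H.YE h ν).eq, ← mul_assoc, H.E_al i hl, if_neg h2, zero_mul]
  · rw [if_neg h1, if_neg h1]; simp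

lemma Loc.T_de (H : Loc C n E X T t Y) (l : ℕ) (h : l + 1 < n) :
    T l * de E i l = de E i (l+1) * T l := by
  have hl : l < n := by omega
  refine eq_of_mul_E H.esum fun ν => ?_
  rw [mul_assoc, mul_assoc, H.te l h, H.E_de i hl, ← mul_assoc, H.E_de i h, sw_right]
  split_ifs <;> simp [H.te l h]

lemma Loc.T_de2 (H : Loc C n E X T t Y) (l : ℕ) (h : l + 1 < n) :
    T l * de E i (l+1) = de E i l * T l := by
  have hl : l < n := by omega
  refine eq_of_mul_E H.esum fun ν => ?_
  rw [mul_assoc, mul_assoc, H.te l h, H.E_de i h, ← mul_assoc, H.E_de i hl, sw_left]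
  split_ifs <;> simp [H.te l h]

lemma Loc.T_qq (H : Loc C n E X T t Y) (l : ℕ) (h : l + 1 < n) :
    T l * qq C E X t i l = qq C E X t i (l+1) * T l - dd C E X t i l := by
  have hl : l < n := by omega
  refine eq_of_mul_E H.esum fun ν => ?_
  rw [sub_mul, mul_assoc, mul_assoc, H.te l h, H.E_qq i hl, ← mul_assoc, ← mul_assoc, H.E_qq i h,
    sw_right, H.E_dd i h, mul_assoc _ (E _), ← H.te l h, Qel_symm C _ _ _ _ (H.tX l hl),
    Qel_symm C _ _ _ _ (H.tX _ h), ← mul_assoc]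
  rw [mul_Qel C _ _ (T l) (X l) t (X (l+1)) (E ν) (if ν ⟨l, hl⟩ = ν ⟨l+1, h⟩ then -1 else 0)
    (H.XX hl h) (H.tT l h).eq.symm (H.xe _ _ hl).symm (H.tE ν).symm]
  · split_ifs <;> simp [sub_eq_add_neg]
  · rw [H.tx1 l h]; split_ifs <;> simp [sub_eq_add_neg]

lemma Loc.T_qq2 (H : Loc C n E X T t Y) (l : ℕ) (h : l + 1 < n) :
    T l * qq C E X t i (l+1) = qq C E X t i l * T l + dd C E X t i l := by
  have hl : l < n := by omega
  refine eq_of_mul_E H.esum fun ν => ?_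
  rw [add_mul, mul_assoc, mul_assoc, H.te l h, H.E_qq i h, ← mul_assoc, ← mul_assoc, H.E_qq i hl,
    sw_left, H.E_dd i h, mul_assoc _ (E _), ← H.te l h, Qel_symm C _ _ _ _ (H.tX l hl),
    Qel_symm C _ _ _ _ (H.tX _ h), ← mul_assoc]
  rw [mul_Qel C _ _ (T l) (X (l+1)) t (X l) (E ν) (if ν ⟨l, hl⟩ = ν ⟨l+1, h⟩ then 1 else 0)
    (H.XX h hl) (H.tT l h).eq.symm (H.xe _ _ h).symm (H.tE ν).symm]
  · split_ifs with h1
    · rw [one_smul, Qdiff_symm C _ _ _ _ _ (H.XX h hl), h1]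
    · simp
  · rw [H.tx2 l h]; split_ifs <;> simp

/-- commutation with a distant `T m`. -/
lemma Loc.T_far (H : Loc C n E X T t Y) (l m : ℕ) (h : m + 1 < n) (hl : l < n) (h1 : l ≠ m)
    (h2 : l ≠ m + 1) :
    T m * al E Y i l = al E Y i l * T m ∧ T m * de E i l = de E i l * T m ∧
    T m * qq C E X t i l = qq C E X t i l * T m := by
  have hX : Commute (T m) (X l) := H.tx m l h hl h1 h2
  have hs : ∀ ν : Fin n → I, sw ν m h ⟨l, hl⟩ = ν ⟨l, hl⟩ := fun ν => by
    rw [sw_apply, if_neg h1, if_neg h2]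
  refine ⟨?_, ?_, ?_⟩ <;> refine eq_of_mul_E H.esum fun ν => ?_
  · rw [mul_assoc, mul_assoc, H.te m h, H.E_al i hl, ← mul_assoc, H.E_al i hl, hs]
    split_ifs
    · rw [mul_assoc, ← H.te m h, ← mul_assoc, (H.Y_commute hl (H.tT m h).symm hX).eq, mul_assoc]
    · simp
  · rw [mul_assoc, mul_assoc, H.te m h, H.E_de i hl, ← mul_assoc, H.E_de i hl, hs]
    split_ifs <;> simp [H.te m h]
  · rw [mul_assoc, mul_assoc, H.te m h, H.E_qq i hl, ← mul_assoc, ← mul_assoc, H.E_qq i hl, hs,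
      mul_assoc _ (E _), ← H.te m h, ← mul_assoc]
    rw [(Qel_commute C _ _ _ _ _ (H.tT m h).symm hX).eq]

lemma Loc.al_G (H : Loc C n E X T t Y) (l : ℕ) (h : l + 1 < n) (ν) :
    al E Y i (l+1) * (qq C E X t i l - T l * T l) * E ν = if ν ⟨l+1, h⟩ = i then
      Qdiff C i (ν ⟨l, by omega⟩) t (X l) (X (l+1)) * E ν else 0 := by
  have hl : l < n := by omega
  rw [mul_assoc, sub_mul, H.E_qq i hl, H.tsq l h, ← sub_mul,
    (H.commute_of_mem (sub_mem (Qel_mem C _ _ _ _ _ pol_t (pol_X hl))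
      (Qel_mem C _ _ _ _ _ (pol_X hl) (pol_X h))) (pol_E ν)).eq, ← mul_assoc, H.E_al i h]
  split_ifs with h1
  · rw [h1, Qel_symm C (ν ⟨l, hl⟩) i _ _ (H.XX hl h), ← Qdiff_mul C _ _ _ _ _ (H.tX _ h)
      (H.tX _ hl) (H.XX hl h), (H.YE h ν).eq, mul_assoc,
      (H.commute_of_mem (pol_Y h) (mul_mem (Qdiff_mem C _ _ _ _ _ _ pol_t (pol_X hl) (pol_X h))
      (sub_mem pol_t (pol_X h)))).eq, mul_assoc, H.Y2 _ h, mul_one]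
    exact (H.commute_of_mem (pol_E ν) (Qdiff_mem C _ _ _ _ _ _ pol_t (pol_X hl) (pol_X h))).eq
  · rw [zero_mul]

lemma Loc.al_G2 (H : Loc C n E X T t Y) (l : ℕ) (h : l + 1 < n) (ν) :
    al E Y i l * (qq C E X t i (l+1) - T l * T l) * E ν = if ν ⟨l, by omega⟩ = i then
      Qdiff C i (ν ⟨l+1, h⟩) (X l) (X (l+1)) t * E ν else 0 := by
  have hl : l < n := by omega
  rw [mul_assoc, sub_mul, H.E_qq i h, H.tsq l h, ← sub_mul,
    (H.commute_of_mem (sub_mem (Qel_mem C _ _ _ _ _ pol_t (pol_X h))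
      (Qel_mem C _ _ _ _ _ (pol_X hl) (pol_X h))) (pol_E ν)).eq, ← mul_assoc, H.E_al i hl]
  split_ifs with h1
  · rw [h1, ← Qdiff_mul C _ _ _ _ _ (H.tX _ hl)
      (H.tX _ h) (H.XX h hl), (H.YE hl ν).eq, mul_assoc,
      (H.commute_of_mem (pol_Y hl) (mul_mem (Qdiff_mem C _ _ _ _ _ _ pol_t (pol_X h) (pol_X hl))
      (sub_mem pol_t (pol_X hl)))).eq, mul_assoc, H.Y2 _ hl, mul_one,
      Qdiff_symm C _ _ _ _ _ (H.tX _ hl)]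
    exact (H.commute_of_mem (pol_E ν) (Qdiff_mem C _ _ _ _ _ _ (pol_X hl) (pol_X h) pol_t)).eq
  · rw [zero_mul]

end
end KLR

set_option linter.unusedSectionVars false
set_option linter.unusedSimpArgs false
namespace KLR

/-- Abstract form of the nine braid coefficient identities. -/
lemma braid_coeffs {L : Type} [Ring L] (T a b d e q r D : L)
    (ba : b * a = a * b) (da : d * a = 0) (ad : a * d = 0) (db : d * b = b * d)
    (ea : e * a = a * e) (eb : e * b = 0) (be : b * e = 0) (ed : e * d = d * e)
    (qa : q * a = 0) (aq : a * q = 0) (qb : q * b = b * q) (qd : q * d = q) (dq : d * q = q)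
    (eq' : q * e = e * q)
    (ra : r * a = a * r) (rb : r * b = 0) (br : b * r = 0) (rd : r * d = d * r) (re : r * e = r)
    (er : e * r = r) (rq : r * q = q * r)
    (Da : D * a = 0) (aD : a * D = 0) (bD : b * D = 0) (Db : D * b = 0) (eD : e * D = D)
    (De : D * e = D) (qD : D * q = q * D)
    (Ta : T * a = b * T - a * b) (Tb : T * b = a * T + a * b) (Td : T * d = e * T)
    (Te : T * e = d * T) (Tq : T * q = r * T - D) (Tr : T * r = q * T + D) :
    T * (a + d) * (b + e) = (a + d) * (b + e) * T ∧
    -(T * (a + d) * b) + (a + d) * b * a + a * T * (a + d) = 0 ∧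
    -(T * a * T) + (a + d) * b * (q - a) - a * T * a = b * (q - T * T) ∧
    (b + e) * T * b - b * a * (b + e) - a * (b + e) * T = 0 ∧
    (b + e) * T * (r - b) + b * a * b + a * b * a - (q - a) * T * (a + d) = D ∧
    -(b * (q - a) * T) + a * b * (q - a) + (q - a) * T * a = 0 ∧
    b * T * b + (r - b) * a * (b + e) - T * b * T = a * (r - T * T) ∧
    b * T * (r - b) - (r - b) * a * b - T * (r - b) * a = 0 ∧
    (r - b) * (q - a) * T = T * (r - b) * (q - a) := by
  have tl : ∀ {x y z : L}, x * y = z → ∀ w, x * (y * w) = z * w := fun h w => by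
    rw [← mul_assoc, h]
  have abq : a * (b * q) = 0 := by rw [← qb, ← mul_assoc, aq, zero_mul]
  refine ⟨?_, ?_, ?_, ?_, ?_, ?_, ?_, ?_, ?_⟩ <;>
  · simp only [mul_add, add_mul, mul_sub, sub_mul, mul_assoc, ba, da, ad, db, ea, eb, be, ed, qa,
      aq, qb, qd, dq, eq', ra, rb, br, rd, re, er, rq, Da, aD, bD, Db, eD, De, qD, Ta, Tb, Td,
      Te, Tq, Tr, tl ba, tl da, tl ad, tl db, tl ea, tl eb, tl be, tl ed, tl qa, tl aq, tl qb,
      tl qd, tl dq, tl eq', tl ra, tl rb, tl br, tl rd, tl re, tl er, tl rq, tl Da, tl aD, tl bD,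
      tl Db, tl eD, tl De, tl qD, tl Ta, tl Tb, tl Td, tl Te, tl Tq, tl Tr, mul_zero, zero_mul, abq,
      neg_mul, mul_neg, add_zero, zero_add]
    try abel

variable {k : Type} [Field k] {I : Type} [Fintype I] [DecidableEq I]

/-- total evaluation of a vector -/
def fx {n : ℕ} {L : Type} [Zero L] (f : Fin (n+1) → L) (p : ℕ) : L :=
  if h : p < n + 1 then f ⟨p, h⟩ else 0

lemma fx_ext {n : ℕ} {L : Type} [Zero L] {f g : Fin (n+1) → L}
    (h : ∀ p, p < n + 1 → fx f p = fx g p) : f = g := by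
  funext ⟨p, hp⟩
  have := h p hp
  simpa [fx, hp] using this

/-- removing an entry -/
def rm {n : ℕ} (μ : Fin (n+1) → I) (p : ℕ) : Fin n → I :=
  fun j => if j.1 < p then μ ⟨j, by omega⟩ else μ ⟨j+1, by omega⟩

section
variable {n : ℕ} (μ : Fin (n+1) → I)
lemma rm_lt {p j : ℕ} (hj : j < n) (h : j < p) : rm μ p ⟨j, hj⟩ = μ ⟨j, by omega⟩ := by
  simp [rm, h]
lemma rm_ge {p j : ℕ} (hj : j < n) (h : p ≤ j) : rm μ p ⟨j, hj⟩ = μ ⟨j+1, by omega⟩ := by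
  simp [rm, h]
lemma rm_eq_removeNth (p : Fin (n+1)) : rm μ p = p.removeNth μ := by
  funext j
  simp only [rm, Fin.removeNth, Fin.succAbove]
  by_cases h : j.1 < p.1
  · rw [if_pos h, if_pos (by simpa [Fin.lt_def] using h)]; rfl
  · rw [if_neg h, if_neg (by simpa [Fin.lt_def] using h)]; rfl
lemma rm_sw_left {l : ℕ} (h : l + 1 < n + 1) : rm (sw μ l h) l = rm μ (l+1) := by
  funext ⟨j, hj⟩
  by_cases h1 : j < l
  · rw [rm_lt _ _ h1, rm_lt _ _ (by omega), sw_apply, if_neg (by omega), if_neg (by omega)]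
  · rw [rm_ge _ _ (by omega), sw_apply, if_neg (by omega)]
    split_ifs with h2
    · rw [rm_lt _ _ (by omega)]; congr 1; simp; omega
    · rw [rm_ge _ _ (by omega)]
lemma rm_sw_right {l : ℕ} (h : l + 1 < n + 1) : rm (sw μ l h) (l+1) = rm μ l := by
  have := rm_sw_left (sw μ l h) h
  rw [sw_sw] at this; exact this.symm
lemma rm_sw_lt {l p : ℕ} (h : l + 1 < n + 1) (hp : p < l) :
    rm (sw μ l h) p = sw (rm μ p) (l-1) (by omega) := by
  funext ⟨j, hj⟩
  rw [sw_apply]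
  by_cases h1 : j < p
  · rw [rm_lt _ _ h1, sw_apply, if_neg (by omega), if_neg (by omega), if_neg (by omega),
      if_neg (by omega), rm_lt _ _ h1]
  · rw [rm_ge _ _ (by omega), sw_apply]
    by_cases h2 : j + 1 = l
    · subst h2
      rw [if_pos rfl, if_pos (by omega), rm_ge _ _ (by omega)]; rfl
    by_cases h3 : j = l
    · subst h3
      rw [if_neg (by omega), if_pos rfl, if_neg (by omega), if_pos (by omega), rm_ge _ _ (by omega)]
      congr 1; simp; omega
    rw [if_neg h2, if_neg (by omega), if_neg (by omega), if_neg (by omega), rm_ge _ _ (by omega)]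
lemma rm_sw_gt {l p : ℕ} (h : l + 1 < n + 1) (hp : l + 1 < p) (hl : l + 1 < n) :
    rm (sw μ l h) p = sw (rm μ p) l hl := by
  funext ⟨j, hj⟩
  rw [sw_apply]
  by_cases h1 : j < p
  · rw [rm_lt _ _ h1, sw_apply, rm_lt _ _ (by omega), rm_lt _ _ (by omega), rm_lt _ _ h1]
  · rw [rm_ge _ _ (by omega), sw_apply, if_neg (by omega), if_neg (by omega), if_neg (by omega),
      if_neg (by omega), rm_ge _ _ (by omega)]
lemma rm_inj {μ μ' : Fin (n+1) → I} {p : ℕ} (hp : p < n + 1) (h : μ ⟨p, hp⟩ = μ' ⟨p, hp⟩)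
    (h' : rm μ p = rm μ' p) : μ = μ' := by
  funext ⟨j, hj⟩
  rcases lt_trichotomy j p with h1 | h1 | h1
  · have := congrFun h' ⟨j, by omega⟩
    rwa [rm_lt _ _ h1, rm_lt _ _ h1] at this
  · subst h1; exact h
  · have := congrFun h' ⟨j-1, by omega⟩
    rw [rm_ge _ _ (by omega), rm_ge _ _ (by omega)] at this
    have h3 : j - 1 + 1 = j := by omega
    simpa only [h3] using this
end

section
variable {C : CartanDatum k I} {n : ℕ} {L : Type} [Ring L] [Algebra k L]
    {E : (Fin n → I) → L} {X T : ℕ → L} {t : L} {Y : ℕ → L}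

variable (k n L) in
/-- diagonal operators -/
def dg : (Fin (n+1) → L) →ₐ[k] Module.End Lᵐᵒᵖ (Fin (n+1) → L) where
  toFun c := 
    { toFun := fun f p => c p * f p
      map_add' := fun f g => by funext p; simp [mul_add]
      map_smul' := fun r f => by funext p; simp [mul_assoc] }
  map_one' := by ext; simp
  map_mul' c d := by ext; simp [mul_assoc]
  map_zero' := by ext; simp
  map_add' c d := by ext; simp [add_mul]
  commutes' r := by
    refine LinearMap.ext fun f => ?_
    funext p
    simp [Algebra.algebraMap_eq_smul_one]

variable (E) in
/-- coefficient of `e(μ)` -/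
def Ec (i : I) (μ : Fin (n+1) → I) (p : ℕ) : L :=
  if h : p < n + 1 then if μ ⟨p, h⟩ = i then E (rm μ p) else 0 else 0

variable (X t) in
/-- coefficient of `x_a` -/
def Xc (a p : ℕ) : L := if a = p then t else if a < p then X a else X (a-1)

variable (k E) in
/-- operator `e(μ)` -/
def EO (i : I) (μ : Fin (n+1) → I) : Module.End Lᵐᵒᵖ (Fin (n+1) → L) :=
  dg k n L (fun p => Ec E i μ p)
variable (k n X t) in
/-- operator `x_a` -/
def XO (a : ℕ) : Module.End Lᵐᵒᵖ (Fin (n+1) → L) := dg k n L (fun p => Xc X t a p)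

variable (C E X T t Y) in
/-- operator `τ_l` -/
def TO (i : I) (l : ℕ) : Module.End Lᵐᵒᵖ (Fin (n+1) → L) where
  toFun f p := if p.1 = l then (al E Y i l + de E i l) * fx f (l+1) - al E Y i l * fx f l else
    if p.1 = l + 1 then al E Y i l * fx f (l+1) + (qq C E X t i l - al E Y i l) * fx f l else
    if p.1 < l then T (l-1) * f p else T l * f p
  map_add' f g := by
    have : ∀ p, fx (f + g) p = fx f p + fx g p := fun p => by unfold fx; split_ifs <;> simp
    funext p
    simp only [this, Pi.add_apply]
    split_ifs <;> simp only [mul_add] <;> abel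
  map_smul' r f := by
    have : ∀ p, fx (r • f) p = fx f p * r.unop := fun p => by unfold fx; split_ifs <;> simp
    funext p
    simp only [this, Pi.smul_apply, RingHom.id_apply, MulOpposite.smul_eq_mul_unop]
    split_ifs <;> simp only [mul_assoc, add_mul, sub_mul]

variable (i : I) (f : Fin (n+1) → L)

lemma fx_dg (c : Fin (n+1) → L) {p : ℕ} (h : p < n + 1) :
    fx (dg k n L c f) p = c ⟨p, h⟩ * fx f p := by simp [fx, h, dg]
lemma fx_E (μ) {p : ℕ} (h : p < n + 1) : fx (EO k E i μ f) p = Ec E i μ p * fx f p := 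
  fx_dg f _ h
lemma fx_X (a) {p : ℕ} (h : p < n + 1) : fx (XO k n X t a f) p = Xc X t a p * fx f p := 
  fx_dg f _ h
lemma fx_Q (u v : I) (a b) {p : ℕ} (h : p < n + 1) :
    fx (Qel C u v (XO k n X t a) (XO k n X t b) f) p =
      Qel C u v (Xc X t a p) (Xc X t b p) * fx f p := by
  unfold XO
  rw [← Qel_map, fx_dg f _ h]
  congr 1
  exact Qel_map C (Pi.evalAlgHom k (fun _ : Fin (n+1) => L) ⟨p, h⟩) _ _ _ _
lemma fx_D (u v : I) (a b c) {p : ℕ} (h : p < n + 1) :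
    fx (Qdiff C u v (XO k n X t a) (XO k n X t b) (XO k n X t c) f) p =
      Qdiff C u v (Xc X t a p) (Xc X t b p) (Xc X t c p) * fx f p := by
  unfold XO
  rw [← Qdiff_map, fx_dg f _ h]
  congr 1
  exact Qdiff_map C (Pi.evalAlgHom k (fun _ : Fin (n+1) => L) ⟨p, h⟩) _ _ _ _ _
lemma fx_add (f g : Fin (n+1) → L) (p : ℕ) : fx (f + g) p = fx f p + fx g p := by
  unfold fx; split_ifs <;> simp
lemma fx_sub (f g : Fin (n+1) → L) (p : ℕ) : fx (f - g) p = fx f p - fx g p := by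
  unfold fx; split_ifs <;> simp
lemma fx_zero (p : ℕ) : fx (0 : Fin (n+1) → L) p = 0 := by
  unfold fx; split_ifs <;> simp
lemma fx_T0 {l : ℕ} (h : l < n) : fx (TO C E X T t Y i l f) l =
    (al E Y i l + de E i l) * fx f (l+1) - al E Y i l * fx f l := by
  rw [fx, dif_pos (by omega)]
  simp [TO]
lemma fx_T1 {l : ℕ} (h : l < n) : fx (TO C E X T t Y i l f) (l+1) =
    al E Y i l * fx f (l+1) + (qq C E X t i l - al E Y i l) * fx f l := by
  rw [fx, dif_pos (by omega)]
  simp [TO]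
lemma fx_Tlt {l p : ℕ} (h : p < n + 1) (h1 : p < l) : fx (TO C E X T t Y i l f) p =
    T (l-1) * fx f p := by
  rw [fx, dif_pos (by omega)]
  simp [TO, h1, h1.ne, show p ≠ l + 1 by omega, fx, h]
lemma fx_Tgt {l p : ℕ} (h : p < n + 1) (h1 : l + 1 < p) : fx (TO C E X T t Y i l f) p =
    T l * fx f p := by
  rw [fx, dif_pos (by omega)]
  simp [TO, show ¬ p < l by omega, show p ≠ l by omega, show p ≠ l + 1 by omega, fx, h]
end
end KLR

set_option linter.unusedSectionVars false
namespace KLR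
variable {k : Type} [Field k] {I : Type} [Fintype I] [DecidableEq I]
section
variable {C : CartanDatum k I} {n : ℕ} {L : Type} [Ring L] [Algebra k L]
    {E : (Fin n → I) → L} {X T : ℕ → L} {t : L} {Y : ℕ → L}
variable (i : I)

lemma Ec_pos {μ : Fin (n+1) → I} {p : ℕ} (h : p < n + 1) (hm : μ ⟨p, h⟩ = i) :
    Ec E i μ p = E (rm μ p) := by simp [Ec, h, hm]
lemma Ec_neg {μ : Fin (n+1) → I} {p : ℕ} (h : p < n + 1) (hm : μ ⟨p, h⟩ ≠ i) :
    Ec E i μ p = 0 := by simp [Ec, h, hm]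

lemma Xc_eq (a : ℕ) : Xc X t a a = t := by simp [Xc]
lemma Xc_lt {a p : ℕ} (h : a < p) : Xc X t a p = X a := by simp [Xc, h, h.ne]
lemma Xc_gt {a p : ℕ} (h : p < a) : Xc X t a p = X (a-1) := by
  simp [Xc, h.ne', show ¬ a < p by omega]

lemma Xc_pol {a p : ℕ} (h : a < n + 1) (hp : p < n + 1) : Xc X t a p ∈ pol k E X t Y := by
  unfold Xc
  split_ifs with h1 h2
  · exact pol_t
  · exact pol_X (by omega)
  · exact pol_X (by omega)

lemma Ec_pol {μ : Fin (n+1) → I} {p : ℕ} : Ec E i μ p ∈ pol k E X t Y := by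
  unfold Ec
  split_ifs with h1 h2
  · exact pol_E _
  · exact zero_mem _
  · exact zero_mem _

lemma end_ext {F G : Module.End Lᵐᵒᵖ (Fin (n+1) → L)}
    (h : ∀ f p, p < n + 1 → fx (F f) p = fx (G f) p) : F = G :=
  LinearMap.ext fun f => fx_ext fun p hp => h f p hp

lemma Loc.O_tx (H : Loc C n E X T t Y) (l m : ℕ) (h : l + 1 < n + 1) (hm : m < n + 1) (h1 : m ≠ l)
    (h2 : m ≠ l + 1) : TO C E X T t Y i l * XO k n X t m = XO k n X t m * TO C E X T t Y i l := by
  refine end_ext fun f p hp => ?_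
  simp only [Module.End.mul_apply]
  rw [fx_X _ _ hp]
  have e1 : Xc X t m (l+1) = Xc X t m l := by
    simp only [Xc, h1, h2, if_false]
    by_cases h3 : m < l
    · rw [if_pos (by omega), if_pos h3]
    · rw [if_neg (by omega), if_neg h3]
  have hX : Xc X t m l ∈ pol k E X t Y := Xc_pol hm (by omega)
  have ca := (H.commute_of_mem hX (pol_al i l)).eq
  have cd := (H.commute_of_mem hX (pol_de i l)).eq
  have cq := (H.commute_of_mem hX (pol_qq (C := C) i l)).eq
  by_cases c0 : p = l
  · subst c0
    rw [fx_T0 i _ (by omega), fx_T0 i _ (by omega), fx_X _ _ hp, fx_X _ _ h, e1]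
    simp only [← mul_assoc, mul_sub, mul_add, sub_mul, add_mul, ca, cd]
  by_cases c1 : p = l + 1
  · subst c1
    rw [fx_T1 i _ (by omega), fx_T1 i _ (by omega), fx_X _ _ hp, fx_X _ _ (by omega), e1]
    simp only [← mul_assoc, mul_sub, mul_add, sub_mul, add_mul, ca, cq]
  by_cases c2 : p < l
  · rw [fx_Tlt i _ hp c2, fx_Tlt i _ hp c2, fx_X _ _ hp, ← mul_assoc, ← mul_assoc]
    congr 1
    unfold Xc
    split_ifs with h3 h4
    · exact (H.tT _ (by omega)).eq.symm
    · exact H.tx _ _ (by omega) (by omega) (by omega) (by omega)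
    · exact H.tx _ _ (by omega) (by omega) (by omega) (by omega)
  · have c3 : l + 1 < p := by omega
    rw [fx_Tgt i _ hp c3, fx_Tgt i _ hp c3, fx_X _ _ hp, ← mul_assoc, ← mul_assoc]
    congr 1
    unfold Xc
    split_ifs with h3 h4
    · exact (H.tT _ (by omega)).eq.symm
    · exact H.tx _ _ (by omega) (by omega) (by omega) (by omega)
    · exact H.tx _ _ (by omega) (by omega) (by omega) (by omega)

lemma Loc.al_tX (H : Loc C n E X T t Y) {l : ℕ} (h : l < n) (ν) :
    al E Y i l * (t - X l) * E ν = if ν ⟨l, h⟩ = i then E ν else 0 := by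
  rw [mul_assoc, (H.commute_of_mem (sub_mem pol_t (pol_X h)) (pol_E ν)).eq, ← mul_assoc,
    H.E_al i h]
  split_ifs
  · rw [(H.YE h ν).eq, mul_assoc, H.Y1 _ h, mul_one]
  · simp

lemma Loc.O_tx1 (H : Loc C n E X T t Y) (l : ℕ) (h : l + 1 < n + 1) (μ) :
    TO C E X T t Y i l * XO k n X t l * EO k E i μ =
      XO k n X t (l+1) * TO C E X T t Y i l * EO k E i μ -
      (if μ ⟨l, by omega⟩ = μ ⟨l + 1, h⟩ then EO k E i μ else 0) := by
  have hl : l < n := by omega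
  refine end_ext fun f p hp => ?_
  have e0 : fx ((if μ ⟨l, by omega⟩ = μ ⟨l + 1, h⟩ then EO k E i μ else 0 :
      Module.End Lᵐᵒᵖ (Fin (n+1) → L)) f) p =
      (if μ ⟨l, by omega⟩ = μ ⟨l + 1, h⟩ then Ec E i μ p else 0) * fx f p := by
    split_ifs
    · exact fx_E _ _ _ hp
    · simp [fx_zero]
  simp only [Module.End.mul_apply, LinearMap.sub_apply]
  rw [fx_sub, e0, fx_X _ _ hp]
  have hX : X l ∈ pol k E X t Y := pol_X hl
  have ca := (H.commute_of_mem hX (pol_al i l)).eq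
  have cd := (H.commute_of_mem hX (pol_de i l)).eq
  have cq := (H.commute_of_mem hX (pol_qq (C := C) i l)).eq
  have ta := (H.commute_of_mem pol_t (pol_al i l)).eq
  have tq := (H.commute_of_mem pol_t (pol_qq (C := C) i l)).eq
  by_cases c0 : p = l
  · subst c0
    rw [fx_T0 i _ hl, fx_T0 i _ hl, fx_X _ _ hp, fx_X _ _ h, fx_E _ _ _ hp, fx_E _ _ _ h, Xc_eq,
      Xc_lt (by omega : p < p + 1), Xc_gt (by omega : p < p + 1), Nat.add_sub_cancel]
    have key : al E Y i p * (t - X p) * Ec E i μ p =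
        if μ ⟨p, by omega⟩ = μ ⟨p + 1, h⟩ then Ec E i μ p else 0 := by
      by_cases hc : μ ⟨p, hp⟩ = i
      · rw [Ec_pos i hp hc, H.al_tX i hl, rm_ge _ _ le_rfl, hc]
        simp only [eq_comm]
      · rw [Ec_neg i hp hc]; simp
    rw [← key]
    simp only [← mul_assoc, mul_sub, mul_add, sub_mul, add_mul, ca, cd, cq, ta, tq]
    abel
  by_cases c1 : p = l + 1
  · subst c1
    rw [fx_T1 i _ (by omega), fx_T1 i _ (by omega), fx_X _ _ hp, fx_X _ _ (by omega),
      fx_E _ _ _ hp, fx_E _ _ _ (by omega), Xc_eq, Xc_eq, Xc_lt (by omega : l < l + 1)]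
    have key : al E Y i l * (t - X l) * Ec E i μ (l+1) =
        if μ ⟨l, by omega⟩ = μ ⟨l + 1, h⟩ then Ec E i μ (l+1) else 0 := by
      by_cases hc : μ ⟨l+1, hp⟩ = i
      · rw [Ec_pos i hp hc, H.al_tX i hl, rm_lt _ _ (by omega), hc]
      · rw [Ec_neg i hp hc]; simp
    rw [← key]
    simp only [← mul_assoc, mul_sub, mul_add, sub_mul, add_mul, ca, cd, cq, ta, tq]
    abel
  by_cases c2 : p < l
  · rw [fx_Tlt i _ hp c2, fx_Tlt i _ hp c2, fx_X _ _ hp, fx_E _ _ _ hp, Xc_gt c2,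
      Xc_gt (by omega : p < l + 1)]
    simp only [← mul_assoc]
    rw [← sub_mul]
    congr 1
    by_cases hc : μ ⟨p, hp⟩ = i
    · have := H.tx1 (l-1) (by omega) (rm μ p)
      rw [rm_ge _ _ (by omega), rm_ge _ _ (by omega)] at this
      rw [Ec_pos i hp hc, this]
      obtain ⟨l, rfl⟩ : ∃ m, l = m + 1 := ⟨l-1, by omega⟩
      rfl
    · rw [Ec_neg i hp hc]; simp
  · have c3 : l + 1 < p := by omega
    rw [fx_Tgt i _ hp c3, fx_Tgt i _ hp c3, fx_X _ _ hp, fx_E _ _ _ hp, Xc_lt c3,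
      Xc_lt (by omega : l < p)]
    simp only [← mul_assoc]
    rw [← sub_mul]
    congr 1
    by_cases hc : μ ⟨p, hp⟩ = i
    · have := H.tx1 l (by omega) (rm μ p)
      rw [rm_lt _ _ (by omega), rm_lt _ _ (by omega)] at this
      rw [Ec_pos i hp hc, this]
    · rw [Ec_neg i hp hc]; simp

lemma Loc.O_tx2 (H : Loc C n E X T t Y) (l : ℕ) (h : l + 1 < n + 1) (μ) :
    TO C E X T t Y i l * XO k n X t (l+1) * EO k E i μ =
      XO k n X t l * TO C E X T t Y i l * EO k E i μ +
      (if μ ⟨l, by omega⟩ = μ ⟨l + 1, h⟩ then EO k E i μ else 0) := by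
  have hl : l < n := by omega
  refine end_ext fun f p hp => ?_
  have e0 : fx ((if μ ⟨l, by omega⟩ = μ ⟨l + 1, h⟩ then EO k E i μ else 0 :
      Module.End Lᵐᵒᵖ (Fin (n+1) → L)) f) p =
      (if μ ⟨l, by omega⟩ = μ ⟨l + 1, h⟩ then Ec E i μ p else 0) * fx f p := by
    split_ifs
    · exact fx_E _ _ _ hp
    · simp [fx_zero]
  simp only [Module.End.mul_apply, LinearMap.add_apply]
  rw [fx_add, e0, fx_X _ _ hp]
  have hX : X l ∈ pol k E X t Y := pol_X hl
  have ca := (H.commute_of_mem hX (pol_al i l)).eq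
  have cd := (H.commute_of_mem hX (pol_de i l)).eq
  have cq := (H.commute_of_mem hX (pol_qq (C := C) i l)).eq
  have ta := (H.commute_of_mem pol_t (pol_al i l)).eq
  have td := (H.commute_of_mem pol_t (pol_de i l)).eq
  have tq := (H.commute_of_mem pol_t (pol_qq (C := C) i l)).eq
  by_cases c0 : p = l
  · subst c0
    rw [fx_T0 i _ hl, fx_T0 i _ hl, fx_X _ _ hp, fx_X _ _ h, fx_E _ _ _ hp, fx_E _ _ _ h, Xc_eq,
      Xc_eq, Xc_gt (by omega : p < p + 1), Nat.add_sub_cancel]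
    have key : al E Y i p * (t - X p) * Ec E i μ p =
        if μ ⟨p, by omega⟩ = μ ⟨p + 1, h⟩ then Ec E i μ p else 0 := by
      by_cases hc : μ ⟨p, hp⟩ = i
      · rw [Ec_pos i hp hc, H.al_tX i hl, rm_ge _ _ le_rfl, hc]
        simp only [eq_comm]
      · rw [Ec_neg i hp hc]; simp
    rw [← key]
    simp only [← mul_assoc, mul_sub, mul_add, sub_mul, add_mul, ca, cd, cq, ta, tq, td]
    abel
  by_cases c1 : p = l + 1
  · subst c1
    rw [fx_T1 i _ (by omega), fx_T1 i _ (by omega), fx_X _ _ hp, fx_X _ _ (by omega),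
      fx_E _ _ _ hp, fx_E _ _ _ (by omega), Xc_eq, Xc_lt (by omega : l < l + 1),
      Xc_gt (by omega : l < l + 1), Nat.add_sub_cancel]
    have key : al E Y i l * (t - X l) * Ec E i μ (l+1) =
        if μ ⟨l, by omega⟩ = μ ⟨l + 1, h⟩ then Ec E i μ (l+1) else 0 := by
      by_cases hc : μ ⟨l+1, hp⟩ = i
      · rw [Ec_pos i hp hc, H.al_tX i hl, rm_lt _ _ (by omega), hc]
      · rw [Ec_neg i hp hc]; simp
    rw [← key]
    simp only [← mul_assoc, mul_sub, mul_add, sub_mul, add_mul, ca, cd, cq, ta, tq]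
    abel
  by_cases c2 : p < l
  · rw [fx_Tlt i _ hp c2, fx_Tlt i _ hp c2, fx_X _ _ hp, fx_E _ _ _ hp, Xc_gt c2,
      Xc_gt (by omega : p < l + 1)]
    simp only [← mul_assoc]
    rw [← add_mul]
    congr 1
    by_cases hc : μ ⟨p, hp⟩ = i
    · have := H.tx2 (l-1) (by omega) (rm μ p)
      rw [rm_ge _ _ (by omega), rm_ge _ _ (by omega)] at this
      rw [Ec_pos i hp hc]
      obtain ⟨l, rfl⟩ : ∃ m, l = m + 1 := ⟨l-1, by omega⟩
      exact this
    · rw [Ec_neg i hp hc]; simp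
  · have c3 : l + 1 < p := by omega
    rw [fx_Tgt i _ hp c3, fx_Tgt i _ hp c3, fx_X _ _ hp, fx_E _ _ _ hp, Xc_lt c3,
      Xc_lt (by omega : l < p)]
    simp only [← mul_assoc]
    rw [← add_mul]
    congr 1
    by_cases hc : μ ⟨p, hp⟩ = i
    · have := H.tx2 l (by omega) (rm μ p)
      rw [rm_lt _ _ (by omega), rm_lt _ _ (by omega)] at this
      rw [Ec_pos i hp hc, this]
    · rw [Ec_neg i hp hc]; simp

lemma Loc.O_te (H : Loc C n E X T t Y) (l : ℕ) (h : l + 1 < n + 1) (μ) :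
    TO C E X T t Y i l * EO k E i μ = EO k E i (sw μ l h) * TO C E X T t Y i l := by
  have hl : l < n := by omega
  have key : al E Y i l * Ec E i μ l = al E Y i l * Ec E i μ (l+1) := by
    by_cases hc : μ ⟨l, by omega⟩ = i
    · rw [Ec_pos i _ hc, H.E_al i hl, rm_ge _ _ le_rfl]
      by_cases hd : μ ⟨l+1, h⟩ = i
      · rw [if_pos hd, Ec_pos i _ hd, H.E_al i hl, rm_lt _ _ (by omega), if_pos hc]
        congr 2
        rw [← rm_sw_left μ h]
        congr 1
        funext ⟨a, ha⟩
        rw [sw_apply]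
        split_ifs with h1 h2
        · subst h1; rw [hc, hd]
        · subst h2; rw [hc, hd]
        · rfl
      · rw [if_neg hd, Ec_neg i _ hd, mul_zero]
    · rw [Ec_neg i _ hc, mul_zero]
      by_cases hd : μ ⟨l+1, h⟩ = i
      · rw [Ec_pos i _ hd, H.E_al i hl, rm_lt _ _ (by omega), if_neg hc]
      · rw [Ec_neg i _ hd, mul_zero]
  have f0 : Ec E i (sw μ l h) l = Ec E i μ (l+1) := by
    simp only [Ec, h, show l < n + 1 by omega, dif_pos, sw_left, rm_sw_left]
  have f1 : Ec E i (sw μ l h) (l+1) = Ec E i μ l := by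
    simp only [Ec, h, show l < n + 1 by omega, dif_pos, sw_right, rm_sw_right]
  have hc : ∀ {a : L} {p}, a ∈ pol k E X t Y → Ec E i μ p * a = a * Ec E i μ p :=
    fun ha => (H.commute_of_mem (Ec_pol i) ha).eq
  have ha := fun p => hc (p := p) (pol_al i l)
  have hd := fun p => hc (p := p) (pol_de i l)
  have hq := fun p => hc (p := p) (pol_qq (C := C) i l)
  refine end_ext fun f p hp => ?_
  simp only [Module.End.mul_apply]
  rw [fx_E _ _ _ hp]
  by_cases c0 : p = l
  · subst c0
    rw [fx_T0 i _ hl, fx_T0 i _ hl, fx_E _ _ _ hp, fx_E _ _ _ h, f0]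
    simp only [← mul_assoc, mul_sub, mul_add, sub_mul, add_mul, ha, hd, key]
  by_cases c1 : p = l + 1
  · subst c1
    rw [fx_T1 i _ hl, fx_T1 i _ hl, fx_E _ _ _ hp, fx_E _ _ _ (by omega), f1]
    simp only [← mul_assoc, mul_sub, mul_add, sub_mul, add_mul, ha, hq, key]
  by_cases c2 : p < l
  · rw [fx_Tlt i _ hp c2, fx_Tlt i _ hp c2, fx_E _ _ _ hp]
    simp only [← mul_assoc]
    congr 1
    have e1 : sw μ l h ⟨p, hp⟩ = μ ⟨p, hp⟩ := by rw [sw_apply, if_neg c0, if_neg c1]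
    by_cases hc : μ ⟨p, hp⟩ = i
    · rw [Ec_pos i hp hc, Ec_pos i hp (e1.trans hc), rm_sw_lt _ _ c2, H.te (l-1) (by omega)]
    · rw [Ec_neg i hp hc, Ec_neg i hp (by rw [e1]; exact hc)]; simp
  · have c3 : l + 1 < p := by omega
    rw [fx_Tgt i _ hp c3, fx_Tgt i _ hp c3, fx_E _ _ _ hp]
    simp only [← mul_assoc]
    congr 1
    have e1 : sw μ l h ⟨p, hp⟩ = μ ⟨p, hp⟩ := by rw [sw_apply, if_neg c0, if_neg c1]
    by_cases hc : μ ⟨p, hp⟩ = i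
    · rw [Ec_pos i hp hc, Ec_pos i hp (e1.trans hc), rm_sw_gt _ _ c3 (by omega),
        H.te l (by omega)]
    · rw [Ec_neg i hp hc, Ec_neg i hp (by rw [e1]; exact hc)]; simp

end
end KLR

set_option linter.unusedSectionVars false
set_option linter.unusedSimpArgs false
namespace KLR
variable {k : Type} [Field k] {I : Type} [Fintype I] [DecidableEq I]
section
variable {C : CartanDatum k I} {n : ℕ} {L : Type} [Ring L] [Algebra k L]
    {E : (Fin n → I) → L} {X T : ℕ → L} {t : L} {Y : ℕ → L}
variable (i : I)

lemma Loc.O_ee (H : Loc C n E X T t Y) (μ μ' : Fin (n+1) → I) :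
    EO k E i μ * EO k E i μ' = if μ = μ' then EO k E i μ else 0 := by
  refine end_ext fun f p hp => ?_
  rw [Module.End.mul_apply, fx_E _ _ _ hp, fx_E _ _ _ hp, ← mul_assoc]
  have e0 : fx ((if μ = μ' then EO k E i μ else 0 :
      Module.End Lᵐᵒᵖ (Fin (n+1) → L)) f) p = (if μ = μ' then Ec E i μ p else 0) * fx f p := by
    split_ifs
    · exact fx_E _ _ _ hp
    · simp [fx_zero]
  rw [e0]
  congr 1
  by_cases h1 : μ ⟨p, hp⟩ = i
  · by_cases h2 : μ' ⟨p, hp⟩ = i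
    · rw [Ec_pos i hp h1, Ec_pos i hp h2, H.ee]
      by_cases h3 : rm μ p = rm μ' p
      · rw [if_pos h3, if_pos (rm_inj hp (h1.trans h2.symm) h3)]
      · rw [if_neg h3, if_neg (fun h => h3 (by rw [h]))]
    · rw [Ec_neg i hp h2, mul_zero, if_neg]
      rintro rfl; exact h2 h1
  · rw [Ec_neg i hp h1, zero_mul, ite_self]

lemma Loc.O_esum (H : Loc C n E X T t Y) : ∑ μ, EO k E i μ = 1 := by
  unfold EO
  rw [← map_sum]
  convert map_one (dg k n L)
  funext p
  rw [Finset.sum_apply, Pi.one_apply, ← (Fin.insertNthEquiv (fun _ => I) p).sum_comp,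
    Fintype.sum_prod_type]
  have : ∀ x : I, ∀ ν : Fin n → I, Ec E i ((Fin.insertNthEquiv (fun _ => I) p) (x, ν)) p =
      if x = i then E ν else 0 := by
    intro x ν
    have hp : (p : ℕ) < n + 1 := p.2
    simp only [Ec, hp, dif_pos, rm_eq_removeNth]
    simp [Fin.insertNthEquiv]
  simp only [this]
  rw [Finset.sum_eq_single i]
  · simp [H.esum]
  · intro b _ hb; simp [hb]
  · simp

lemma Loc.O_xx (H : Loc C n E X T t Y) (a b : ℕ) (ha : a < n + 1) (hb : b < n + 1) :
    XO k n X t a * XO k n X t b = XO k n X t b * XO k n X t a := by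
  refine end_ext fun f p hp => ?_
  simp only [Module.End.mul_apply]
  rw [fx_X _ _ hp, fx_X _ _ hp, fx_X _ _ hp, fx_X _ _ hp, ← mul_assoc, ← mul_assoc,
    (H.commute_of_mem (Xc_pol ha hp) (Xc_pol hb hp)).eq]

lemma Loc.O_xe (H : Loc C n E X T t Y) (a : ℕ) (μ) (ha : a < n + 1) :
    XO k n X t a * EO k E i μ = EO k E i μ * XO k n X t a := by
  refine end_ext fun f p hp => ?_
  simp only [Module.End.mul_apply]
  rw [fx_X _ _ hp, fx_E _ _ _ hp, fx_E _ _ _ hp, fx_X _ _ hp, ← mul_assoc, ← mul_assoc,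
    (H.commute_of_mem (Xc_pol ha hp) (Ec_pol i)).eq]

lemma Loc.O_tt (H : Loc C n E X T t Y) (l m : ℕ) (hl : l + 1 < n + 1) (hm : m + 1 < n + 1)
    (hlm : l + 1 < m) : TO C E X T t Y i l * TO C E X T t Y i m =
      TO C E X T t Y i m * TO C E X T t Y i l := by
  refine end_ext fun f p hp => ?_
  simp only [Module.End.mul_apply]
  obtain ⟨a1, a2, a3⟩ := H.T_far i l (m-1) (by omega) (by omega) (by omega) (by omega)
  obtain ⟨b1, b2, b3⟩ := H.T_far i m l (by omega) (by omega) (by omega) (by omega)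
  by_cases c0 : p = l
  · subst c0
    rw [fx_T0 i _ (by omega), fx_Tlt i _ hp (by omega), fx_Tlt i _ (by omega) hlm,
      fx_Tlt i _ hp (by omega), fx_T0 i _ (by omega)]
    simp only [← mul_assoc, mul_sub, mul_add, sub_mul, add_mul, a1, a2, a3]
  by_cases c1 : p = l + 1
  · subst c1
    rw [fx_T1 i _ (by omega), fx_Tlt i _ hp (by omega), fx_Tlt i _ (by omega) (by omega),
      fx_Tlt i _ hp (by omega), fx_T1 i _ (by omega)]
    simp only [← mul_assoc, mul_sub, mul_add, sub_mul, add_mul, a1, a2, a3]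
  by_cases c2 : p = m
  · subst c2
    rw [fx_Tgt i _ hp (by omega), fx_T0 i _ (by omega), fx_T0 i _ (by omega),
      fx_Tgt i _ hp (by omega), fx_Tgt i _ hm (by omega)]
    simp only [← mul_assoc, mul_sub, mul_add, sub_mul, add_mul, b1, b2, b3]
  by_cases c3 : p = m + 1
  · subst c3
    rw [fx_Tgt i _ hp (by omega), fx_T1 i _ (by omega), fx_T1 i _ (by omega),
      fx_Tgt i _ hp (by omega), fx_Tgt i _ (by omega) (by omega)]
    simp only [← mul_assoc, mul_sub, mul_add, sub_mul, add_mul, b1, b2, b3]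
  by_cases c4 : p < l
  · rw [fx_Tlt i _ hp c4, fx_Tlt i _ hp (by omega), fx_Tlt i _ hp (by omega), fx_Tlt i _ hp c4,
      ← mul_assoc, ← mul_assoc, H.tt _ _ (by omega) (by omega) (by omega)]
  by_cases c5 : p < m
  · rw [fx_Tgt i _ hp (by omega), fx_Tlt i _ hp (by omega), fx_Tlt i _ hp (by omega),
      fx_Tgt i _ hp (by omega), ← mul_assoc, ← mul_assoc,
      H.tt _ _ (by omega) (by omega) (by omega)]
  · rw [fx_Tgt i _ hp (by omega), fx_Tgt i _ hp (by omega), fx_Tgt i _ hp (by omega),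
      fx_Tgt i _ hp (by omega), ← mul_assoc, ← mul_assoc,
      H.tt _ _ (by omega) (by omega) (by omega)]

lemma Loc.O_tsq (H : Loc C n E X T t Y) (l : ℕ) (h : l + 1 < n + 1) (μ) :
    TO C E X T t Y i l * TO C E X T t Y i l * EO k E i μ =
    Qel C (μ ⟨l, by omega⟩) (μ ⟨l + 1, h⟩) (XO k n X t l) (XO k n X t (l + 1)) * EO k E i μ := by
  have hl : l < n := by omega
  have cc : ∀ {a b : L}, a ∈ pol k E X t Y → b ∈ pol k E X t Y → a * b = b * a :=
    fun h1 h2 => (H.commute_of_mem h1 h2).eq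
  have ad := H.al_de i l
  have da := (cc (pol_de i l) (pol_al i l)).trans ad
  have aq := H.al_qq i l
  have qa := (cc (pol_qq (C := C) i l) (pol_al i l)).trans aq
  have dq := H.de_qq i l
  have qd := (cc (pol_qq (C := C) i l) (pol_de i l)).trans dq
  have tl : ∀ {x y z : L}, x * y = z → ∀ w, x * (y * w) = z * w := fun h w => by
    rw [← mul_assoc, h]
  refine end_ext fun f p hp => ?_
  simp only [Module.End.mul_apply]
  rw [fx_Q _ _ _ _ _ hp]
  by_cases c0 : p = l
  · subst c0
    rw [fx_T0 i _ hl, fx_T0 i _ hl, fx_T1 i _ hl, fx_E _ _ _ hp, Xc_eq,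
      Xc_gt (by omega : p < p + 1), Nat.add_sub_cancel]
    have key : qq C E X t i p * Ec E i μ p =
      Qel C (μ ⟨p, hp⟩) (μ ⟨p+1, h⟩) t (X p) * Ec E i μ p := by
      by_cases hc : μ ⟨p, hp⟩ = i
      · rw [Ec_pos i hp hc, H.E_qq i hl, rm_ge _ _ le_rfl, hc]
      · rw [Ec_neg i hp hc]; simp
    rw [← mul_assoc (Qel _ _ _ _ _), ← key]
    simp only [mul_assoc, mul_sub, mul_add, sub_mul, add_mul, tl ad, tl da, tl aq, tl qa, tl dq,
      tl qd, zero_mul, mul_zero]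
    abel
  by_cases c1 : p = l + 1
  · subst c1
    rw [fx_T1 i _ hl, fx_T0 i _ hl, fx_T1 i _ hl, fx_E _ _ _ hp, Xc_eq,
      Xc_lt (by omega : l < l + 1)]
    have key : qq C E X t i l * Ec E i μ (l+1) =
      Qel C (μ ⟨l, by omega⟩) (μ ⟨l+1, h⟩) (X l) t * Ec E i μ (l+1) := by
      by_cases hc : μ ⟨l+1, hp⟩ = i
      · rw [Ec_pos i hp hc, H.E_qq i hl, rm_lt _ _ (by omega), hc, Qel_symm C _ _ _ _ (H.tX l hl)]
      · rw [Ec_neg i hp hc]; simp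
    rw [← mul_assoc (Qel _ _ _ _ _), ← key]
    simp only [mul_assoc, mul_sub, mul_add, sub_mul, add_mul, tl ad, tl da, tl aq, tl qa, tl dq,
      tl qd, zero_mul, mul_zero]
    abel
  by_cases c2 : p < l
  · rw [fx_Tlt i _ hp c2, fx_Tlt i _ hp c2, fx_E _ _ _ hp, Xc_gt c2, Xc_gt (by omega : p < l + 1)]
    simp only [← mul_assoc]
    congr 1
    by_cases hc : μ ⟨p, hp⟩ = i
    · have := H.tsq (l-1) (by omega) (rm μ p)
      rw [rm_ge _ _ (by omega), rm_ge _ _ (by omega)] at this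
      rw [Ec_pos i hp hc, this]
      obtain ⟨l, rfl⟩ : ∃ m, l = m + 1 := ⟨l-1, by omega⟩
      rfl
    · rw [Ec_neg i hp hc]; simp
  · have c3 : l + 1 < p := by omega
    rw [fx_Tgt i _ hp c3, fx_Tgt i _ hp c3, fx_E _ _ _ hp, Xc_lt c3, Xc_lt (by omega : l < p)]
    simp only [← mul_assoc]
    congr 1
    by_cases hc : μ ⟨p, hp⟩ = i
    · have := H.tsq l (by omega) (rm μ p)
      rw [rm_lt _ _ (by omega), rm_lt _ _ (by omega)] at this
      rw [Ec_pos i hp hc, this]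
    · rw [Ec_neg i hp hc]; simp

lemma Loc.O_braid (H : Loc C n E X T t Y) (l : ℕ) (h : l + 2 < n + 1) (μ) :
    (TO C E X T t Y i (l+1) * TO C E X T t Y i l * TO C E X T t Y i (l+1) -
      TO C E X T t Y i l * TO C E X T t Y i (l+1) * TO C E X T t Y i l) * EO k E i μ =
    if μ ⟨l, by omega⟩ = μ ⟨l + 2, h⟩ then
      Qdiff C (μ ⟨l, by omega⟩) (μ ⟨l + 1, by omega⟩) (XO k n X t l) (XO k n X t (l + 1))
        (XO k n X t (l + 2)) * EO k E i μ else 0 := by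
  have hl : l + 1 < n := by omega
  have hl0 : l < n := by omega
  have cc : ∀ {a b : L}, a ∈ pol k E X t Y → b ∈ pol k E X t Y → a * b = b * a :=
    fun h1 h2 => (H.commute_of_mem h1 h2).eq
  have Pa := pol_al (k := k) (E := E) (X := X) (t := t) (Y := Y) i l
  have Pb := pol_al (k := k) (E := E) (X := X) (t := t) (Y := Y) i (l+1)
  have Pd := pol_de (k := k) (E := E) (X := X) (t := t) (Y := Y) i l
  have Pe := pol_de (k := k) (E := E) (X := X) (t := t) (Y := Y) i (l+1)
  have Pq := pol_qq (C := C) (E := E) (X := X) (t := t) (Y := Y) i l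
  have Pr := pol_qq (C := C) (E := E) (X := X) (t := t) (Y := Y) i (l+1)
  have PD := pol_dd (C := C) (E := E) (X := X) (t := t) (Y := Y) i l
  obtain ⟨k1, k2, k3, k4, k5, k6, k7, k8, k9⟩ := braid_coeffs (T l) (al E Y i l) (al E Y i (l+1))
    (de E i l) (de E i (l+1)) (qq C E X t i l) (qq C E X t i (l+1)) (dd C E X t i l)
    (cc Pb Pa) ((cc Pd Pa).trans (H.al_de i l)) (H.al_de i l) (cc Pd Pb) (cc Pe Pa)
    ((cc Pe Pb).trans (H.al_de i _)) (H.al_de i _) (cc Pe Pd)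
    ((cc Pq Pa).trans (H.al_qq i l)) (H.al_qq i l) (cc Pq Pb) ((cc Pq Pd).trans (H.de_qq i l))
    (H.de_qq i l) (cc Pq Pe) (cc Pr Pa) ((cc Pr Pb).trans (H.al_qq i _)) (H.al_qq i _) (cc Pr Pd)
    ((cc Pr Pe).trans (H.de_qq i _)) (H.de_qq i _) (cc Pr Pq)
    ((cc PD Pa).trans (H.al_dd i l)) (H.al_dd i l) (H.al2_dd i l hl)
    ((cc PD Pb).trans (H.al2_dd i l hl)) (H.de2_dd i l hl)
    ((cc PD Pe).trans (H.de2_dd i l hl)) (cc PD Pq)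
    (H.T_al i l hl) (H.T_al2 i l hl) (H.T_de i l hl) (H.T_de2 i l hl) (H.T_qq i l hl)
    (H.T_qq2 i l hl)
  refine end_ext fun f p hp => ?_
  have e0 : fx ((if μ ⟨l, by omega⟩ = μ ⟨l + 2, h⟩ then
      Qdiff C (μ ⟨l, by omega⟩) (μ ⟨l + 1, by omega⟩) (XO k n X t l) (XO k n X t (l + 1))
        (XO k n X t (l + 2)) * EO k E i μ else 0 :
      Module.End Lᵐᵒᵖ (Fin (n+1) → L)) f) p =
      (if μ ⟨l, by omega⟩ = μ ⟨l + 2, h⟩ then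
      Qdiff C (μ ⟨l, by omega⟩) (μ ⟨l + 1, by omega⟩) (Xc X t l p) (Xc X t (l + 1) p)
        (Xc X t (l + 2) p) * Ec E i μ p else 0) * fx f p := by
    split_ifs
    · rw [Module.End.mul_apply, fx_D _ _ _ _ _ _ hp, fx_E _ _ _ hp, mul_assoc]
    · simp [fx_zero]
  rw [e0]
  simp only [Module.End.mul_apply, LinearMap.sub_apply]
  rw [fx_sub]
  have u0 : ∀ g, fx (TO C E X T t Y i (l+1) g) l = T l * fx g l := fun g => by
    rw [fx_Tlt i _ (by omega) (by omega)]; rfl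
  have u1 : ∀ g, fx (TO C E X T t Y i (l+1) g) (l+1) =
    (al E Y i (l+1) + de E i (l+1)) * fx g (l+2) - al E Y i (l+1) * fx g (l+1) := fun g =>
      fx_T0 i _ hl
  have u2 : ∀ g, fx (TO C E X T t Y i (l+1) g) (l+2) =
    al E Y i (l+1) * fx g (l+2) + (qq C E X t i (l+1) - al E Y i (l+1)) * fx g (l+1) := fun g =>
      fx_T1 i _ hl
  have v0 : ∀ g, fx (TO C E X T t Y i l g) l =
    (al E Y i l + de E i l) * fx g (l+1) - al E Y i l * fx g l := fun g => fx_T0 i _ hl0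
  have v1 : ∀ g, fx (TO C E X T t Y i l g) (l+1) =
    al E Y i l * fx g (l+1) + (qq C E X t i l - al E Y i l) * fx g l := fun g => fx_T1 i _ hl0
  have v2 : ∀ g, fx (TO C E X T t Y i l g) (l+2) = T l * fx g (l+2) := fun g =>
    fx_Tgt i _ (by omega) (by omega)
  by_cases c0 : p = l
  · subst c0
    have key : al E Y i (p+1) * (qq C E X t i p - T p * T p) * Ec E i μ p =
      if μ ⟨p, hp⟩ = μ ⟨p+2, h⟩ then
      Qdiff C (μ ⟨p, hp⟩) (μ ⟨p + 1, by omega⟩) (Xc X t p p) (Xc X t (p + 1) p)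
        (Xc X t (p + 2) p) * Ec E i μ p else 0 := by
      rw [Xc_eq, Xc_gt (by omega : p < p + 1), Xc_gt (by omega : p < p + 2), Nat.add_sub_cancel]
      by_cases hc : μ ⟨p, hp⟩ = i
      · rw [Ec_pos i hp hc, H.al_G i p hl, rm_ge _ _ le_rfl, rm_ge _ _ (by omega), hc]
        simp only [eq_comm]
        rfl
      · rw [Ec_neg i hp hc]; simp
    rw [← key]
    simp only [u0, u1, u2, v0, v1, v2]
    rw [mul_assoc, ← fx_E (k := k) i f μ hp]
    set g := EO k E i μ f
    rw [← k3, ← sub_eq_zero, ← zero_mul (fx g (p+1)), ← k2, ← sub_eq_zero,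
      ← zero_mul (fx g (p+2)), ← sub_eq_zero.2 k1]
    noncomm_ring
  by_cases c1 : p = l + 1
  · subst c1
    have key : dd C E X t i l * Ec E i μ (l+1) =
      if μ ⟨l, by omega⟩ = μ ⟨l+2, h⟩ then
      Qdiff C (μ ⟨l, by omega⟩) (μ ⟨l + 1, by omega⟩) (Xc X t l (l+1)) (Xc X t (l + 1) (l+1))
        (Xc X t (l + 2) (l+1)) * Ec E i μ (l+1) else 0 := by
      rw [Xc_eq, Xc_lt (by omega : l < l + 1), Xc_gt (by omega : l + 1 < l + 2)]
      by_cases hc : μ ⟨l+1, hp⟩ = i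
      · rw [Ec_pos i hp hc, H.E_dd i hl, rm_lt _ _ (by omega), rm_ge _ _ (by omega), hc]
        rfl
      · rw [Ec_neg i hp hc]; simp
    rw [← key]
    simp only [u0, u1, u2, v0, v1, v2]
    rw [mul_assoc, ← fx_E (k := k) i f μ hp]
    set g := EO k E i μ f
    rw [← k5, ← sub_eq_zero, ← zero_mul (fx g l), ← k6, ← sub_eq_zero,
      ← zero_mul (fx g (l+2)), ← k4]
    noncomm_ring
  by_cases c2 : p = l + 2
  · subst c2
    have key : al E Y i l * (qq C E X t i (l+1) - T l * T l) * Ec E i μ (l+2) =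
      if μ ⟨l, by omega⟩ = μ ⟨l+2, h⟩ then
      Qdiff C (μ ⟨l, by omega⟩) (μ ⟨l + 1, by omega⟩) (Xc X t l (l+2)) (Xc X t (l + 1) (l+2))
        (Xc X t (l + 2) (l+2)) * Ec E i μ (l+2) else 0 := by
      rw [Xc_eq, Xc_lt (by omega : l < l + 2), Xc_lt (by omega : l + 1 < l + 2)]
      by_cases hc : μ ⟨l+2, hp⟩ = i
      · rw [Ec_pos i hp hc, H.al_G2 i l hl, rm_lt _ _ (by omega), rm_lt _ _ (by omega), hc]
        split_ifs with h5
        · rw [h5]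
        · rfl
      · rw [Ec_neg i hp hc]; simp
    rw [← key]
    simp only [u0, u1, u2, v0, v1, v2]
    rw [mul_assoc, ← fx_E (k := k) i f μ hp]
    set g := EO k E i μ f
    rw [← k7, ← sub_eq_zero, ← zero_mul (fx g (l+1)), ← k8, ← sub_eq_zero,
      ← zero_mul (fx g l), ← sub_eq_zero.2 k9]
    noncomm_ring
  by_cases c3 : p < l
  · obtain ⟨l, rfl⟩ : ∃ m, l = m + 1 := ⟨l-1, by omega⟩
    have w0 : ∀ g, fx (TO C E X T t Y i (l+1) g) p = T l * fx g p := fun g => by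
      rw [fx_Tlt i _ hp c3]; rfl
    have w1 : ∀ g, fx (TO C E X T t Y i (l+1+1) g) p = T (l+1) * fx g p := fun g => by
      rw [fx_Tlt i _ hp (by omega)]; rfl
    simp only [w0, w1]
    rw [fx_E _ _ _ hp, Xc_gt c3, Xc_gt (by omega : p < l + 1 + 1),
      Xc_gt (by omega : p < l + 1 + 2)]
    simp only [← mul_assoc]
    rw [← sub_mul, ← sub_mul]
    congr 1
    by_cases hc : μ ⟨p, hp⟩ = i
    · have := H.braid l (by omega) (rm μ p)
      rw [rm_ge _ _ (by omega), rm_ge _ _ (by omega), rm_ge _ _ (by omega)] at this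
      rw [Ec_pos i hp hc]
      exact this
    · rw [Ec_neg i hp hc]; simp
  · have c4 : l + 2 < p := by omega
    have w0 : ∀ g, fx (TO C E X T t Y i l g) p = T l * fx g p := fun g => by
      rw [fx_Tgt i _ hp (by omega)]
    have w1 : ∀ g, fx (TO C E X T t Y i (l+1) g) p = T (l+1) * fx g p := fun g => by
      rw [fx_Tgt i _ hp (by omega)]
    simp only [w0, w1]
    rw [fx_E _ _ _ hp, Xc_lt (by omega : l < p), Xc_lt (by omega : l + 1 < p),
      Xc_lt (by omega : l + 2 < p)]
    simp only [← mul_assoc]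
    rw [← sub_mul, ← sub_mul]
    congr 1
    by_cases hc : μ ⟨p, hp⟩ = i
    · have := H.braid l (by omega) (rm μ p)
      rw [rm_lt _ _ (by omega), rm_lt _ _ (by omega), rm_lt _ _ (by omega)] at this
      rw [Ec_pos i hp hc]
      exact this
    · rw [Ec_neg i hp hc]; simp

/-- The operators satisfy the KLR relations. -/
lemma Loc.isKLR (H : Loc C n E X T t Y) :
    IsKLR C (n+1) (EO k E i) (XO k n X t) (TO C E X T t Y i) where
  ee := H.O_ee i
  esum := H.O_esum i
  xx := H.O_xx
  xe := H.O_xe i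
  te := H.O_te i
  tt := H.O_tt i
  tsq := H.O_tsq i
  tx1 := H.O_tx1 i
  tx2 := H.O_tx2 i
  tx := H.O_tx i
  braid := H.O_braid i

end
end KLR

set_option linter.unusedSectionVars false
set_option linter.unusedSimpArgs false
namespace KLR
variable {k : Type} [Field k] {I : Type} [Fintype I] [DecidableEq I]
section
variable {C : CartanDatum k I} {n : ℕ} {L : Type} [Ring L] [Algebra k L]
    {E : (Fin n → I) → L} {X T : ℕ → L}

lemma IsKLR.nil_same (H : IsKLR C n E X T) (a : ℕ) (h : a + 1 < n) (hx : IsNilpotent (X a))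
    (ν) (hν : ν ⟨a, by omega⟩ = ν ⟨a+1, h⟩) : IsNilpotent (X (a+1) * E ν) := by
  have ha : a < n := by omega
  have sν : sw ν a h = ν := by
    funext ⟨b, hb⟩
    rw [sw_apply]
    split_ifs with h1 h2
    · subst h1; exact hν.symm
    · subst h2; exact hν
    · rfl
  have TE : T a * E ν = E ν * T a := by
    have := H.te a h ν
    rwa [sν] at this
  have TTE : T a * T a * E ν = 0 := by rw [H.tsq a h ν, hν, Qel_self, zero_mul]
  have c1 : Commute (X a) (X (a+1)) := H.xx _ _ ha h
  have c2 : Commute (X a) (E ν) := H.xe _ _ ha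
  have c3 : Commute (X (a+1)) (E ν) := H.xe _ _ h
  have key : ∀ m, ∃ g, Commute g (X a) ∧ Commute g (X (a+1)) ∧ Commute g (E ν) ∧
      X (a+1) ^ (m+1) * (T a * E ν) = T a * X a ^ (m+1) * E ν +
        (X (a+1) ^ m + X a * g) * E ν := by
    intro m
    induction m with
    | zero =>
      refine ⟨0, Commute.zero_left _, Commute.zero_left _, Commute.zero_left _, ?_⟩
      have := H.tx1 a h ν
      rw [if_pos hν] at this
      simp only [zero_add, pow_one, pow_zero, mul_zero, add_zero, this]
      noncomm_ring
    | succ m ih =>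
      obtain ⟨g, g1, g2, g3, e⟩ := ih
      refine ⟨X (a+1)^m + X a * g, ?_, ?_, ?_, ?_⟩
      · exact (c1.symm.pow_left _).add_left ((Commute.refl _).mul_left g1)
      · exact ((Commute.refl _).pow_left _).add_left (c1.mul_left g2)
      · exact (c3.pow_left _).add_left (c2.mul_left g3)
      · have e1 := H.tx1 a h ν
        rw [if_pos hν] at e1
        have e2 : X (a+1) * (T a * E ν) = (T a * E ν) * X a + E ν := by
          rw [mul_assoc (T a), ← c2.eq, ← mul_assoc (T a), e1]; noncomm_ring
        have e3 : (X (a+1) ^ m + X a * g) * X a = X a * (X (a+1)^m + X a * g) :=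
          ((c1.symm.pow_left _).add_left ((Commute.refl _).mul_left g1)).eq
        rw [pow_succ (X (a+1)), mul_assoc, e2, mul_add, ← mul_assoc, e, add_mul, mul_assoc _ (E ν),
          ← c2.eq, ← mul_assoc, mul_assoc (T a), ← pow_succ (X a), mul_assoc _ (E ν), ← c2.eq,
          ← mul_assoc, e3, add_assoc, ← add_mul, add_comm (X a * _)]
  obtain ⟨m, hm⟩ := hx
  obtain ⟨g, g1, g2, g3, e⟩ := key m
  rw [pow_succ (X a), hm, zero_mul, mul_zero, zero_mul, zero_add] at e
  have ch1 : Commute (X (a+1) ^ m + X a * g) (X (a+1)) :=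
    ((Commute.refl _).pow_left _).add_left (c1.mul_left g2)
  have ch2 : Commute (X (a+1) ^ m + X a * g) (E ν) := (c3.pow_left _).add_left (c2.mul_left g3)
  have ch3 : Commute (X (a+1) ^ m + X a * g) (X a) :=
    (c1.symm.pow_left _).add_left ((Commute.refl _).mul_left g1)
  have ch4 : Commute (X (a+1) ^ m + X a * g) g :=
    (g2.symm.pow_left _).add_left (g1.symm.mul_left (Commute.refl _))
  set h' := X (a+1) ^ m + X a * g with hh
  have z1 : h' * (T a * E ν) = 0 := by
    have := congrArg (· * T a) e
    simp only [mul_assoc] at this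
    rw [← TE, ← mul_assoc (T a), TTE, mul_zero] at this
    exact this.symm
  have z2 : h' * (h' * E ν) = 0 := by
    rw [← e, ← mul_assoc, (ch1.pow_right _).eq, mul_assoc, z1, mul_zero]
  have ee : E ν * E ν = E ν := by rw [H.ee, if_pos rfl]
  have n1 : IsNilpotent (h' * E ν) := by
    refine ⟨2, ?_⟩
    rw [pow_two, mul_assoc, ← mul_assoc (E ν), ← ch2.eq, mul_assoc, ee, z2]
  have n2 : IsNilpotent (X a * (g * E ν)) :=
    (g1.symm.mul_right c2).isNilpotent_mul_right ⟨m, hm⟩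
  have n3 : IsNilpotent (X (a+1)^m * E ν) := by
    have : X (a+1)^m * E ν = h' * E ν - X a * (g * E ν) := by rw [hh]; noncomm_ring
    rw [this]
    refine Commute.isNilpotent_sub ?_ n1 n2
    exact (ch3.mul_right (ch4.mul_right ch2)).mul_left
      (c2.symm.mul_right (g3.symm.mul_right (Commute.refl _)))
  obtain ⟨r, hr⟩ := n3
  refine ⟨(m+1)*r, ?_⟩
  rw [c3.mul_pow, pow_mul, pow_mul, ← Commute.mul_pow]
  · have : X (a+1)^(m+1) * E ν ^ (m+1) = X (a+1) * E ν ^ m * (X (a+1)^m * E ν) := by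
      rw [pow_succ' (X (a+1)), pow_succ (E ν)]
      simp only [mul_assoc]
      rw [← mul_assoc (X (a+1)^m), ((c3.pow_left m).pow_right m).eq, mul_assoc]
    rw [this, Commute.mul_pow, hr, mul_zero]
    exact ((((Commute.refl _).pow_right _).mul_right c3)).mul_left
      (((c3.symm.pow_right _).mul_right (Commute.refl _)).pow_left _)
  · exact (c3.pow_left _).pow_right _

lemma IsKLR.nil_diff (H : IsKLR C n E X T) (a : ℕ) (h : a + 1 < n) (hx : IsNilpotent (X a))
    (ν) (hν : ν ⟨a, by omega⟩ ≠ ν ⟨a+1, h⟩) : IsNilpotent (X (a+1) * E ν) := by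
  have ha : a < n := by omega
  have c1 : Commute (X a) (X (a+1)) := H.xx _ _ ha h
  have c3 : Commute (X (a+1)) (E ν) := H.xe _ _ h
  obtain ⟨m, hm⟩ := hx
  have key : ∀ m, T a * (E ν * X (a+1)^m) = X a ^ m * (T a * E ν) := by
    intro m
    induction m with
    | zero => simp
    | succ m ih =>
      have := H.tx2 a h ν
      rw [if_neg hν, add_zero, mul_assoc, c3.eq, ← mul_assoc] at this
      rw [pow_succ', ← mul_assoc, ← mul_assoc, this, mul_assoc, mul_assoc, ih, ← mul_assoc (X a),
        ← pow_succ']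
  have z := congrArg (T a * ·) (key m)
  simp only [hm, zero_mul, mul_zero] at z
  rw [← mul_assoc, ← mul_assoc, H.tsq a h, Qel_symm C _ _ _ _ c1, mul_assoc] at z
  obtain ⟨c, M, s, hc, s1, s2, e⟩ := Qel_lead C _ _ hν.symm (X (a+1)) (X a) c1.symm
  set u := E ν * X (a+1)^m
  rw [e, add_mul] at z
  have z1 : X (a+1)^M * u = X a * ((-c⁻¹) • s) * u := by
    have := congrArg (c⁻¹ • ·) (eq_neg_of_add_eq_zero_left z)
    simp only [smul_mul_assoc, smul_smul, inv_mul_cancel₀ hc, one_smul] at this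
    rw [this]
    simp [mul_assoc]
  have cs : Commute (X (a+1)^M) (X a * ((-c⁻¹) • s)) :=
    (c1.symm.mul_right (s1.smul_right _)).pow_left _
  have z2 : ∀ j, (X (a+1)^M)^j * u = (X a * ((-c⁻¹) • s))^j * u := by
    intro j
    induction j with
    | zero => simp
    | succ j ih =>
      rw [pow_succ, mul_assoc, z1, ← mul_assoc, (cs.pow_left j).eq, mul_assoc, ih, ← mul_assoc,
        ← pow_succ']
  have z3 := z2 m
  rw [Commute.mul_pow (s2.smul_right _), hm, zero_mul, zero_mul, ← pow_mul] at z3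
  have ee : E ν * E ν = E ν := by rw [H.ee, if_pos rfl]
  have eN : ∀ N, E ν ^ (N+1) = E ν := fun N => by
    induction N with
    | zero => simp
    | succ N ih => rw [pow_succ, ih, ee]
  refine ⟨M * m + m + 1, ?_⟩
  rw [c3.mul_pow, eN, pow_succ', mul_assoc, pow_add, mul_assoc (X (a+1)^(M*m)),
    (c3.pow_left m).eq, z3, mul_zero]

lemma IsKLR.nil (H : IsKLR C n E X T) (h0 : IsNilpotent (X 0)) (a : ℕ) (h : a < n) :
    IsNilpotent (X a) := by
  induction a with
  | zero => exact h0
  | succ a ih =>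
    have : X (a+1) = ∑ ν, X (a+1) * E ν := by rw [← Finset.mul_sum, H.esum, mul_one]
    rw [this]
    refine Commute.isNilpotent_sum (fun ν _ => ?_) (fun μ ν _ _ => ?_)
    · by_cases hν : ν ⟨a, by omega⟩ = ν ⟨a+1, h⟩
      · exact H.nil_same a h (ih (by omega)) ν hν
      · exact H.nil_diff a h (ih (by omega)) ν hν
    · have c3 : ∀ ν, Commute (X (a+1)) (E ν) := fun ν => H.xe _ _ h
      have c4 : Commute (E μ) (E ν) := by
        by_cases hh : μ = ν
        · subst hh; exact Commute.refl _
        · unfold Commute SemiconjBy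
          rw [H.ee, H.ee, if_neg hh, if_neg (Ne.symm hh)]
      exact ((Commute.refl _).mul_right (c3 _)).mul_left (((c3 _).symm).mul_right c4)

variable (C) in
/-- images of the generators in the cyclotomic quotient -/
noncomputable def eA (Λ : I → ℕ) (n : ℕ) (β : I → ℕ) (ν : Fin n → I) : cAlg C Λ n β :=
  toCB C Λ (Ee C ν)
variable (C) in
noncomputable def xA (Λ : I → ℕ) (n : ℕ) (β : I → ℕ) (a : ℕ) : cAlg C Λ n β :=
  toCB C Λ (XN C n a)
variable (C) in
noncomputable def tA (Λ : I → ℕ) (n : ℕ) (β : I → ℕ) (a : ℕ) : cAlg C Λ n β :=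
  toCB C Λ (TN C n a)

variable (C) in
lemma cAlg_isKLR (Λ : I → ℕ) (n : ℕ) (β : I → ℕ) :
    IsKLR C n (eA C Λ n β) (xA C Λ n β) (tA C Λ n β) := (alg_isKLR C n).map (toCB C Λ)

variable (C) in
lemma toCB_mk (Λ : I → ℕ) (n : ℕ) (β : I → ℕ) (x : FA k I n) :
    toCB C Λ (β := β) (RingQuot.mkAlgHom k (Rel C n) x) = RingQuot.mkAlgHom k (CRel C Λ n β) x := by
  simp [toCB, toC, toB]

lemma eA_zero (Λ : I → ℕ) (n : ℕ) (β : I → ℕ) (ν : Fin n → I) (h : content ν ≠ β) :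
    eA C Λ n β ν = 0 := by
  have h1 : ∑ ν ∈ seqs β n, eA C Λ n β ν = 1 := by
    have := RingQuot.mkAlgHom_rel k (CRel.unit (C := C) (Λ := Λ) (n := n) (β := β))
    rw [map_sum, map_one] at this
    rw [← this]
    exact Finset.sum_congr rfl fun ν _ => toCB_mk C Λ n β _
  rw [← mul_one (eA C Λ n β ν), ← h1, Finset.mul_sum]
  refine Finset.sum_eq_zero fun μ hμ => ?_
  rw [(cAlg_isKLR C Λ n β).ee, if_neg]
  rintro rfl
  exact h (by simpa [seqs] using hμ)

lemma cyc_E (Λ : I → ℕ) (n : ℕ) (β : I → ℕ) (h : 0 < n) (ν : Fin n → I) :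
    xA C Λ n β 0 ^ (Λ (ν ⟨0, h⟩)) * eA C Λ n β ν = 0 := by
  by_cases hc : content ν = β
  · have := RingQuot.mkAlgHom_rel k (CRel.cyc (C := C) (Λ := Λ) (n := n) (β := β))
    rw [aLamF, dif_pos h, map_sum, map_zero] at this
    have e : ∀ μ : Fin n → I, (RingQuot.mkAlgHom k (CRel C Λ n β))
        (gx k (⟨0, h⟩ : Fin n) ^ Λ (μ ⟨0, h⟩) * ge k μ) =
        xA C Λ n β 0 ^ (Λ (μ ⟨0, h⟩)) * eA C Λ n β μ := by
      intro μ
      rw [← toCB_mk, map_mul, map_mul, map_pow, map_pow]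
      unfold xA
      rw [XN_eq C h]
      rfl
    simp only [e] at this
    have h2 := congrArg (· * eA C Λ n β ν) this
    simp only [Finset.sum_mul, zero_mul] at h2
    rw [Finset.sum_eq_single_of_mem ν (by simpa [seqs] using hc)] at h2
    · rwa [mul_assoc, (cAlg_isKLR C Λ n β).ee, if_pos rfl] at h2
    · intro μ _ hμ
      rw [mul_assoc, (cAlg_isKLR C Λ n β).ee, if_neg hμ, mul_zero]
  · rw [eA_zero _ _ _ _ hc, mul_zero]

lemma xA_nil (Λ : I → ℕ) (n : ℕ) (β : I → ℕ) (a : ℕ) (ha : a < n) :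
    IsNilpotent (xA C Λ n β a) := by
  refine (cAlg_isKLR C Λ n β).nil ?_ a ha
  have h : 0 < n := by omega
  refine ⟨∑ j, Λ j, eq_of_mul_E (cAlg_isKLR C Λ n β).esum fun ν => ?_⟩
  rw [zero_mul]
  have : Λ (ν ⟨0, h⟩) ≤ ∑ j, Λ j := Finset.single_le_sum (fun _ _ => Nat.zero_le _)
    (Finset.mem_univ _)
  obtain ⟨d, hd⟩ := Nat.exists_eq_add_of_le this
  rw [hd, add_comm, pow_add, mul_assoc, cyc_E Λ n β h, mul_zero]
end
end KLR

set_option linter.unusedSectionVars false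
set_option linter.unusedSimpArgs false
namespace KLR

section span
variable {R : Type} [Ring R] (τ : ℕ → R) (m : ℕ)

/-- `τ_{m-j} ⋯ τ_{m-1}` -/
def wP : ℕ → R
  | 0 => 1
  | j+1 => τ (m - (j+1)) * wP j

/-- `τ_c ⋯ τ_{m-1}` -/
def wT (c : ℕ) : R := wP τ m (m - c)

lemma wT_top : wT τ m m = 1 := by simp [wT, wP]
lemma wT_step {c : ℕ} (h : c < m) : wT τ m c = τ c * wT τ m (c+1) := by
  unfold wT
  obtain ⟨j, hj⟩ : ∃ j, m - c = j + 1 := ⟨m - c - 1, by omega⟩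
  rw [hj, wP, show m - (j+1) = c by omega, show m - (c+1) = j by omega]

/-- the span of `w_d D0`, `d ≥ c` -/
def DD (D0 : AddSubgroup R) (c : ℕ) : AddSubgroup R :=
  AddSubgroup.closure {z | ∃ d y, c ≤ d ∧ d ≤ m ∧ y ∈ D0 ∧ z = wT τ m d * y}

variable {τ m} {D0 : AddSubgroup R}

lemma DD_mem {c d : ℕ} {y : R} (h : c ≤ d) (h' : d ≤ m) (hy : y ∈ D0) :
    wT τ m d * y ∈ DD τ m D0 c := AddSubgroup.subset_closure ⟨d, y, h, h', hy, rfl⟩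

lemma DD_stab {c : ℕ} {r : R} {S : AddSubgroup R}
    (h : ∀ d, c ≤ d → d ≤ m → ∀ y ∈ D0, r * (wT τ m d * y) ∈ S) :
    ∀ z ∈ DD τ m D0 c, r * z ∈ S := by
  have : DD τ m D0 c ≤ S.comap (AddMonoidHom.mulLeft r) := by
    rw [DD, AddSubgroup.closure_le]
    rintro _ ⟨d, y, h1, h2, h3, rfl⟩
    exact h d h1 h2 y h3
  exact fun z hz => this hz

lemma DD_mono {c c' : ℕ} (h : c ≤ c') : DD τ m D0 c' ≤ DD τ m D0 c := by
  refine AddSubgroup.closure_mono ?_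
  rintro _ ⟨d, y, h1, h2, h3, rfl⟩
  exact ⟨d, y, h.trans h1, h2, h3, rfl⟩

variable (P : Subring R)
  (hc : ∀ l, l < m → ∀ p ∈ P, ∃ p' ∈ P, ∃ q ∈ P, p * τ l = τ l * p' + q)
  (hsq : ∀ l, l < m → τ l * τ l ∈ P)
  (hbr : ∀ l, l + 1 < m → ∃ p ∈ P, τ (l+1) * τ l * τ (l+1) = τ l * τ (l+1) * τ l + p)
  (hfar : ∀ l l', l < m → l' < m → l + 1 < l' → τ l * τ l' = τ l' * τ l)
  (hP : ∀ p ∈ P, ∀ y ∈ D0, p * y ∈ D0)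
  (hT : ∀ l, l + 1 < m → ∀ y ∈ D0, τ l * y ∈ D0)

include hfar in
lemma wT_comm {l e : ℕ} (h : l + 1 < e) (he : e ≤ m) : τ l * wT τ m e = wT τ m e * τ l := by
  induction he using Nat.decreasingInduction with
  | self => rw [wT_top, mul_one, one_mul]
  | of_succ e he ih =>
    rw [wT_step τ m he, ← mul_assoc, hfar _ _ (by omega) he h, mul_assoc, ih (by omega), mul_assoc]

include hfar hT in
lemma DD_A {l c e : ℕ} (h : l + 1 < e) (he : e ≤ m) (hce : c ≤ e) {y : R} (hy : y ∈ D0) :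
    τ l * (wT τ m e * y) ∈ DD τ m D0 c := by
  rw [← mul_assoc, wT_comm hfar h he, mul_assoc]
  exact DD_mem hce he (hT l (by omega) y hy)

include hfar hT in
lemma DD_B {d : ℕ} (h : d < m) : ∀ z ∈ DD τ m D0 (d+1), τ d * z ∈ DD τ m D0 d := by
  refine DD_stab fun e h1 h2 y hy => ?_
  by_cases h3 : e = d + 1
  · subst h3
    rw [← mul_assoc, ← wT_step τ m h]
    exact DD_mem le_rfl h.le hy
  · exact DD_A hfar hT (by omega) h2 (by omega) hy

include hc hfar hP hT in
lemma DD_C {d : ℕ} (h : d ≤ m) : ∀ p ∈ P, ∀ z ∈ DD τ m D0 d, p * z ∈ DD τ m D0 d := by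
  induction h using Nat.decreasingInduction with
  | self =>
    refine fun p hp => DD_stab fun e h1 h2 y hy => ?_
    obtain rfl : e = m := by omega
    rw [wT_top, one_mul]
    have := DD_mem (τ := τ) (le_refl e) h2 (hP p hp y hy)
    rwa [wT_top, one_mul] at this
  | of_succ d hd ih =>
    refine fun p hp => DD_stab fun e h1 h2 y hy => ?_
    by_cases h3 : e = d
    · subst h3
      obtain ⟨p', hp', q, hq, e1⟩ := hc e hd p hp
      rw [wT_step τ m hd, ← mul_assoc, ← mul_assoc, e1, mul_assoc, add_mul, mul_assoc]
      exact add_mem (DD_B hfar hT hd _ (ih p' hp' _ (DD_mem le_rfl hd hy)))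
        (DD_mono (by omega) (ih q hq _ (DD_mem le_rfl hd hy)))
    · exact DD_mono (by omega) (ih p hp _ (DD_mem (c := d + 1) (by omega) h2 hy))

include hc hsq hbr hfar hP hT in
lemma DD_D {d : ℕ} (h : d ≤ m) : ∀ l, d ≤ l → l < m →
    ∀ z ∈ DD τ m D0 d, τ l * z ∈ DD τ m D0 d := by
  induction h using Nat.decreasingInduction with
  | self => intro l h1 h2; omega
  | of_succ d hd ih =>
    refine fun l hl hl' => DD_stab fun e h1 h2 y hy => ?_
    by_cases h3 : e = d
    · subst h3
      rw [wT_step τ m hd]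
      by_cases h4 : l = e
      · subst h4
        rw [← mul_assoc, ← mul_assoc, mul_assoc _ _ y]
        exact DD_mono (by omega) (DD_C P hc hfar hP hT (by omega) _ (hsq l hd) _
          (DD_mem (le_refl (l+1)) hd hy))
      by_cases h5 : l = e + 1
      · subst h5
        obtain ⟨p, hp, e1⟩ := hbr e (by omega)
        have h6 : wT τ m (e+2) * y ∈ DD τ m D0 (e+2) := DD_mem le_rfl (by omega) hy
        have e2 : τ (e+1) * (τ e * wT τ m (e+1) * y) = wT τ m e * (τ e * y) +
            p * (wT τ m (e+2) * y) := by
          rw [wT_step τ m hl']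
          have : τ (e+1) * (τ e * (τ (e+1) * wT τ m (e+1+1)) * y) =
            (τ (e+1) * τ e * τ (e+1)) * (wT τ m (e+2) * y) := by noncomm_ring
          rw [this, e1, add_mul, wT_step τ m hd, wT_step τ m hl']
          have h7 := wT_comm hfar (l := e) (e := e + 1 + 1) (by omega) (by omega)
          have : τ e * (τ (e+1) * wT τ m (e+1+1)) * (τ e * y) =
            τ e * τ (e+1) * (wT τ m (e+1+1) * τ e) * y := by noncomm_ring
          rw [this, ← h7]
          noncomm_ring
        rw [e2]
        exact add_mem (DD_mem le_rfl hd.le (hT e (by omega) y hy))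
          (DD_mono (by omega) (DD_C P hc hfar hP hT (by omega) p hp _ h6))
      · have e2 : τ l * (τ e * wT τ m (e+1) * y) = τ e * (τ l * (wT τ m (e+1) * y)) := by
          rw [mul_assoc, ← mul_assoc, ← hfar e l hd hl' (by omega), mul_assoc]
        rw [e2]
        exact DD_B hfar hT hd _ (ih l (by omega) hl' _ (DD_mem le_rfl hd hy))
    · by_cases h4 : l = d
      · subst h4
        exact DD_B hfar hT hd _ (DD_mem (by omega) h2 hy)
      · exact DD_mono (by omega) (ih l (by omega) hl' _ (DD_mem (c := d + 1) (by omega) h2 hy))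

lemma DD_explicit {z : R} (h : z ∈ DD τ m D0 0) :
    ∃ y : Fin (m+1) → R, (∀ c, y c ∈ D0) ∧ z = ∑ c : Fin (m+1), wT τ m (c : ℕ) * y c := by
  induction h using AddSubgroup.closure_induction with
  | mem z hz =>
    obtain ⟨d, y, h1, h2, h3, rfl⟩ := hz
    refine ⟨Pi.single ⟨d, by omega⟩ y, fun c => ?_, ?_⟩
    · by_cases hc : c = ⟨d, by omega⟩
      · subst hc; simpa using h3
      · rw [Pi.single_eq_of_ne hc]; exact zero_mem _
    · rw [Finset.sum_eq_single ⟨d, by omega⟩]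
      · simp
      · intro b _ hb; simp [Pi.single_eq_of_ne hb]
      · simp
  | zero => exact ⟨0, fun _ => zero_mem _, by simp⟩
  | add x y _ _ hx hy =>
    obtain ⟨a, ha, rfl⟩ := hx
    obtain ⟨b, hb, rfl⟩ := hy
    exact ⟨a + b, fun c => add_mem (ha c) (hb c), by simp [mul_add, Finset.sum_add_distrib]⟩
  | neg x _ hx =>
    obtain ⟨a, ha, rfl⟩ := hx
    exact ⟨-a, fun c => neg_mem (ha c), by simp⟩

end span

section tri
variable {ι L : Type} [Fintype ι] [DecidableEq ι] [Ring L]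

/-- right linear map given by a family of vectors -/
def vecMap (v : ι → ι → L) : (ι → L) →ₗ[Lᵐᵒᵖ] (ι → L) where
  toFun y p := ∑ c, v c p * y c
  map_add' y z := by funext p; simp [mul_add, Finset.sum_add_distrib]
  map_smul' r y := by funext p; simp [Finset.sum_mul, mul_assoc]

lemma vecMap_apply (v : ι → ι → L) (y : ι → L) (p : ι) : vecMap v y p = ∑ c, v c p * y c := rfl

lemma vecMap_bij (v : ι → ι → L) (rk : ι → ℕ) (h0 : ∀ c p, p ≠ c → rk p ≤ rk c → v c p = 0)
    (h1 : ∀ c, IsUnit (v c c)) : Function.Bijective (vecMap v) := by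
  constructor
  · rw [injective_iff_map_eq_zero]
    intro y hy
    have key : ∀ s, ∀ p, rk p < s → y p = 0 := by
      intro s
      induction s with
      | zero => intro p hp; omega
      | succ s ih =>
        intro p hp
        have := congrFun hy p
        rw [vecMap_apply, Finset.sum_eq_single p] at this
        · exact (h1 p).mul_right_eq_zero.1 this
        · intro c _ hc
          by_cases h2 : rk p ≤ rk c
          · rw [h0 c p hc.symm h2, zero_mul]
          · rw [ih c (by omega), mul_zero]
        · simp
    funext p
    exact key _ p (Nat.lt_succ_self _)
  · intro f
    have key : ∀ s, ∃ y, ∀ p, rk p < s → vecMap v y p = f p := by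
      intro s
      induction s with
      | zero => exact ⟨0, fun p hp => by omega⟩
      | succ s ih =>
        obtain ⟨y, hy⟩ := ih
        refine ⟨fun p => if rk p = s then ↑(h1 p).unit⁻¹ * (f p - ∑ c ∈ Finset.univ.erase p,
          v c p * y c) else y p, fun p hp => ?_⟩
        rw [vecMap_apply, ← Finset.add_sum_erase _ _ (Finset.mem_univ p)]
        have e1 : ∑ c ∈ Finset.univ.erase p, v c p * (if rk c = s then ↑(h1 c).unit⁻¹ * (f c - 
            ∑ d ∈ Finset.univ.erase c, v d c * y d) else y c) =
            ∑ c ∈ Finset.univ.erase p, v c p * y c := by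
          refine Finset.sum_congr rfl fun c hc => ?_
          split_ifs with h2
          · rw [h0 c p (Finset.ne_of_mem_erase hc).symm (by omega), zero_mul, zero_mul]
          · rfl
        rw [e1]
        by_cases h2 : rk p = s
        · rw [if_pos h2, ← mul_assoc, IsUnit.mul_val_inv, one_mul, sub_add_cancel]
        · rw [if_neg h2, ← hy p (by omega), vecMap_apply,
            ← Finset.add_sum_erase _ _ (Finset.mem_univ p)]
    obtain ⟨y, hy⟩ := key (Finset.univ.sup rk + 1)
    exact ⟨y, funext fun p => hy p (Nat.lt_succ_of_le (Finset.le_sup (Finset.mem_univ p)))⟩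
end tri
end KLR

set_option linter.unusedSectionVars false
set_option linter.unusedSimpArgs false
namespace KLR
variable {k : Type} [Field k] {I : Type} [Fintype I] [DecidableEq I]

section
variable {C : CartanDatum k I} {m : ℕ} {R : Type} [Ring R] [Algebra k R]
    {E : (Fin m → I) → R} {X T : ℕ → R}

variable (k E X) in
/-- the polynomial part -/
def pP : Subalgebra k R := Algebra.adjoin k {z | (∃ ν, z = E ν) ∨ ∃ a, a < m ∧ z = X a}

lemma pP_E (ν) : E ν ∈ pP k E X := Algebra.subset_adjoin (Or.inl ⟨ν, rfl⟩)
lemma pP_X {a : ℕ} (h : a < m) : X a ∈ pP k E X := Algebra.subset_adjoin (Or.inr ⟨a, h, rfl⟩)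
lemma pP_sS {c : (Fin m → I) → R} (h : ∀ ν, c ν ∈ pP k E X) : sS E c ∈ pP k E X :=
  sum_mem fun ν _ => mul_mem (h ν) (pP_E ν)

lemma pP_hc (H : IsKLR C m E X T) (l : ℕ) (h : l + 1 < m) : ∀ p ∈ pP k E X,
    ∃ p' ∈ pP k E X, ∃ q ∈ pP k E X, p * T l = T l * p' + q := by
  have hD : sS E (fun ν => if ν ⟨l, by omega⟩ = ν ⟨l + 1, h⟩ then 1 else 0) ∈ pP k E X := by
    refine pP_sS fun ν => ?_
    split_ifs
    · exact one_mem _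
    · exact zero_mem _
  intro p hp
  induction hp using Algebra.adjoin_induction with
  | mem x hx =>
    rcases hx with ⟨ν, rfl⟩ | ⟨a, ha, rfl⟩
    · refine ⟨E (sw ν l h), pP_E _, 0, zero_mem _, ?_⟩
      rw [H.te l h, sw_sw, add_zero]
    · by_cases h1 : a = l
      · subst h1
        refine ⟨X (a+1), pP_X h, _, neg_mem hD, eq_of_mul_E H.esum fun ν => ?_⟩
        rw [add_mul, H.tx2 a h, neg_mul, H.sS_mul_E]
        split_ifs <;> simp
      by_cases h2 : a = l + 1
      · subst h2
        refine ⟨X l, pP_X (by omega), _, hD, eq_of_mul_E H.esum fun ν => ?_⟩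
        rw [add_mul, H.tx1 l h, H.sS_mul_E]
        split_ifs <;> simp
      · exact ⟨X a, pP_X ha, 0, zero_mem _, by rw [H.tx l a h ha h1 h2, add_zero]⟩
  | algebraMap r => exact ⟨algebraMap k R r, algebraMap_mem _ _, 0, zero_mem _, by
      rw [Algebra.commutes, add_zero]⟩
  | add x y hx hy h1 h2 =>
    obtain ⟨p1, hp1, q1, hq1, e1⟩ := h1
    obtain ⟨p2, hp2, q2, hq2, e2⟩ := h2
    refine ⟨_, add_mem hp1 hp2, _, add_mem hq1 hq2, ?_⟩
    rw [add_mul, e1, e2, mul_add]; abel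
  | mul x y hx hy h1 h2 =>
    obtain ⟨p1, hp1, q1, hq1, e1⟩ := h1
    obtain ⟨p2, hp2, q2, hq2, e2⟩ := h2
    refine ⟨_, mul_mem hp1 hp2, _, add_mem (mul_mem hq1 hp2) (mul_mem hx hq2), ?_⟩
    rw [mul_assoc, e2, mul_add, ← mul_assoc, e1, add_mul, mul_assoc, add_assoc]

lemma pP_hsq (H : IsKLR C m E X T) (l : ℕ) (h : l + 1 < m) : T l * T l ∈ pP k E X := by
  have : T l * T l = sS E (fun ν => Qel C (ν ⟨l, by omega⟩) (ν ⟨l + 1, h⟩) (X l) (X (l + 1))) := by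
    refine eq_of_mul_E H.esum fun ν => ?_
    rw [H.sS_mul_E, H.tsq l h]
  rw [this]
  exact pP_sS fun ν => Qel_mem C _ _ _ _ _ (pP_X (by omega)) (pP_X h)

lemma pP_hbr (H : IsKLR C m E X T) (l : ℕ) (h : l + 2 < m) : ∃ p ∈ pP k E X,
    T (l+1) * T l * T (l+1) = T l * T (l+1) * T l + p := by
  refine ⟨sS E (fun ν => if ν ⟨l, by omega⟩ = ν ⟨l + 2, h⟩ then
      Qdiff C (ν ⟨l, by omega⟩) (ν ⟨l + 1, by omega⟩) (X l) (X (l + 1)) (X (l + 2)) else 0),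
    pP_sS fun ν => ?_, ?_⟩
  · split_ifs
    · exact Qdiff_mem C _ _ _ _ _ _ (pP_X (by omega)) (pP_X (by omega)) (pP_X (by omega))
    · exact zero_mem _
  · rw [← sub_eq_iff_eq_add']
    refine eq_of_mul_E H.esum fun ν => ?_
    rw [H.sS_mul_E, H.braid l h]
    split_ifs <;> simp

lemma pP_stab (D0 : AddSubgroup R) (hk : ∀ c : k, ∀ y ∈ D0, algebraMap k R c * y ∈ D0)
    (hE : ∀ ν, ∀ y ∈ D0, E ν * y ∈ D0) (hX : ∀ a, a < m → ∀ y ∈ D0, X a * y ∈ D0) :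
    ∀ p ∈ pP k E X, ∀ y ∈ D0, p * y ∈ D0 := by
  intro p hp
  induction hp using Algebra.adjoin_induction with
  | mem x hx =>
    rcases hx with ⟨ν, rfl⟩ | ⟨a, ha, rfl⟩
    · exact hE ν
    · exact hX a ha
  | algebraMap r => exact hk r
  | add x y hx hy h1 h2 => intro z hz; rw [add_mul]; exact add_mem (h1 z hz) (h2 z hz)
  | mul x y hx hy h1 h2 => intro z hz; rw [mul_assoc]; exact h1 _ (h2 z hz)

end

section
variable {C : CartanDatum k I} {n : ℕ}

lemma ideal_of_gens (D : AddSubgroup (Alg C n))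
    (hp : ∀ p ∈ pP k (Ee C (n := n)) (XN C n), ∀ z ∈ D, p * z ∈ D)
    (hT : ∀ l, l + 1 < n → ∀ z ∈ D, TN C n l * z ∈ D) (r : Alg C n) : ∀ z ∈ D, r * z ∈ D := by
  induction r using alg_induction with
  | hc c => exact hp _ (algebraMap_mem _ _)
  | hE ν => exact hp _ (pP_E ν)
  | hX a ha => exact hp _ (pP_X ha)
  | hT l hl => exact hT l hl
  | ha x y h1 h2 => intro z hz; rw [add_mul]; exact add_mem (h1 z hz) (h2 z hz)
  | hm x y h1 h2 => intro z hz; rw [mul_assoc]; exact h1 _ (h2 z hz)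

lemma span1 (D0 : AddSubgroup (Alg C (n+1)))
    (hk : ∀ c : k, ∀ y ∈ D0, algebraMap k _ c * y ∈ D0)
    (hE : ∀ ν, ∀ y ∈ D0, Ee C ν * y ∈ D0) (hX : ∀ a, a < n + 1 → ∀ y ∈ D0, XN C (n+1) a * y ∈ D0)
    (hT : ∀ l, l + 1 < n → ∀ y ∈ D0, TN C (n+1) l * y ∈ D0) (r : Alg C (n+1)) :
    ∀ z ∈ DD (TN C (n+1)) n D0 0, r * z ∈ DD (TN C (n+1)) n D0 0 := by
  have H := alg_isKLR C (n+1)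
  have hP := pP_stab (k := k) D0 hk hE hX
  refine ideal_of_gens _ ?_ ?_ r
  · exact DD_C (pP k (Ee C (n := n+1)) (XN C (n+1))).toSubring
      (fun l hl p hp => pP_hc H l (by omega) p hp)
      (fun l l' h1 h2 h3 => H.tt l l' (by omega) (by omega) h3) hP hT (Nat.zero_le _)
  · intro l hl
    exact DD_D (pP k (Ee C (n := n+1)) (XN C (n+1))).toSubring
      (fun l hl p hp => pP_hc H l (by omega) p hp) (fun l hl => pP_hsq H l (by omega))
      (fun l hl => pP_hbr H l (by omega))
      (fun l l' h1 h2 h3 => H.tt l l' (by omega) (by omega) h3) hP hT (Nat.zero_le _) l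
      (Nat.zero_le _) (by omega)

lemma span2 (D0 : AddSubgroup (Alg C (n+1)))
    (hk : ∀ c : k, ∀ y ∈ D0, algebraMap k _ c * y ∈ D0)
    (hE : ∀ ν, ∀ y ∈ D0, Ee C ν * y ∈ D0) (hX : ∀ a, a < n + 1 → ∀ y ∈ D0, XN C (n+1) a * y ∈ D0)
    (hT : ∀ l, l + 1 < n → ∀ y ∈ D0, TN C (n+1) (l+1) * y ∈ D0) (r : Alg C (n+1)) :
    ∀ z ∈ DD (fun l => TN C (n+1) (n-1-l)) n D0 0,
      r * z ∈ DD (fun l => TN C (n+1) (n-1-l)) n D0 0 := by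
  have H := alg_isKLR C (n+1)
  have hP := pP_stab (k := k) D0 hk hE hX
  have hT' : ∀ l, l + 1 < n → ∀ y ∈ D0, TN C (n+1) (n-1-l) * y ∈ D0 := by
    intro l hl
    obtain ⟨c, hc⟩ : ∃ c, n - 1 - l = c + 1 := ⟨n - 1 - l - 1, by omega⟩
    rw [hc]
    exact hT c (by omega)
  have hfar : ∀ l l', l < n → l' < n → l + 1 < l' → 
      TN C (n+1) (n-1-l) * TN C (n+1) (n-1-l') = TN C (n+1) (n-1-l') * TN C (n+1) (n-1-l) :=
    fun l l' h1 h2 h3 => (H.tt _ _ (by omega) (by omega) (by omega)).symm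
  refine ideal_of_gens _ ?_ ?_ r
  · exact DD_C (pP k (Ee C (n := n+1)) (XN C (n+1))).toSubring
      (fun l hl p hp => pP_hc H _ (by omega) p hp) hfar hP hT' (Nat.zero_le _)
  · intro l hl
    have := DD_D (pP k (Ee C (n := n+1)) (XN C (n+1))).toSubring
      (fun l hl p hp => pP_hc H _ (by omega) p hp) (fun l hl => pP_hsq H _ (by omega))
      (fun l hl => ?_) hfar hP hT' (Nat.zero_le _) (n-1-l) (Nat.zero_le _) (by omega)
    · rwa [show n - 1 - (n - 1 - l) = l by omega] at this
    · obtain ⟨p, hp, e⟩ := pP_hbr H (n - 1 - (l+1)) (by omega)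
      refine ⟨-p, neg_mem hp, ?_⟩
      rw [show n - 1 - l = n - 1 - (l+1) + 1 by omega, e]
      abel
end
end KLR

set_option linter.unusedSectionVars false
set_option linter.unusedSimpArgs false
namespace KLR
variable {k : Type} [Field k] {I : Type} [Fintype I] [DecidableEq I]

section
variable {C : CartanDatum k I} {n : ℕ} {L : Type} [Ring L] [Algebra k L]
    {E : (Fin n → I) → L} {X T : ℕ → L} {t : L} {Y : ℕ → L}

lemma commute_unit_inv {L : Type} [Ring L] {a z : L} (ha : IsUnit a) (h : Commute a z) :
    Commute (↑ha.unit⁻¹ : L) z := by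
  have : Commute (ha.unit : L) z := h
  exact this.units_inv_left

lemma IsKLR.sS_unit (H : IsKLR C n E X T) (c : (Fin n → I) → L) (hu : ∀ ν, IsUnit (c ν))
    (hc : ∀ μ ν, Commute (c μ) (E ν)) : IsUnit (sS E c) := by
  refine isUnit_iff_exists.2 ⟨sS E (fun ν => ↑(hu ν).unit⁻¹), ?_, ?_⟩
  · rw [H.sS_mul _ _ fun μ ν => commute_unit_inv (hu μ) (hc μ ν)]
    simp [H.sS_one]
  · rw [H.sS_mul _ _ hc]
    simp [H.sS_one]

lemma Loc.Y_unit (H : Loc C n E X T t Y) {a : ℕ} (h : a < n) : IsUnit (Y a) :=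
  isUnit_iff_exists.2 ⟨_, H.Y1 a h, H.Y2 a h⟩

lemma Loc.unit1 (H : Loc C n E X T t Y) (i : I) {l : ℕ} (h : l < n) :
    IsUnit (al E Y i l + de E i l) := by
  rw [al, de, dif_pos h, dif_pos h, sS_add]
  refine H.sS_unit _ (fun ν => ?_) (fun μ ν => ?_)
  · split_ifs
    · simpa using H.Y_unit h
    · simp
  · split_ifs
    · simpa using H.YE h ν
    · simp

lemma Loc.unitQ (H : Loc C n E X T t Y) (ht : IsUnit t) (hX : ∀ a, a < n → IsNilpotent (X a))
    {i j : I} (hij : i ≠ j) {l : ℕ} (h : l < n) : IsUnit (Qel C i j t (X l)) := by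
  obtain ⟨c, m, s, hc, h1, h2, e⟩ := Qel_lead C i j hij t (X l) (H.tX l h)
  rw [e]
  have hu : IsUnit (c • t ^ m) := by
    rw [Algebra.smul_def]
    exact ((isUnit_iff_ne_zero.2 hc).map (algebraMap k L)).mul (ht.pow m)
  have hn : IsNilpotent (X l * s) := h2.isNilpotent_mul_right (hX l h)
  have hcm : Commute (c • t ^ m) (X l * s) := 
    (((H.tX l h).mul_right h1).pow_left m).smul_left c
  exact hn.isUnit_add_left_of_commute hu hcm.symm

lemma Loc.unit2 (H : Loc C n E X T t Y) (ht : IsUnit t) (hX : ∀ a, a < n → IsNilpotent (X a))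
    (i : I) {l : ℕ} (h : l < n) : IsUnit (qq C E X t i l - al E Y i l) := by
  rw [al, qq, dif_pos h, dif_pos h, sS_sub]
  refine H.sS_unit _ (fun ν => ?_) (fun μ ν => ?_)
  · split_ifs with h1
    · rw [h1]; simpa using (H.Y_unit h).neg
    · simpa using H.unitQ ht hX (Ne.symm h1) h
  · refine Commute.sub_left ?_ ?_
    · exact (Qel_commute C _ _ _ _ _ (H.tE ν).symm (H.xe l ν h).symm).symm
    · split_ifs
      · exact H.YE h ν
      · simp

/-- `v_c` -/
noncomputable def vv (H : Loc C n E X T t Y) (i : I) (c : Fin (n+1)) : Fin (n+1) → L :=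
  (H.isKLR i).hom (wT (TN C (n+1)) n c) (Pi.single (Fin.last n) 1)

/-- `w_d` -/
noncomputable def ww (H : Loc C n E X T t Y) (i : I) (g : L) (c : Fin (n+1)) : Fin (n+1) → L :=
  (H.isKLR i).hom (wT (fun l => TN C (n+1) (n-1-l)) n (n - c)) (Pi.single 0 g)

lemma vv_tri (H : Loc C n E X T t Y) (i : I) {c : ℕ} (hc : c ≤ n) :
    (∀ p, p < c → fx (vv H i ⟨c, by omega⟩) p = 0) ∧ IsUnit (fx (vv H i ⟨c, by omega⟩) c) := by
  induction hc using Nat.decreasingInduction with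
  | self =>
    simp only [vv, wT_top, map_one, Module.End.one_apply]
    constructor
    · intro p hp
      rw [fx, dif_pos (by omega : p < n + 1), Pi.single_eq_of_ne]
      simp [Fin.ext_iff]; omega
    · rw [fx, dif_pos (by omega)]
      have : (⟨n, by omega⟩ : Fin (n+1)) = Fin.last n := rfl
      simp [this]
  | of_succ c hc ih =>
    have e : vv H i ⟨c, by omega⟩ = TO C E X T t Y i c (vv H i ⟨c+1, by omega⟩) := by
      simp only [vv]
      rw [wT_step _ _ hc, map_mul, (H.isKLR i).hom_T C c (by omega)]
      rfl
    rw [e]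
    obtain ⟨h1, h2⟩ := ih
    constructor
    · intro p hp
      rw [fx_Tlt i _ (by omega) hp, h1 p (by omega), mul_zero]
    · rw [fx_T0 i _ hc, h1 c (by omega), mul_zero, sub_zero]
      exact (H.unit1 i hc).mul h2

lemma ww_tri (H : Loc C n E X T t Y) (ht : IsUnit t) (hX : ∀ a, a < n → IsNilpotent (X a))
    (i : I) (g : L) (hg : IsUnit g) {c : ℕ} (hc : c ≤ n) :
    (∀ p, c < p → fx (ww H i g ⟨c, by omega⟩) p = 0) ∧
      IsUnit (fx (ww H i g ⟨c, by omega⟩) c) := by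
  induction c with
  | zero =>
    simp only [ww, Nat.sub_zero, wT_top, map_one, Module.End.one_apply]
    constructor
    · intro p hp
      rw [fx]
      split_ifs with hp'
      · rw [Pi.single_eq_of_ne]
        simp [Fin.ext_iff]; omega
      · rfl
    · rw [fx, dif_pos (by omega)]
      simpa using hg
  | succ c ih =>
    have e : ww H i g ⟨c+1, by omega⟩ = TO C E X T t Y i c (ww H i g ⟨c, by omega⟩) := by
      simp only [ww]
      rw [wT_step _ _ (show n - (c+1) < n by omega), map_mul, show n - (c+1) + 1 = n - c by omega,
        show n - 1 - (n - (c+1)) = c by omega, (H.isKLR i).hom_T C c (by omega)]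
      rfl
    rw [e]
    obtain ⟨h1, h2⟩ := ih (by omega)
    constructor
    · intro p hp
      by_cases hp' : p < n + 1
      · rw [fx_Tgt i _ hp' hp, h1 p (by omega), mul_zero]
      · rw [fx, dif_neg hp']
    · rw [fx_T1 i _ (by omega), h1 (c+1) (by omega), mul_zero, zero_add]
      exact (H.unit2 ht hX i (by omega)).mul h2

lemma fx_coe {n : ℕ} {L : Type} [Zero L] (f : Fin (n+1) → L) (p : Fin (n+1)) : fx f p = f p := by
  rw [fx, dif_pos p.2]

lemma vv_bij (H : Loc C n E X T t Y) (i : I) : Function.Bijective (vecMap (vv H i)) := by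
  refine vecMap_bij _ (fun p => p.1) (fun c p h1 h2 => ?_) fun c => ?_
  · rw [← fx_coe (vv H i c) p]
    refine (vv_tri H i (by omega : c.1 ≤ n)).1 p ?_
    have : p.1 ≠ c.1 := fun h => h1 (Fin.ext h)
    omega
  · rw [← fx_coe (vv H i c) c]
    exact (vv_tri H i (by omega : c.1 ≤ n)).2

lemma ww_bij (H : Loc C n E X T t Y) (ht : IsUnit t) (hX : ∀ a, a < n → IsNilpotent (X a))
    (i : I) (g : L) (hg : IsUnit g) : Function.Bijective (vecMap (ww H i g)) := by
  refine vecMap_bij _ (fun p => n - p.1) (fun c p h1 h2 => ?_) fun c => ?_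
  · rw [← fx_coe (ww H i g c) p]
    refine (ww_tri H ht hX i g hg (by omega : c.1 ≤ n)).1 p ?_
    have : p.1 ≠ c.1 := fun h => h1 (Fin.ext h)
    omega
  · rw [← fx_coe (ww H i g c) c]
    exact (ww_tri H ht hX i g hg (by omega : c.1 ≤ n)).2

end

section
variable {C : CartanDatum k I} {n : ℕ} {A : Type} [Ring A] [Algebra k A]
    {e : (Fin n → I) → A} {x τ : ℕ → A}

variable (k A) in
/-- constants -/
noncomputable def cL : A →ₐ[k] LaurentPolynomial A :=
  { LaurentPolynomial.C with commutes' := fun _ => rfl }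

lemma T1_comm (y : LaurentPolynomial A) : Commute (LaurentPolynomial.T 1) y := 
  LaurentPolynomial.commute_T 1 y

lemma xL_nil {a : A} (h : IsNilpotent a) : IsNilpotent (cL k A a) :=
  h.map (cL k A)

lemma T1_unit : IsUnit (LaurentPolynomial.T 1 : LaurentPolynomial A) :=
  LaurentPolynomial.isUnit_T 1

variable (k) in
lemma yL_exists (a : A) : ∃ y : LaurentPolynomial A, IsNilpotent a →
    y * (LaurentPolynomial.T 1 - cL k A a) = 1 ∧
    (LaurentPolynomial.T 1 - cL k A a) * y = 1 := by
  by_cases h : IsNilpotent a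
  · have : IsUnit (LaurentPolynomial.T 1 - cL k A a) := by
      rw [sub_eq_add_neg]
      exact (xL_nil h).neg.isUnit_add_left_of_commute T1_unit (T1_comm _).symm
    obtain ⟨y, h1, h2⟩ := isUnit_iff_exists.1 this
    exact ⟨y, fun _ => ⟨h2, h1⟩⟩
  · exact ⟨0, fun h' => absurd h' h⟩

variable (k) in
/-- inverse of `t - x` -/
noncomputable def yL (a : A) : LaurentPolynomial A := (yL_exists k a).choose

lemma loc (H : IsKLR C n e x τ) (hx : ∀ a, a < n → IsNilpotent (x a)) :
    Loc C n (fun ν => cL k A (e ν)) (fun a => cL k A (x a)) (fun a => cL k A (τ a))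
      (LaurentPolynomial.T 1) (fun a => yL k (x a)) where
  toIsKLR := H.map (cL k A)
  tE ν := T1_comm _
  tX a _ := T1_comm _
  tT l _ := T1_comm _
  Y1 a h := ((yL_exists k (x a)).choose_spec (hx a h)).1
  Y2 a h := ((yL_exists k (x a)).choose_spec (hx a h)).2

end
end KLR

set_option linter.unusedSectionVars false
set_option linter.unusedSimpArgs false
namespace KLR
variable {k : Type} [Field k] {I : Type} [Fintype I] [DecidableEq I]

section
variable {A : Type} [Ring A]
open MulOpposite Polynomial

lemma laurent_ind {M : LaurentPolynomial A → Prop} (h0 : M 0)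
    (ha : ∀ p q, M p → M q → M (p + q)) 
    (hm : ∀ (j : ℤ) (a : A), M (LaurentPolynomial.C a * LaurentPolynomial.T j)) (p) : M p := by
  induction p using LaurentPolynomial.induction_on' with
  | add p q h1 h2 => exact ha _ _ h1 h2
  | C_mul_T j a => exact hm j a

lemma op_smul_laurent (a : A) (f : LaurentPolynomial A) :
    op a • f = f * LaurentPolynomial.C a := by
  induction f using laurent_ind with
  | h0 => simp
  | ha p q h1 h2 => rw [smul_add, h1, h2, add_mul]
  | hm j b =>
    rw [mul_assoc, LaurentPolynomial.T_mul, ← mul_assoc, ← map_mul,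
      ← LaurentPolynomial.single_eq_C_mul_T, ← LaurentPolynomial.single_eq_C_mul_T,
      AddMonoidAlgebra.smul_single]
    rfl

lemma trunc_mul_C (a : A) (f : LaurentPolynomial A) :
    LaurentPolynomial.trunc (f * LaurentPolynomial.C a) = LaurentPolynomial.trunc f * C a := by
  induction f using laurent_ind with
  | h0 => simp
  | ha p q h1 h2 => rw [add_mul, map_add, map_add, h1, h2, add_mul]
  | hm j b =>
    rw [mul_assoc, LaurentPolynomial.T_mul, ← mul_assoc, ← map_mul,
      LaurentPolynomial.trunc_C_mul_T, LaurentPolynomial.trunc_C_mul_T]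
    split_ifs
    · rw [monomial_mul_C]
    · simp

/-- `A` is free over `Aᵐᵒᵖ`. -/
lemma free_op : Module.Free Aᵐᵒᵖ A :=
  Module.Free.of_equiv
    ({ toFun := unop, invFun := op, map_add' := fun _ _ => rfl, map_smul' := fun _ _ => rfl,
       left_inv := fun _ => rfl, right_inv := fun _ => rfl } : Aᵐᵒᵖ ≃ₗ[Aᵐᵒᵖ] A)

lemma proj_N (m : ℕ) : Module.Projective Aᵐᵒᵖ (Fin m → LaurentPolynomial A) := by
  have := free_op (A := A)
  have : Module.Free Aᵐᵒᵖ (LaurentPolynomial A) :=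
    Module.Free.of_equiv (AddMonoidAlgebra.coeffLinearEquiv Aᵐᵒᵖ (S := A) (M := ℤ)).symm
  infer_instance

variable {B : Type} [Ring B] [Algebra k A] [Algebra k B] (φ : A →ₙₐ[k] B) (z : B)

/-- evaluation `Σ a_j X^j ↦ Σ φ(a_j) z^j` -/
noncomputable def evP (p : A[X]) : B := p.sum fun j a => φ a * z ^ j

lemma evP_add (p q : A[X]) : evP φ z (p + q) = evP φ z p + evP φ z q :=
  Polynomial.sum_add_index _ _ _ (by simp) (by intros; rw [map_add, add_mul])
lemma evP_zero : evP φ z 0 = 0 := by simp [evP]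
lemma evP_monomial (j : ℕ) (a : A) : evP φ z (monomial j a) = φ a * z ^ j :=
  Polynomial.sum_monomial_index _ _ (by simp)
lemma evP_C_mul (a : A) (p : A[X]) : evP φ z (C a * p) = φ a * evP φ z p := by
  induction p using Polynomial.induction_on' with
  | add p q h1 h2 => rw [mul_add, evP_add, h1, h2, evP_add, mul_add]
  | monomial j b => rw [C_mul_monomial, evP_monomial, evP_monomial, map_mul, mul_assoc]
lemma evP_mul_C (hz : ∀ a, Commute z (φ a)) (a : A) (p : A[X]) :
    evP φ z (p * C a) = evP φ z p * φ a := by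
  induction p using Polynomial.induction_on' with
  | add p q h1 h2 => rw [add_mul, evP_add, h1, h2, evP_add, add_mul]
  | monomial j b =>
    rw [monomial_mul_C, evP_monomial, evP_monomial, map_mul, mul_assoc, mul_assoc,
      ((hz a).pow_left j).eq]
lemma evP_X_mul (hz : ∀ a, Commute z (φ a)) (p : A[X]) :
    evP φ z (X * p) = z * evP φ z p := by
  induction p using Polynomial.induction_on' with
  | add p q h1 h2 => rw [mul_add, evP_add, h1, h2, evP_add, mul_add]
  | monomial j b =>
    rw [X_mul_monomial, evP_monomial, evP_monomial, ← mul_assoc, (hz b).eq, pow_succ', mul_assoc]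
lemma evP_C (a : A) : evP φ z (C a) = φ a := by
  have := evP_monomial φ z 0 a
  simpa using this
lemma evP_one_mul (p : A[X]) : φ 1 * evP φ z p = evP φ z p := by
  rw [← evP_C_mul, map_one, one_mul]
lemma evP_mul_one (hz : ∀ a, Commute z (φ a)) (p : A[X]) : evP φ z p * φ 1 = evP φ z p := by
  rw [← evP_mul_C φ z hz, map_one, mul_one]
lemma evP_sum {ι : Type} (s : Finset ι) (f : ι → A[X]) :
    evP φ z (∑ c ∈ s, f c) = ∑ c ∈ s, evP φ z (f c) := by
  classical
  induction s using Finset.induction_on with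
  | empty => simp [evP_zero]
  | insert a s h ih => rw [Finset.sum_insert h, Finset.sum_insert h, evP_add, ih]
end

section content
variable {n : ℕ}
lemma content_succAbove (μ : Fin (n+1) → I) (p : Fin (n+1)) :
    content μ = addA (content (rm μ p)) (μ p) := by
  funext j
  rw [rm_eq_removeNth]
  simp only [content, addA, Finset.card_filter]
  rw [Fin.sum_univ_succAbove _ p, add_comm]
  congr 1
  simp [eq_comm]

lemma addA_inj {β γ : I → ℕ} {i : I} (h : addA β i = addA γ i) : β = γ := by
  funext j
  have := congrFun h j
  simpa [addA] using this

lemma rm_snoc (ν : Fin n → I) (i : I) : rm (Fin.snoc ν i : Fin (n+1) → I) n = ν := by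
  have := rm_eq_removeNth (Fin.snoc ν i : Fin (n+1) → I) (Fin.last n)
  rw [Fin.val_last] at this
  rw [this]
  funext j
  simp [Fin.removeNth]

lemma snoc_rm (μ : Fin (n+1) → I) : (Fin.snoc (rm μ n) (μ (Fin.last n)) : Fin (n+1) → I) = μ := by
  refine rm_inj (p := n) (by omega) ?_ (rm_snoc _ _)
  exact Fin.snoc_last (α := fun _ => I) _ _
end content
end KLR

set_option linter.unusedSectionVars false
set_option linter.unusedSimpArgs false
set_option linter.unusedVariables false
namespace KLR
variable {k : Type} [Field k] {I : Type} [Fintype I] [DecidableEq I]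

/-- `a^Λ` without restriction on the weight -/
noncomputable def aF (C : CartanDatum k I) (Λ : I → ℕ) (n : ℕ) : Alg C (n+1) :=
  ∑ μ, XN C (n+1) 0 ^ Λ (μ 0) * Ee C μ

/-- abstract data for the main argument -/
structure Setup (C : CartanDatum k I) (Λ β : I → ℕ) (i : I) (n : ℕ) {A B : Type} [Ring A]
    [Algebra k A] [Ring B] [Algebra k B] (e : (Fin n → I) → A) (x τ : ℕ → A)
    (π : Alg C (n+1) →ₐ[k] B) (φ : A →ₙₐ[k] B) : Prop where
  HA : IsKLR C n e x τ
  nil : ∀ a, a < n → IsNilpotent (x a)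
  cyc : ∀ (h : 0 < n) ν, x 0 ^ Λ (ν ⟨0, h⟩) * e ν = 0
  surj : Function.Surjective HA.hom
  ez : ∀ ν, content ν ≠ β → e ν = 0
  phe : ∀ ν, φ (e ν) = π (Ee C (Fin.snoc ν i))
  phx : ∀ a, a < n → φ (x a) = π (XN C (n+1) a) * φ 1
  pht : ∀ a, a + 1 < n → φ (τ a) = π (TN C (n+1) a) * φ 1
  psurj : Function.Surjective π
  pa : π (aF C Λ n) = 0
  pz : ∀ μ, content μ ≠ addA β i → π (Ee C μ) = 0
  pker : ∀ S : AddSubgroup (Alg C (n+1)), (∀ a s, s ∈ S → a * s ∈ S) → (∀ a s, s ∈ S → s * a ∈ S) →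
    aF C Λ n ∈ S → (∀ μ, content μ ≠ addA β i → Ee C μ ∈ S) → ∀ r, π r = 0 → r ∈ S

namespace Setup
variable {C : CartanDatum k I} {Λ β : I → ℕ} {i : I} {n : ℕ} {A B : Type} [Ring A]
    [Algebra k A] [Ring B] [Algebra k B] {e : (Fin n → I) → A} {x τ : ℕ → A}
    {π : Alg C (n+1) →ₐ[k] B} {φ : A →ₙₐ[k] B} (H : Setup C Λ β i n e x τ π φ)

include H

lemma loc : Loc C n (fun ν => cL k A (e ν)) (fun a => cL k A (x a)) (fun a => cL k A (τ a))
      (LaurentPolynomial.T 1) (fun a => yL k (x a)) := KLR.loc H.HA H.nil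

/-- the representation -/
noncomputable def rho : Alg C (n+1) →ₐ[k]
    Module.End (LaurentPolynomial A)ᵐᵒᵖ (Fin (n+1) → LaurentPolynomial A) := (H.loc.isKLR i).hom

/-- `φ(1)` lifted -/
lemma phi1 : φ 1 = ∑ ν, π (Ee C (Fin.snoc ν i)) := by
  rw [← H.HA.esum, map_sum]
  exact Finset.sum_congr rfl fun ν _ => H.phe ν

lemma E_phi1 (μ : Fin (n+1) → I) : π (Ee C μ) * φ 1 =
    if μ (Fin.last n) = i then π (Ee C μ) else 0 := by
  rw [H.phi1, Finset.mul_sum]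
  simp only [← map_mul, (alg_isKLR C (n+1)).ee]
  split_ifs with h
  · rw [Finset.sum_eq_single (rm μ n)]
    · rw [if_pos]
      rw [← h, snoc_rm]
    · intro ν _ hν
      rw [if_neg, map_zero]
      rintro rfl
      exact hν (rm_snoc _ _).symm
    · simp
  · refine Finset.sum_eq_zero fun ν _ => ?_
    rw [if_neg, map_zero]
    rintro rfl
    exact h (Fin.snoc_last (α := fun _ => I) _ _)

lemma z_comm (a : A) : Commute (π (XN C (n+1) n)) (φ a) := by
  have K := alg_isKLR C (n+1)
  have h1 : Commute (π (XN C (n+1) n)) (φ 1) := by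
    rw [H.phi1]
    refine Commute.sum_right _ _ _ fun ν _ => ?_
    show _ * _ = _ * _
    rw [← map_mul, ← map_mul, K.xe _ _ (by omega)]
  obtain ⟨r, rfl⟩ := H.surj a
  induction r using alg_induction with
  | hc c =>
    rw [AlgHom.commutes, Algebra.algebraMap_eq_smul_one, map_smul]
    exact h1.smul_right c
  | hE ν =>
    rw [H.HA.hom_E, H.phe]
    show _ * _ = _ * _
    rw [← map_mul, ← map_mul, K.xe _ _ (by omega)]
  | hX a ha =>
    rw [H.HA.hom_X _ _ ha, H.phx a ha]
    refine Commute.mul_right ?_ h1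
    show _ * _ = _ * _
    rw [← map_mul, ← map_mul, K.xx _ _ (by omega) (by omega)]
  | hT a ha =>
    rw [H.HA.hom_T _ _ ha, H.pht a ha]
    refine Commute.mul_right ?_ h1
    show _ * _ = _ * _
    rw [← map_mul, ← map_mul, K.tx _ _ (by omega) (by omega) (by omega) (by omega)]
  | ha r s h1 h2 => rw [map_add, map_add]; exact h1.add_right h2
  | hm r s h1 h2 => rw [map_mul, map_mul]; exact h1.mul_right h2


omit H in
lemma fx_last {L : Type} [Zero L] (y : L) (p : ℕ) :
    fx (Pi.single (Fin.last n) y : Fin (n+1) → L) p = if p = n then y else 0 := by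
  unfold fx
  split_ifs with h1 h2 h2
  · subst h2; exact Pi.single_eq_same (M := fun _ : Fin (p+1) => L) _ _
  · rw [Pi.single_eq_of_ne]
    intro h; exact h2 (congrArg Fin.val h)
  · omega
  · rfl

lemma rho_E (μ : Fin (n+1) → I) (y : LaurentPolynomial A) :
    H.rho (Ee C μ) (Pi.single (Fin.last n) y) = Pi.single (Fin.last n)
      (if μ (Fin.last n) = i then LaurentPolynomial.C (e (rm μ n)) * y else 0) := by
  rw [rho, (H.loc.isKLR i).hom_E]
  refine fx_ext fun p hp => ?_
  rw [fx_E i _ μ hp, fx_last, fx_last]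
  by_cases h : p = n
  · subst h
    rw [if_pos rfl, if_pos rfl]
    by_cases hm : μ (Fin.last p) = i
    · rw [Ec_pos i hp hm, if_pos hm]; rfl
    · rw [Ec_neg i hp hm, if_neg hm, zero_mul]
  · rw [if_neg h, if_neg h, mul_zero]

lemma rho_X (a : ℕ) (ha : a < n) (y : LaurentPolynomial A) :
    H.rho (XN C (n+1) a) (Pi.single (Fin.last n) y) = Pi.single (Fin.last n)
      (LaurentPolynomial.C (x a) * y) := by
  rw [rho, (H.loc.isKLR i).hom_X _ _ (by omega)]
  refine fx_ext fun p hp => ?_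
  rw [fx_X _ _ hp, fx_last, fx_last]
  by_cases h : p = n
  · subst h
    rw [if_pos rfl, if_pos rfl, Xc_lt ha]; rfl
  · rw [if_neg h, if_neg h, mul_zero]

lemma rho_Xn (y : LaurentPolynomial A) :
    H.rho (XN C (n+1) n) (Pi.single (Fin.last n) y) = Pi.single (Fin.last n)
      (LaurentPolynomial.T 1 * y) := by
  rw [rho, (H.loc.isKLR i).hom_X _ _ (by omega)]
  refine fx_ext fun p hp => ?_
  rw [fx_X _ _ hp, fx_last, fx_last]
  by_cases h : p = n
  · subst h
    rw [if_pos rfl, if_pos rfl, Xc_eq]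
  · rw [if_neg h, if_neg h, mul_zero]

lemma rho_T (a : ℕ) (ha : a + 1 < n) (y : LaurentPolynomial A) :
    H.rho (TN C (n+1) a) (Pi.single (Fin.last n) y) = Pi.single (Fin.last n)
      (LaurentPolynomial.C (τ a) * y) := by
  rw [rho, (H.loc.isKLR i).hom_T _ _ (by omega)]
  refine fx_ext fun p hp => ?_
  by_cases h : p = n
  · subst h
    rw [fx_Tgt _ _ hp ha, fx_last, fx_last, if_pos rfl, if_pos rfl]; rfl
  · have h0 : ∀ q, q ≠ n → fx (Pi.single (Fin.last n) y : Fin (n+1) → LaurentPolynomial A) q = 0 :=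
      fun q hq => by rw [fx_last, if_neg hq]
    rw [fx_last, if_neg h]
    rcases lt_trichotomy p a with h1 | h1 | h1
    · rw [fx_Tlt _ _ hp h1, h0 _ h, mul_zero]
    · subst h1
      rw [fx_T0 _ _ (by omega), h0 _ h, h0 _ (by omega), mul_zero, mul_zero, sub_zero]
    · by_cases h2 : p = a + 1
      · subst h2
        rw [fx_T1 _ _ (by omega), h0 _ h, h0 _ (by omega), mul_zero, mul_zero, zero_add]
      · rw [fx_Tgt _ _ hp (by omega), h0 _ h, mul_zero]

end Setup
end KLR

set_option linter.unusedSectionVars false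
set_option linter.unusedSimpArgs false
set_option linter.unusedVariables false
namespace KLR
variable {k : Type} [Field k] {I : Type} [Fintype I] [DecidableEq I]
namespace Setup
variable {C : CartanDatum k I} {Λ β : I → ℕ} {i : I} {n : ℕ} {A B : Type} [Ring A]
    [Algebra k A] [Ring B] [Algebra k B] {e : (Fin n → I) → A} {x τ : ℕ → A}
    {π : Alg C (n+1) →ₐ[k] B} {φ : A →ₙₐ[k] B} (H : Setup C Λ β i n e x τ π φ)

include H
open Polynomial

lemma rho_op (r : Alg C (n+1)) (q : Fin (n+1)) (f y : LaurentPolynomial A) :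
    H.rho r (Pi.single q (f * y)) = fun p => H.rho r (Pi.single q f) p * y := by
  have h : (Pi.single q (f * y) : Fin (n+1) → LaurentPolynomial A) =
      MulOpposite.op y • Pi.single q f := by
    funext p
    by_cases hp : p = q
    · subst hp; simp
    · simp [Pi.single_eq_of_ne hp]
  rw [h, map_smul]
  rfl

/-- elements acting polynomially on the last coordinate -/
def D1 : AddSubgroup (Alg C (n+1)) where
  carrier := {r | ∃ y : A[X], H.rho r (Pi.single (Fin.last n) 1) =
    Pi.single (Fin.last n) (toLaurent y) ∧ π r * φ 1 = evP φ (π (XN C (n+1) n)) y}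
  zero_mem' := ⟨0, by simp, by simp [evP_zero]⟩
  add_mem' := by
    rintro a b ⟨y, h1, h2⟩ ⟨z, h3, h4⟩
    refine ⟨y + z, ?_, ?_⟩
    · rw [map_add, map_add, LinearMap.add_apply, h1, h3, Pi.single_add]
    · rw [map_add, add_mul, evP_add, h2, h4]
  neg_mem' := by
    rintro a ⟨y, h1, h2⟩
    refine ⟨-y, ?_, ?_⟩
    · rw [map_neg, map_neg, LinearMap.neg_apply, h1, Pi.single_neg]
    · rw [map_neg, neg_mul, h2, neg_eq_iff_add_eq_zero, ← evP_add, add_neg_cancel, evP_zero]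

lemma E_ev (μ : Fin (n+1) → I) (y : A[X]) : π (Ee C μ) * evP φ (π (XN C (n+1) n)) y =
    evP φ (π (XN C (n+1) n)) (if μ (Fin.last n) = i then Polynomial.C (e (rm μ n)) * y else 0) := by
  rw [← evP_one_mul, ← mul_assoc, H.E_phi1]
  split_ifs with h
  · rw [evP_C_mul, H.phe, ← h, snoc_rm]
  · rw [evP_zero, zero_mul]

lemma X_ev (a : ℕ) (ha : a < n) (y : A[X]) : π (XN C (n+1) a) * evP φ (π (XN C (n+1) n)) y =
    evP φ (π (XN C (n+1) n)) (Polynomial.C (x a) * y) := by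
  rw [evP_C_mul, H.phx a ha, mul_assoc, evP_one_mul]

lemma T_ev (a : ℕ) (ha : a + 1 < n) (y : A[X]) : π (TN C (n+1) a) * evP φ (π (XN C (n+1) n)) y =
    evP φ (π (XN C (n+1) n)) (Polynomial.C (τ a) * y) := by
  rw [evP_C_mul, H.pht a ha, mul_assoc, evP_one_mul]

lemma Xn_ev (y : A[X]) : π (XN C (n+1) n) * evP φ (π (XN C (n+1) n)) y =
    evP φ (π (XN C (n+1) n)) (X * y) := by
  rw [evP_X_mul _ _ H.z_comm]

lemma D1_stab {r s : Alg C (n+1)} (q : A[X] → A[X])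
    (h1 : ∀ y, H.rho r (Pi.single (Fin.last n) (toLaurent y)) =
      Pi.single (Fin.last n) (toLaurent (q y)))
    (h2 : ∀ y, π r * evP φ (π (XN C (n+1) n)) y = evP φ (π (XN C (n+1) n)) (q y))
    (h : s ∈ H.D1) : r * s ∈ H.D1 := by
  obtain ⟨y, h3, h4⟩ := h
  refine ⟨q y, ?_, ?_⟩
  · rw [map_mul, Module.End.mul_apply, h3, h1]
  · rw [map_mul, mul_assoc, h4, h2]

lemma D1_E (μ : Fin (n+1) → I) (y : A[X]) :
    H.rho (Ee C μ) (Pi.single (Fin.last n) (toLaurent y)) =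
      Pi.single (Fin.last n)
        (toLaurent (if μ (Fin.last n) = i then Polynomial.C (e (rm μ n)) * y else 0)) := by
  rw [H.rho_E]
  split_ifs with h
  · rw [map_mul, toLaurent_C]
  · rw [map_zero]

lemma D1_one : (1 : Alg C (n+1)) ∈ H.D1 := by
  refine ⟨1, ?_, ?_⟩
  · rw [map_one, map_one]; rfl
  · rw [map_one, one_mul, ← Polynomial.C_1, evP_C]

lemma dec0 (r : Alg C (n+1)) : r ∈ DD (TN C (n+1)) n H.D1 0 := by
  have := span1 H.D1 ?_ ?_ ?_ ?_ r 1 ?_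
  · rwa [mul_one] at this
  · intro c y hy
    refine H.D1_stab (fun y => Polynomial.C (algebraMap k A c) * y) ?_ ?_ hy
    · intro y
      rw [AlgHom.commutes, Algebra.algebraMap_eq_smul_one, LinearMap.smul_apply,
        Module.End.one_apply, ← Pi.single_smul, map_mul, toLaurent_C, Algebra.smul_def]
      rfl
    · intro y
      rw [AlgHom.commutes, evP_C_mul, Algebra.algebraMap_eq_smul_one,
        Algebra.algebraMap_eq_smul_one, map_smul, smul_mul_assoc, smul_mul_assoc, one_mul,
        evP_one_mul]
  · intro μ y hy
    exact H.D1_stab _ (H.D1_E μ) (H.E_ev μ) hy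
  · intro a ha y hy
    by_cases h : a = n
    · subst h
      refine H.D1_stab (fun y => X * y) (fun y => ?_) H.Xn_ev hy
      rw [H.rho_Xn, map_mul, toLaurent_X]
    · refine H.D1_stab (fun y => Polynomial.C (x a) * y) (fun y => ?_) (H.X_ev a (by omega)) hy
      rw [H.rho_X _ (by omega), map_mul, toLaurent_C]
  · intro a ha y hy
    refine H.D1_stab (fun y => Polynomial.C (τ a) * y) (fun y => ?_) (H.T_ev a (by omega)) hy
    rw [H.rho_T _ (by omega), map_mul, toLaurent_C]
  · rw [← wT_top (TN C (n+1)) n, ← mul_one (wT _ _ _)]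
    exact DD_mem (Nat.zero_le _) le_rfl H.D1_one

lemma dec (r : Alg C (n+1)) : ∃ y : Fin (n+1) → A[X],
    H.rho r (Pi.single (Fin.last n) 1) = vecMap (vv H.loc i) (fun c => toLaurent (y c)) ∧
    π r * φ 1 = ∑ c : Fin (n+1), π (wT (TN C (n+1)) n c) * evP φ (π (XN C (n+1) n)) (y c) := by
  obtain ⟨s, hs, rfl⟩ := DD_explicit (H.dec0 r)
  choose y h1 h2 using hs
  refine ⟨y, ?_, ?_⟩
  · funext p
    rw [vecMap_apply, map_sum, LinearMap.sum_apply, Finset.sum_apply]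
    refine Finset.sum_congr rfl fun c _ => ?_
    rw [map_mul, Module.End.mul_apply, h1, ← one_mul (toLaurent (y c)), H.rho_op, one_mul]
    rfl
  · rw [map_sum, Finset.sum_mul]
    refine Finset.sum_congr rfl fun c _ => ?_
    rw [map_mul, mul_assoc, h2]

end Setup
end KLR

set_option linter.unusedSectionVars false
set_option linter.unusedSimpArgs false
set_option linter.unusedVariables false
namespace KLR
variable {k : Type} [Field k] {I : Type} [Fintype I] [DecidableEq I]
namespace Setup
variable {C : CartanDatum k I} {Λ β : I → ℕ} {i : I} {n : ℕ} {A B : Type} [Ring A]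
    [Algebra k A] [Ring B] [Algebra k B] {e : (Fin n → I) → A} {x τ : ℕ → A}
    {π : Alg C (n+1) →ₐ[k] B} {φ : A →ₙₐ[k] B} (H : Setup C Λ β i n e x τ π φ)

include H
open Polynomial

/-- inverse of `vecMap vv` -/
noncomputable def V : (Fin (n+1) → LaurentPolynomial A) ≃ₗ[(LaurentPolynomial A)ᵐᵒᵖ]
    (Fin (n+1) → LaurentPolynomial A) := LinearEquiv.ofBijective _ (vv_bij H.loc i)

/-- the map `q` -/
noncomputable def q (f : Fin (n+1) → LaurentPolynomial A) : B :=
  ∑ c : Fin (n+1), π (wT (TN C (n+1)) n c) * evP φ (π (XN C (n+1) n))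
    (LaurentPolynomial.trunc (H.V.symm f c))

lemma q_rho (r : Alg C (n+1)) : H.q (H.rho r (Pi.single (Fin.last n) 1)) = π r * φ 1 := by
  obtain ⟨y, h1, h2⟩ := H.dec r
  rw [h1, h2]
  have : H.V.symm (vecMap (vv H.loc i) (fun c => toLaurent (y c))) = fun c => toLaurent (y c) :=
    H.V.symm_apply_apply _
  unfold q
  rw [this]
  simp only [Polynomial.trunc_toLaurent]

lemma q_add (f g) : H.q (f + g) = H.q f + H.q g := by
  unfold q
  rw [← Finset.sum_add_distrib]
  refine Finset.sum_congr rfl fun c _ => ?_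
  rw [map_add, Pi.add_apply, map_add, evP_add, mul_add]

omit H in
lemma smulA (a : A) (f : Fin (n+1) → LaurentPolynomial A) :
    MulOpposite.op a • f = MulOpposite.op (LaurentPolynomial.C a) • f := by
  funext p
  exact op_smul_laurent a (f p)

lemma q_smul (a : A) (f) : H.q (MulOpposite.op a • f) = H.q f * φ a := by
  unfold q
  rw [Finset.sum_mul]
  refine Finset.sum_congr rfl fun c _ => ?_
  rw [smulA, map_smul, Pi.smul_apply, MulOpposite.smul_eq_mul_unop, MulOpposite.unop_op,
    trunc_mul_C, evP_mul_C _ _ H.z_comm, mul_assoc]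

lemma lift_A (a : A) : ∃ r : Alg C (n+1), ∀ y : A[X],
    H.rho r (Pi.single (Fin.last n) (toLaurent y)) =
      Pi.single (Fin.last n) (toLaurent (Polynomial.C a * y)) ∧
    π r * evP φ (π (XN C (n+1) n)) y = evP φ (π (XN C (n+1) n)) (Polynomial.C a * y) := by
  obtain ⟨s, rfl⟩ := H.surj a
  induction s using alg_induction with
  | hc c =>
    refine ⟨algebraMap k _ c, fun y => ⟨?_, ?_⟩⟩
    · rw [AlgHom.commutes, AlgHom.commutes, Algebra.algebraMap_eq_smul_one, LinearMap.smul_apply,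
        Module.End.one_apply, ← Pi.single_smul, map_mul, toLaurent_C, Algebra.smul_def]
      rfl
    · rw [AlgHom.commutes, AlgHom.commutes, evP_C_mul, Algebra.algebraMap_eq_smul_one,
        Algebra.algebraMap_eq_smul_one, map_smul, smul_mul_assoc, smul_mul_assoc, one_mul,
        evP_one_mul]
  | hE ν =>
    refine ⟨Ee C (Fin.snoc ν i), fun y => ⟨?_, ?_⟩⟩
    · rw [H.D1_E, if_pos (Fin.snoc_last (α := fun _ => I) _ _), rm_snoc, H.HA.hom_E]
    · rw [H.E_ev, if_pos (Fin.snoc_last (α := fun _ => I) _ _), rm_snoc, H.HA.hom_E]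
  | hX a ha =>
    refine ⟨XN C (n+1) a, fun y => ⟨?_, ?_⟩⟩
    · rw [H.rho_X _ ha, map_mul, toLaurent_C, H.HA.hom_X _ _ ha]
    · rw [H.X_ev _ ha, H.HA.hom_X _ _ ha]
  | hT a ha =>
    refine ⟨TN C (n+1) a, fun y => ⟨?_, ?_⟩⟩
    · rw [H.rho_T _ ha, map_mul, toLaurent_C, H.HA.hom_T _ _ ha]
    · rw [H.T_ev _ ha, H.HA.hom_T _ _ ha]
  | ha r s h1 h2 =>
    obtain ⟨r', h1⟩ := h1
    obtain ⟨s', h2⟩ := h2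
    refine ⟨r' + s', fun y => ⟨?_, ?_⟩⟩
    · rw [map_add, LinearMap.add_apply, (h1 y).1, (h2 y).1, map_add, map_add, add_mul,
        map_add, Pi.single_add]
    · rw [map_add, add_mul, (h1 y).2, (h2 y).2, map_add, map_add, add_mul, evP_add]
  | hm r s h1 h2 =>
    obtain ⟨r', h1⟩ := h1
    obtain ⟨s', h2⟩ := h2
    refine ⟨r' * s', fun y => ⟨?_, ?_⟩⟩
    · rw [map_mul, Module.End.mul_apply, (h2 y).1, (h1 _).1, ← mul_assoc, ← Polynomial.C_mul, ← map_mul H.HA.hom]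
    · rw [map_mul, mul_assoc, (h2 y).2, (h1 _).2, ← mul_assoc, ← Polynomial.C_mul, ← map_mul H.HA.hom]

lemma lift_y (y : A[X]) : ∃ r : Alg C (n+1), ∀ y' : A[X],
    H.rho r (Pi.single (Fin.last n) (toLaurent y')) =
      Pi.single (Fin.last n) (toLaurent (y * y')) := by
  induction y using Polynomial.induction_on with
  | C a => 
    obtain ⟨r, h⟩ := H.lift_A a
    exact ⟨r, fun y => (h y).1⟩
  | add p q h1 h2 =>
    obtain ⟨r', h1⟩ := h1
    obtain ⟨s', h2⟩ := h2
    refine ⟨r' + s', fun y => ?_⟩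
    rw [map_add, LinearMap.add_apply, h1, h2, add_mul, map_add, Pi.single_add]
  | monomial j a h =>
    obtain ⟨r, h⟩ := h
    refine ⟨r * XN C (n+1) n, fun y => ?_⟩
    rw [map_mul, Module.End.mul_apply, H.rho_Xn, ← toLaurent_X, ← map_mul, h, pow_succ]
    simp only [mul_assoc]

omit H in
lemma fx_sum {ι L : Type} [AddCommMonoid L] (s : Finset ι) (f : ι → Fin (n+1) → L) (p : ℕ) :
    fx (∑ c ∈ s, f c) p = ∑ c ∈ s, fx (f c) p := by
  unfold fx
  split_ifs
  · rw [Finset.sum_apply]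
  · simp

omit H in
lemma fx_Xpow {L : Type} [Ring L] [Algebra k L] (X : ℕ → L) (t : L) (a m : ℕ)
    (f : Fin (n+1) → L) {p : ℕ} (hp : p < n + 1) :
    fx ((XO k n X t a ^ m) f) p = Xc X t a p ^ m * fx f p := by
  induction m with
  | zero => simp
  | succ m ih => rw [pow_succ', Module.End.mul_apply, fx_X _ _ hp, ih, pow_succ', mul_assoc]

lemma rho_aF (f) : H.rho (aF C Λ n) f = Pi.single 0 (LaurentPolynomial.T 1 ^ Λ i * f 0) := by
  rw [rho, aF, map_sum, LinearMap.sum_apply]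
  refine fx_ext fun p hp => ?_
  rw [fx_sum]
  have h1 : ∀ μ : Fin (n+1) → I, fx ((H.loc.isKLR i).hom (XN C (n+1) 0 ^ Λ (μ 0) * Ee C μ) f) p =
      Xc (fun a => cL k A (x a)) (LaurentPolynomial.T 1) 0 p ^ Λ (μ 0) *
        (Ec (fun ν => cL k A (e ν)) i μ p * fx f p) := by
    intro μ
    rw [map_mul, map_pow, (H.loc.isKLR i).hom_E, (H.loc.isKLR i).hom_X _ _ (by omega),
      Module.End.mul_apply, fx_Xpow _ _ _ _ _ hp, fx_E _ _ _ hp]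
  simp only [h1]
  by_cases h0 : p = 0
  · subst h0
    have h2 : ∀ μ : Fin (n+1) → I, Xc (fun a => cL k A (x a)) (LaurentPolynomial.T 1) 0 0 ^ Λ (μ 0) *
        (Ec (fun ν => cL k A (e ν)) i μ 0 * fx f 0) = LaurentPolynomial.T 1 ^ Λ i *
        (Ec (fun ν => cL k A (e ν)) i μ 0 * fx f 0) := by
      intro μ
      by_cases hm : μ 0 = i
      · rw [Xc_eq, hm]
      · rw [Ec_neg i (Nat.succ_pos n : 0 < n + 1) hm]; simp
    have h3 := congrArg (fun F : Module.End _ _ => fx (F f) 0) (H.loc.isKLR i).esum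
    simp only [LinearMap.sum_apply, fx_sum, fx_E i _ _ (Nat.succ_pos n), Module.End.one_apply] at h3
    rw [Finset.sum_congr rfl fun μ _ => h2 μ, ← Finset.mul_sum, h3]
    simp [fx]
  · have : fx (Pi.single 0 (LaurentPolynomial.T 1 ^ Λ i * f 0) : Fin (n+1) → LaurentPolynomial A) p
        = 0 := by
      rw [fx, dif_pos hp, Pi.single_eq_of_ne]
      intro h; exact h0 (congrArg Fin.val h)
    rw [this]
    refine Finset.sum_eq_zero fun μ _ => ?_
    by_cases hm : μ ⟨p, hp⟩ = i
    · rw [Xc_lt (by omega), Ec_pos i hp hm, ← mul_assoc, ← map_pow, ← map_mul]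
      have := H.cyc (by omega) (rm μ p)
      rw [rm_lt _ _ (by omega : 0 < p)] at this
      rw [show x 0 ^ Λ (μ 0) * e (rm μ p) = 0 from this, map_zero, zero_mul]
    · rw [Ec_neg i hp hm]; simp

end Setup
end KLR

set_option linter.unusedSectionVars false
set_option linter.unusedSimpArgs false
set_option linter.unusedVariables false
namespace KLR
variable {k : Type} [Field k] {I : Type} [Fintype I] [DecidableEq I]
namespace Setup
variable {C : CartanDatum k I} {Λ β : I → ℕ} {i : I} {n : ℕ} {A B : Type} [Ring A]
    [Algebra k A] [Ring B] [Algebra k B] {e : (Fin n → I) → A} {x τ : ℕ → A}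
    {π : Alg C (n+1) →ₐ[k] B} {φ : A →ₙₐ[k] B} (H : Setup C Λ β i n e x τ π φ)

include H
open Polynomial

/-- the unit `g` -/
noncomputable def g : LaurentPolynomial A := LaurentPolynomial.T 1 ^ Λ i * vv H.loc i 0 0

lemma g_unit : IsUnit H.g := by
  refine (T1_unit.pow _).mul ?_
  have := (vv_tri H.loc i (Nat.zero_le n)).2
  have h2 := fx_coe (vv H.loc i 0) 0
  rw [← h2]
  exact this

/-- the equivalence given by `ww` -/
noncomputable def W : (Fin (n+1) → LaurentPolynomial A) ≃ₗ[(LaurentPolynomial A)ᵐᵒᵖ]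
    (Fin (n+1) → LaurentPolynomial A) := LinearEquiv.ofBijective _
      (ww_bij H.loc T1_unit (fun a ha => xL_nil (H.nil a ha)) i H.g H.g_unit)

lemma W_apply (y) (p) : H.W y p = ∑ c, ww H.loc i H.g c p * y c := rfl

lemma ww_rho (c : Fin (n+1)) : ww H.loc i H.g c =
    H.rho (wT (fun l => TN C (n+1) (n-1-l)) n (n - c)) (Pi.single 0 H.g) := rfl

lemma aF_r (r : Alg C (n+1)) : ∃ y : A[X],
    H.rho (aF C Λ n * r) (Pi.single (Fin.last n) 1) = Pi.single 0 (H.g * toLaurent y) := by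
  obtain ⟨y, h1, -⟩ := H.dec r
  refine ⟨y 0, ?_⟩
  rw [map_mul, Module.End.mul_apply, h1, H.rho_aF, vecMap_apply, Finset.sum_eq_single 0]
  · rw [g, mul_assoc]
  · intro c _ hc
    have h3 : 0 < c.1 := Nat.pos_of_ne_zero fun h => hc (Fin.ext h)
    have := (vv_tri H.loc i (by omega : c.1 ≤ n)).1 0 h3
    rw [← fx_coe (vv H.loc i c) 0]
    rw [show fx (vv H.loc i c) ((0 : Fin (n+1)) : ℕ) = 0 from this, zero_mul]
  · simp

omit H in
lemma aF_E (μ) : Ee C μ * aF C Λ n = aF C Λ n * Ee C μ := by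
  have K := alg_isKLR C (n+1)
  rw [aF, Finset.mul_sum, Finset.sum_mul]
  refine Finset.sum_congr rfl fun ν _ => ?_
  have h : Commute (Ee C μ) (XN C (n+1) 0) := (K.xe 0 μ (by omega)).symm
  rw [← mul_assoc, (h.pow_right _).eq, mul_assoc, mul_assoc, K.ee, K.ee]
  by_cases hh : μ = ν
  · subst hh; rfl
  · rw [if_neg hh, if_neg (Ne.symm hh)]

omit H in
lemma aF_X (a : ℕ) (ha : a < n + 1) : XN C (n+1) a * aF C Λ n = aF C Λ n * XN C (n+1) a := by
  have K := alg_isKLR C (n+1)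
  rw [aF, Finset.mul_sum, Finset.sum_mul]
  refine Finset.sum_congr rfl fun ν _ => ?_
  have h : Commute (XN C (n+1) a) (XN C (n+1) 0) := K.xx a 0 ha (by omega)
  rw [← mul_assoc, (h.pow_right _).eq, mul_assoc, mul_assoc, K.xe _ _ ha]

omit H in
lemma aF_T (l : ℕ) (hl : l + 1 < n) :
    TN C (n+1) (l+1) * aF C Λ n = aF C Λ n * TN C (n+1) (l+1) := by
  have K := alg_isKLR C (n+1)
  rw [aF, Finset.mul_sum, Finset.sum_mul]
  refine Finset.sum_nbij' (fun μ => sw μ (l+1) (by omega)) (fun μ => sw μ (l+1) (by omega))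
    (by simp) (by simp) (fun a _ => sw_sw _ _ _) (fun a _ => sw_sw _ _ _) fun ν _ => ?_
  have h : Commute (TN C (n+1) (l+1)) (XN C (n+1) 0) :=
    K.tx _ _ (by omega) (by omega) (by omega) (by omega)
  have h0 : sw ν (l+1) (by omega) 0 = ν 0 := by
    have := sw_apply ν (l+1) (by omega : l + 1 + 1 < n + 1) 0 (by omega)
    rw [if_neg (by omega), if_neg (by omega)] at this
    exact this
  rw [← mul_assoc, (h.pow_right _).eq, mul_assoc, mul_assoc, K.te _ (by omega), h0]

variable (C Λ n) in
omit H in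
/-- the right ideal generated by `aF` -/
noncomputable def D2 : AddSubgroup (Alg C (n+1)) := (AddMonoidHom.mulLeft (aF C Λ n)).range

omit H in
lemma D2_stab {r : Alg C (n+1)} (h : r * aF C Λ n = aF C Λ n * r) :
    ∀ y ∈ D2 C Λ n, r * y ∈ D2 C Λ n := by
  rintro _ ⟨s, rfl⟩
  refine ⟨r * s, ?_⟩
  show aF C Λ n * (r * s) = r * (aF C Λ n * s)
  rw [← mul_assoc, ← mul_assoc, h]

variable (C Λ n) in
/-- the two-sided ideal generated by `aF` -/
noncomputable abbrev J : AddSubgroup (Alg C (n+1)) :=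
  DD (fun l => TN C (n+1) (n-1-l)) n (D2 C Λ n) 0

omit H in
lemma J_left (r : Alg C (n+1)) : ∀ z ∈ J C Λ n, r * z ∈ J C Λ n :=
  span2 _ (fun c => D2_stab (Algebra.commutes c _)) (fun μ => D2_stab (aF_E μ))
    (fun a ha => D2_stab (aF_X a ha)) (fun l hl => D2_stab (aF_T l hl)) r

omit H in
lemma J_right (r : Alg C (n+1)) : ∀ z ∈ J C Λ n, z * r ∈ J C Λ n := by
  intro z hz
  obtain ⟨y, hy, rfl⟩ := DD_explicit hz
  rw [Finset.sum_mul]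
  refine sum_mem fun c _ => ?_
  rw [mul_assoc]
  refine DD_mem (Nat.zero_le _) (by omega) ?_
  obtain ⟨s, hs⟩ := hy c
  refine ⟨s * r, ?_⟩
  rw [← hs]
  exact (mul_assoc _ _ _).symm

omit H in
lemma J_a : aF C Λ n ∈ J C Λ n := by
  rw [← one_mul (aF C Λ n), ← wT_top (fun l => TN C (n+1) (n-1-l)) n]
  exact DD_mem (Nat.zero_le _) le_rfl ⟨1, mul_one _⟩

/-- elements acting as elements of `J` -/
def S : AddSubgroup (Alg C (n+1)) where
  carrier := {r | ∃ z ∈ J C Λ n, H.rho r = H.rho z}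
  zero_mem' := ⟨0, zero_mem _, rfl⟩
  add_mem' := by
    rintro a b ⟨y, h1, h2⟩ ⟨z, h3, h4⟩
    exact ⟨y + z, add_mem h1 h3, by rw [map_add, map_add, h2, h4]⟩
  neg_mem' := by
    rintro a ⟨y, h1, h2⟩
    exact ⟨-y, neg_mem h1, by rw [map_neg, map_neg, h2]⟩

lemma rho_E0 (μ) (h : content μ ≠ addA β i) : H.rho (Ee C μ) = 0 := by
  refine end_ext fun f p hp => ?_
  rw [rho, (H.loc.isKLR i).hom_E, fx_E _ _ _ hp, LinearMap.zero_apply, fx_zero]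
  by_cases hm : μ ⟨p, hp⟩ = i
  · rw [Ec_pos i hp hm, H.ez, map_zero, zero_mul]
    intro h2
    apply h
    have := content_succAbove μ ⟨p, hp⟩
    rw [hm] at this
    rw [this]
    exact congrArg (fun γ => addA γ i) h2
  · rw [Ec_neg i hp hm, zero_mul]

lemma ker_S (r) (h : π r = 0) : r ∈ H.S := by
  refine H.pker H.S ?_ ?_ ?_ ?_ r h
  · rintro a s ⟨z, h1, h2⟩
    exact ⟨a * z, J_left a z h1, by rw [map_mul, map_mul, h2]⟩
  · rintro a s ⟨z, h1, h2⟩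
    exact ⟨z * a, J_right a z h1, by rw [map_mul, map_mul, h2]⟩
  · exact ⟨_, J_a, rfl⟩
  · intro μ hμ
    exact ⟨0, zero_mem _, by rw [H.rho_E0 μ hμ, map_zero]⟩

lemma ker_W (r) (h : π r = 0) : ∃ y : Fin (n+1) → A[X],
    H.rho r (Pi.single (Fin.last n) 1) = H.W (fun c => toLaurent (y c)) := by
  obtain ⟨z, hz, hr⟩ := H.ker_S r h
  obtain ⟨s, hs, rfl⟩ := DD_explicit hz
  choose t ht using hs
  choose y hy using fun c => H.aF_r (t c)
  refine ⟨fun c => y c.rev, ?_⟩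
  funext p
  rw [hr, W_apply, map_sum, LinearMap.sum_apply, Finset.sum_apply]
  refine Finset.sum_bij' (fun c _ => c.rev) (fun c _ => c.rev) (by simp) (by simp) (by simp)
    (by simp) fun c _ => ?_
  dsimp only
  rw [map_mul, Module.End.mul_apply, Fin.rev_rev, ← ht c]
  have := hy c
  rw [show (AddMonoidHom.mulLeft (aF C Λ n)) (t c) = aF C Λ n * t c from rfl, hy c, H.rho_op]
  rw [H.ww_rho, Fin.val_rev, show n - (n + 1 - (c.1 + 1)) = c.1 by omega]

lemma lift_W (y : Fin (n+1) → A[X]) : ∃ r : Alg C (n+1), π r = 0 ∧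
    H.rho r (Pi.single (Fin.last n) 1) = H.W (fun c => toLaurent (y c)) := by
  choose s hs using fun c => H.lift_y (y c)
  refine ⟨∑ c : Fin (n+1), wT (fun l => TN C (n+1) (n-1-l)) n (n - c) *
    (aF C Λ n * (wT (TN C (n+1)) n 0 * s c)), ?_, ?_⟩
  · rw [map_sum]
    refine Finset.sum_eq_zero fun c _ => ?_
    rw [map_mul, map_mul, H.pa, zero_mul, mul_zero]
  · funext p
    rw [W_apply, map_sum, LinearMap.sum_apply, Finset.sum_apply]
    refine Finset.sum_congr rfl fun c _ => ?_
    have h1 := hs c 1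
    rw [map_one, mul_one] at h1
    rw [map_mul, map_mul, map_mul, Module.End.mul_apply, Module.End.mul_apply,
      Module.End.mul_apply, h1, ← one_mul (toLaurent (y c)), H.rho_op, one_mul, H.rho_aF,
      ← mul_assoc, H.rho_op, H.ww_rho]
    rfl

lemma q_W (y : Fin (n+1) → A[X]) : H.q (H.W (fun c => toLaurent (y c))) = 0 := by
  obtain ⟨r, h1, h2⟩ := H.lift_W y
  rw [← h2, H.q_rho, h1, zero_mul]

end Setup
end KLR

set_option linter.unusedSectionVars false
set_option linter.unusedSimpArgs false
set_option linter.unusedVariables false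
namespace KLR
variable {k : Type} [Field k] {I : Type} [Fintype I] [DecidableEq I]
open Polynomial MulOpposite

section modr
variable {A B : Type} [Ring A] [Algebra k A] [Ring B] [Algebra k B] (φ : A →ₙₐ[k] B)

lemma mem_rId {x : B} : x ∈ rId (k := k) (φ 1) ↔ x * φ 1 = x := by
  constructor
  · rintro ⟨w, rfl⟩
    show w * φ 1 * φ 1 = w * φ 1
    rw [mul_assoc, ← map_mul, one_mul]
  · intro h
    exact ⟨x, h⟩

/-- the right module structure -/
@[reducible] noncomputable def rMod : Module Aᵐᵒᵖ ↥(rId (k := k) (φ 1)) where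
  smul r x := ⟨x.1 * φ r.unop, (mem_rId φ).2 (by rw [mul_assoc, ← map_mul, mul_one])⟩
  one_smul x := Subtype.ext ((mem_rId φ).1 x.2)
  mul_smul a b x := Subtype.ext (by
    show x.1 * φ (b.unop * a.unop) = x.1 * φ b.unop * φ a.unop
    rw [map_mul, mul_assoc])
  smul_zero a := Subtype.ext (zero_mul _)
  smul_add a x y := Subtype.ext (add_mul _ _ _)
  add_smul a b x := Subtype.ext (by
    show x.1 * φ (a.unop + b.unop) = x.1 * φ a.unop + x.1 * φ b.unop
    rw [map_add, mul_add])
  zero_smul x := Subtype.ext (by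
    show x.1 * φ 0 = 0
    rw [map_zero, mul_zero])
end modr

namespace Setup
variable {C : CartanDatum k I} {Λ β : I → ℕ} {i : I} {n : ℕ} {A B : Type} [Ring A]
    [Algebra k A] [Ring B] [Algebra k B] {e : (Fin n → I) → A} {x τ : ℕ → A}
    {π : Alg C (n+1) →ₐ[k] B} {φ : A →ₙₐ[k] B} (H : Setup C Λ β i n e x τ π φ)

include H

/-- projection away from `W(A[X]^{n+1})` -/
noncomputable def pr (f : Fin (n+1) → LaurentPolynomial A) : Fin (n+1) → LaurentPolynomial A :=
  f - H.W (fun c => toLaurent (LaurentPolynomial.trunc (H.W.symm f c)))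

lemma pr_add (f g) : H.pr (f + g) = H.pr f + H.pr g := by
  have : (fun c => toLaurent (LaurentPolynomial.trunc (H.W.symm (f + g) c))) =
      (fun c => toLaurent (LaurentPolynomial.trunc (H.W.symm f c))) +
      (fun c => toLaurent (LaurentPolynomial.trunc (H.W.symm g c))) := by
    funext c
    rw [map_add, Pi.add_apply, map_add, map_add, Pi.add_apply]
  unfold pr
  rw [this, map_add]
  abel

lemma pr_smul (a : A) (f) : H.pr (op a • f) = op a • H.pr f := by
  have : (fun c => toLaurent (LaurentPolynomial.trunc (H.W.symm (op a • f) c))) =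
      op (LaurentPolynomial.C a) •
        (fun c => toLaurent (LaurentPolynomial.trunc (H.W.symm f c))) := by
    funext c
    rw [smulA, map_smul, Pi.smul_apply, MulOpposite.smul_eq_mul_unop, MulOpposite.unop_op,
      trunc_mul_C, map_mul, toLaurent_C]
    rfl
  unfold pr
  rw [this, map_smul, smulA, smulA, smul_sub]

lemma pr_W (y : Fin (n+1) → A[X]) : H.pr (H.W (fun c => toLaurent (y c))) = 0 := by
  unfold pr
  rw [H.W.symm_apply_apply]
  simp only [Polynomial.trunc_toLaurent, sub_self]

lemma q_pr (f) : H.q (H.pr f) = H.q f := by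
  have : H.q (H.pr f + H.W (fun c => toLaurent (LaurentPolynomial.trunc (H.W.symm f c)))) =
    H.q f := by rw [pr, sub_add_cancel]
  rwa [q_add, q_W, add_zero] at this

lemma q_mem (f) : H.q f ∈ rId (k := k) (φ 1) := by
  rw [mem_rId, q, Finset.sum_mul]
  refine Finset.sum_congr rfl fun c _ => ?_
  rw [mul_assoc, evP_mul_one _ _ H.z_comm]

lemma pr_rho (r s) (h : π r = π s) : H.pr (H.rho r (Pi.single (Fin.last n) 1)) =
    H.pr (H.rho s (Pi.single (Fin.last n) 1)) := by
  obtain ⟨y, hy⟩ := H.ker_W (r - s) (by rw [map_sub, h, sub_self])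
  have h2 : H.rho r (Pi.single (Fin.last n) 1) = H.W (fun c => toLaurent (y c)) +
      H.rho s (Pi.single (Fin.last n) 1) := by
    rw [← hy, map_sub, LinearMap.sub_apply, sub_add_cancel]
  rw [h2, pr_add, pr_W, zero_add]

lemma rho_eN : H.rho (∑ ν, Ee C (Fin.snoc ν i)) (Pi.single (Fin.last n) 1) =
    Pi.single (Fin.last n) 1 := by
  rw [map_sum, LinearMap.sum_apply]
  have : ∀ ν : Fin n → I, H.rho (Ee C (Fin.snoc ν i)) (Pi.single (Fin.last n) 1) =
      Pi.single (Fin.last n) (LaurentPolynomial.C (e ν)) := by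
    intro ν
    rw [H.rho_E, if_pos (Fin.snoc_last (α := fun _ => I) _ _), rm_snoc, mul_one]
  rw [Finset.sum_congr rfl fun ν _ => this ν]
  funext p
  rw [Finset.sum_apply]
  by_cases hp : p = Fin.last n
  · subst hp
    simp only [Pi.single_eq_same]
    rw [← map_sum, H.HA.esum, map_one]
  · simp [Pi.single_eq_of_ne hp]

/-- the splitting -/
noncomputable def sp (b : B) : Fin (n+1) → LaurentPolynomial A :=
  H.pr (H.rho (H.psurj b).choose (Pi.single (Fin.last n) 1))

lemma sp_eq (r) : H.sp (π r) = H.pr (H.rho r (Pi.single (Fin.last n) 1)) :=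
  H.pr_rho _ _ (H.psurj (π r)).choose_spec

lemma sp_add (a b : B) : H.sp (a + b) = H.sp a + H.sp b := by
  obtain ⟨r, rfl⟩ := H.psurj a
  obtain ⟨s, rfl⟩ := H.psurj b
  rw [← map_add, sp_eq, sp_eq, sp_eq, map_add, LinearMap.add_apply, pr_add]

lemma sp_mul (b : B) (a : A) : H.sp (b * φ a) = op a • H.sp b := by
  obtain ⟨r, rfl⟩ := H.psurj b
  obtain ⟨s, hs⟩ := H.lift_A a
  obtain ⟨h1, h2⟩ := hs 1
  rw [mul_one, evP_C, ← Polynomial.C_1, evP_C] at h2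
  rw [map_one, mul_one, toLaurent_C] at h1
  have : π r * φ a = π (r * (s * ∑ ν, Ee C (Fin.snoc ν i))) := by
    rw [map_mul, map_mul, map_sum, ← H.phi1, h2]
  rw [this, sp_eq, sp_eq, map_mul, map_mul, Module.End.mul_apply, Module.End.mul_apply,
    rho_eN, h1, ← pr_smul, smulA]
  congr 1
  rw [← one_mul (LaurentPolynomial.C a), H.rho_op, one_mul]
  rfl

lemma q_sp (b : B) : H.q (H.sp b) = b * φ 1 := by
  obtain ⟨r, rfl⟩ := H.psurj b
  rw [sp_eq, q_pr, q_rho]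

theorem proj : letI := rMod φ
    Module.Projective Aᵐᵒᵖ ↥(rId (k := k) (φ 1)) := by
  letI := rMod φ
  haveI := proj_N (A := A) (n+1)
  let s : ↥(rId (k := k) (φ 1)) →ₗ[Aᵐᵒᵖ] (Fin (n+1) → LaurentPolynomial A) :=
    { toFun := fun b => H.sp b.1
      map_add' := fun a b => H.sp_add a.1 b.1
      map_smul' := fun a b => H.sp_mul b.1 a.unop }
  let p : (Fin (n+1) → LaurentPolynomial A) →ₗ[Aᵐᵒᵖ] ↥(rId (k := k) (φ 1)) :=
    { toFun := fun f => ⟨H.q f, H.q_mem f⟩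
      map_add' := fun a b => Subtype.ext (H.q_add a b)
      map_smul' := fun a b => Subtype.ext (H.q_smul a.unop b) }
  refine Module.Projective.of_split s p ?_
  ext b
  show H.q (H.sp b.1) = b.1
  rw [q_sp]
  exact (mem_rId φ).1 b.2

theorem fin (hz : IsNilpotent (π (XN C (n+1) n))) :
    letI := rMod φ
    Module.Finite Aᵐᵒᵖ ↥(rId (k := k) (φ 1)) := by
  classical
  letI := rMod φ
  obtain ⟨N, hN⟩ := hz
  let gen : Fin (n+1) × Fin N → ↥(rId (k := k) (φ 1)) := fun c =>
    ⟨π (wT (TN C (n+1)) n c.1) * π (XN C (n+1) n) ^ c.2.1 * φ 1, ⟨_, rfl⟩⟩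
  refine ⟨⟨Finset.univ.image gen, ?_⟩⟩
  rw [eq_top_iff]
  have key : ∀ (c : Fin (n+1)) (y : A[X]) (b : ↥(rId (k := k) (φ 1))),
      b.1 = π (wT (TN C (n+1)) n c) * evP φ (π (XN C (n+1) n)) y →
      b ∈ Submodule.span Aᵐᵒᵖ (Finset.univ.image gen : Set ↥(rId (k := k) (φ 1))) := by
    intro c y
    induction y using Polynomial.induction_on' with
    | add p q h1 h2 =>
      intro b hb
      have m : ∀ y, π (wT (TN C (n+1)) n c) * evP φ (π (XN C (n+1) n)) y ∈ rId (k := k) (φ 1) :=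
        fun y => by rw [mem_rId, mul_assoc, evP_mul_one _ _ H.z_comm]
      have : b = ⟨_, m p⟩ + ⟨_, m q⟩ := Subtype.ext (by
        rw [hb, evP_add, mul_add]; rfl)
      rw [this]
      exact add_mem (h1 _ rfl) (h2 _ rfl)
    | monomial j a =>
      intro b hb
      rw [evP_monomial, ← ((H.z_comm a).pow_left j).eq] at hb
      by_cases hj : j < N
      · have : b = op a • gen (c, ⟨j, hj⟩) := Subtype.ext (by
          rw [hb]
          show _ = π (wT (TN C (n+1)) n c) * π (XN C (n+1) n) ^ j * φ 1 * φ a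
          rw [mul_assoc _ (φ 1), ← map_mul φ, one_mul, mul_assoc])
        rw [this]
        refine Submodule.smul_mem _ _ (Submodule.subset_span ?_)
        simp
      · have : b = 0 := Subtype.ext (by
          rw [hb, pow_eq_zero_of_le (by omega) hN, zero_mul, mul_zero]; rfl)
        rw [this]; exact zero_mem _
  intro b _
  obtain ⟨r, hr⟩ := H.psurj b.1
  obtain ⟨y, -, h2⟩ := H.dec r
  rw [hr, (mem_rId φ).1 b.2] at h2
  have m : ∀ c : Fin (n+1), π (wT (TN C (n+1)) n c) * evP φ (π (XN C (n+1) n)) (y c) ∈ rId (k := k) (φ 1) :=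
    fun c => by rw [mem_rId, mul_assoc, evP_mul_one _ _ H.z_comm]
  have : b = ∑ c : Fin (n+1), ⟨_, m c⟩ := Subtype.ext (by
    rw [h2, AddSubmonoidClass.coe_finsetSum])
  rw [this]
  exact sum_mem fun c _ => key c (y c) _ rfl

end Setup
end KLR

set_option linter.unusedSectionVars false
set_option linter.unusedSimpArgs false
set_option linter.unusedVariables false
namespace KLR
variable {k : Type} [Field k] {I : Type} [Fintype I] [DecidableEq I]
open MulOpposite

section opp
variable {C : CartanDatum k I} {n : ℕ} {L : Type} [Ring L] [Algebra k L]

lemma op_sum {M ι : Type} [AddCommMonoid M] (s : Finset ι) (f : ι → M) :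
    op (∑ j ∈ s, f j) = ∑ j ∈ s, op (f j) := map_sum (opAddEquiv (α := M)) f s

lemma Qel_op (i j : I) {u v : L} (h : Commute u v) :
    Qel C i j (op u) (op v) = op (Qel C i j u v) := by
  unfold Qel
  split_ifs
  · rfl
  · rw [op_sum]
    refine Finset.sum_congr rfl fun p _ => ?_
    rw [op_sum]
    refine Finset.sum_congr rfl fun q _ => ?_
    split_ifs
    · rw [op_smul, (h.pow_pow p q).eq, op_mul, op_pow, op_pow]
    · rfl

lemma Qdiff_op (i j : I) {u v w : L} (h : Commute u v) (h2 : Commute u w) (h3 : Commute v w) :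
    Qdiff C i j (op u) (op v) (op w) = op (Qdiff C i j u v w) := by
  unfold Qdiff
  split_ifs
  · rfl
  · rw [op_sum]
    refine Finset.sum_congr rfl fun p _ => ?_
    rw [op_sum]
    refine Finset.sum_congr rfl fun q _ => ?_
    split_ifs
    · have : Commute (∑ c ∈ Finset.range p, u ^ c * w ^ (p - 1 - c)) (v ^ q) :=
        Commute.sum_left _ _ _ fun c _ => (h.pow_pow _ _).mul_left (h3.symm.pow_pow _ _)
      rw [op_smul, this.eq, op_mul, op_pow, op_sum]
      congr 2
      refine Finset.sum_congr rfl fun c _ => ?_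
      rw [(h2.pow_pow _ _).eq, op_mul, op_pow, op_pow]
    · rfl

variable {E : (Fin n → I) → L} {X T : ℕ → L}

lemma IsKLR.flip (H : IsKLR C n E X T) (b : L) (c : (Fin n → I) → L)
    (h : ∀ ν, b * E ν = c ν * E ν) (hc : ∀ ν μ, Commute (c ν) (E μ)) (ν) :
    E ν * b = E ν * c ν := by
  have hb : b = ∑ μ, c μ * E μ := by
    rw [← mul_one b, ← H.esum, Finset.mul_sum]
    exact Finset.sum_congr rfl fun μ _ => h μ
  rw [hb, Finset.mul_sum, Finset.sum_eq_single ν]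
  · rw [(hc ν ν).eq, ← mul_assoc, H.ee, if_pos rfl]
  · intro μ _ hm
    rw [(hc μ μ).eq, ← mul_assoc, H.ee, if_neg hm.symm, zero_mul]
  · simp

lemma IsKLR.opp (H : IsKLR C n E X T) :
    IsKLR C n (fun ν => op (E ν)) (fun a => op (X a)) (fun a => op (T a)) := by
  have hX : ∀ a b, a < n → b < n → Commute (X a) (X b) := H.xx
  have hXE : ∀ a ν, a < n → Commute (X a) (E ν) := H.xe
  constructor
  · intro ν ν'
    rw [← op_mul, H.ee]
    by_cases h : ν = ν'
    · subst h; simp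
    · simp [h, Ne.symm h]
  · rw [← op_sum, H.esum, op_one]
  · intro a b ha hb
    rw [← op_mul, ← op_mul, H.xx _ _ ha hb]
  · intro a ν ha
    rw [← op_mul, ← op_mul, H.xe _ _ ha]
  · intro l h ν
    rw [← op_mul, ← op_mul, H.te l h, sw_sw]
  · intro l l' h1 h2 h3
    rw [← op_mul, ← op_mul, H.tt _ _ h1 h2 h3]
  · intro l h ν
    have hc : ∀ (ν μ : Fin n → I), Commute (Qel C (ν ⟨l, by omega⟩) (ν ⟨l + 1, h⟩) (X l) (X (l + 1))) (E μ) :=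
      fun ν μ => (Qel_commute C _ _ _ _ _ (hXE l μ (by omega)).symm (hXE _ μ h).symm).symm
    rw [Qel_op _ _ (hX l (l+1) (by omega) h), ← op_mul, ← op_mul, ← op_mul,
      H.flip (T l * T l) _ (H.tsq l h) hc]
  · intro l h ν
    have := H.flip (T l * X (l+1) - X l * T l)
      (fun ν => if ν ⟨l, by omega⟩ = ν ⟨l + 1, h⟩ then 1 else 0)
      (fun ν => by rw [sub_mul, H.tx2 l h]; split_ifs <;> simp)
      (fun ν μ => by split_ifs <;> simp) ν
    rw [mul_sub, sub_eq_iff_eq_add] at this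
    rw [← op_mul, ← op_mul, ← op_mul, ← op_mul, this]
    split_ifs <;> simp
  · intro l h ν
    have := H.flip (T l * X l - X (l+1) * T l)
      (fun ν => if ν ⟨l, by omega⟩ = ν ⟨l + 1, h⟩ then -1 else 0)
      (fun ν => by rw [sub_mul, H.tx1 l h]; split_ifs <;> simp)
      (fun ν μ => by split_ifs <;> simp) ν
    rw [mul_sub, sub_eq_iff_eq_add] at this
    rw [← op_mul, ← op_mul, ← op_mul, ← op_mul, this]
    split_ifs <;> simp
  · intro l m h1 h2 h3 h4
    rw [← op_mul, ← op_mul, H.tx _ _ h1 h2 h3 h4]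
  · intro l h ν
    have hc : ∀ (ν μ : Fin n → I), Commute (if ν ⟨l, by omega⟩ = ν ⟨l + 2, h⟩ then
      Qdiff C (ν ⟨l, by omega⟩) (ν ⟨l + 1, by omega⟩) (X l) (X (l + 1)) (X (l + 2)) else 0)
        (E μ) := by
      intro ν μ
      split_ifs
      · exact (Qdiff_commute C _ _ _ _ _ _ (hXE l μ (by omega)).symm
          (hXE (l+1) μ (by omega)).symm (hXE (l+2) μ h).symm).symm
      · exact Commute.zero_left _
    have := H.flip _ _ (fun ν => by rw [H.braid l h ν, ite_zero_mul]) hc ν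
    rw [Qdiff_op _ _ (hX l (l+1) (by omega) (by omega)) (hX l (l+2) (by omega) (by omega))
      (hX (l+1) (l+2) (by omega) (by omega))]
    simp only [← op_mul, ← op_sub]
    simp only [mul_assoc] at this ⊢
    rw [this]
    split_ifs <;> simp
end opp

end KLR

set_option linter.unusedSectionVars false
set_option linter.unusedSimpArgs false
set_option linter.unusedVariables false
namespace KLR
variable {k : Type} [Field k] {I : Type} [Fintype I] [DecidableEq I]
open MulOpposite

section
variable (C : CartanDatum k I) (n : ℕ)
/-- the anti-involution fixing the generators -/
noncomputable def psi : Alg C n →ₐ[k] (Alg C n)ᵐᵒᵖ := (alg_isKLR C n).opp.hom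

lemma psi_E (ν : Fin n → I) : psi C n (Ee C ν) = op (Ee C ν) := by
  unfold psi; rw [IsKLR.hom_E]
lemma psi_X (a : ℕ) (h : a < n) : psi C n (XN C n a) = op (XN C n a) := by
  unfold psi; rw [IsKLR.hom_X _ _ a h]
lemma psi_T (a : ℕ) (h : a + 1 < n) : psi C n (TN C n a) = op (TN C n a) := by
  unfold psi; rw [IsKLR.hom_T _ _ a h]

variable {C n} {L : Type} [Ring L] [Algebra k L] {E : (Fin n → I) → L} {X T : ℕ → L}

lemma op_hom (H : IsKLR C n E X T) (r : Alg C n) :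
    H.opp.hom (unop (psi C n r)) = op (H.hom r) := by
  induction r using alg_induction with
  | hc c =>
    rw [AlgHom.commutes, AlgHom.commutes, MulOpposite.algebraMap_apply, unop_op, AlgHom.commutes,
      MulOpposite.algebraMap_apply]
  | hE ν => rw [psi_E, unop_op, IsKLR.hom_E, IsKLR.hom_E]
  | hX a h => rw [psi_X _ _ _ h, unop_op, IsKLR.hom_X _ _ a h, IsKLR.hom_X _ _ a h]
  | hT a h => rw [psi_T _ _ _ h, unop_op, IsKLR.hom_T _ _ a h, IsKLR.hom_T _ _ a h]
  | ha r s hr hs => rw [map_add, unop_add, map_add, hr, hs, map_add, op_add]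
  | hm r s hr hs => rw [map_mul, unop_mul, map_mul, hr, hs, map_mul, op_mul]

lemma hom_self (r : Alg C n) : (alg_isKLR C n).hom r = r := by
  induction r using alg_induction with
  | hc c => simp only [AlgHom.commutes]
  | hE ν => rw [IsKLR.hom_E]
  | hX a h => rw [IsKLR.hom_X _ _ a h]
  | hT a h => rw [IsKLR.hom_T _ _ a h]
  | ha r s hr hs => rw [map_add, hr, hs]
  | hm r s hr hs => rw [map_mul, hr, hs]

lemma psi_psi (r : Alg C n) : unop (psi C n (unop (psi C n r))) = r := by
  have h := op_hom (alg_isKLR C n) r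
  rw [hom_self] at h
  unfold psi at h ⊢
  rw [h, unop_op]
end

section
variable {C : CartanDatum k I} {n : ℕ}

lemma psi_aF (Λ : I → ℕ) : psi C (n+1) (aF C Λ n) = op (aF C Λ n) := by
  rw [aF, map_sum, op_sum]
  refine Finset.sum_congr rfl fun μ _ => ?_
  have h : Commute (XN C (n+1) 0) (Ee C μ) := (alg_isKLR C (n+1)).xe 0 μ (by omega)
  rw [map_mul, map_pow, psi_E, psi_X _ _ _ (by omega), ← op_pow, ← op_mul, (h.pow_left _).eq]

lemma snoc_sw (ν : Fin n → I) (i : I) (l : ℕ) (h : l + 1 < n) :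
    sw (Fin.snoc ν i : Fin (n+1) → I) l (by omega) = Fin.snoc (sw ν l h) i := by
  funext ⟨a, ha⟩
  rw [sw_apply]
  simp only [Fin.snoc, Fin.castLT_mk, cast_eq]
  split_ifs with h1 h2 h3 h4 h5 <;> (try omega) <;> simp_all [sw_apply]

lemma eN_X (i : I) (a : ℕ) (h : a < n) : Commute (∑ ν : Fin n → I, Ee C (Fin.snoc ν i : Fin (n+1) → I))
    (XN C (n+1) a) :=
  Commute.sum_left _ _ _ fun ν _ => ((alg_isKLR C (n+1)).xe a _ (by omega)).symm

lemma eN_T (i : I) (l : ℕ) (h : l + 1 < n) :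
    Commute (TN C (n+1) l) (∑ ν : Fin n → I, Ee C (Fin.snoc ν i : Fin (n+1) → I)) := by
  unfold Commute SemiconjBy
  rw [Finset.mul_sum, Finset.sum_mul]
  refine Finset.sum_nbij' (fun μ => sw μ l (by omega)) (fun μ => sw μ l (by omega))
    (by simp) (by simp) (fun a _ => sw_sw _ _ _) (fun a _ => sw_sw _ _ _) fun ν _ => ?_
  rw [(alg_isKLR C (n+1)).te l (by omega), snoc_sw ν i l h]
end

section
variable {A B : Type} [Ring A] [Algebra k A] [Ring B] [Algebra k B]
/-- opposite of a non-unital algebra map -/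
def opN (φ : A →ₙₐ[k] B) : Aᵐᵒᵖ →ₙₐ[k] Bᵐᵒᵖ where
  toFun a := op (φ a.unop)
  map_smul' c a := by
    show op (φ (c • a.unop)) = c • op (φ a.unop)
    rw [map_smul, op_smul]
  map_zero' := by rw [unop_zero, map_zero, op_zero]
  map_add' a b := by rw [unop_add, map_add, op_add]
  map_mul' a b := by rw [unop_mul, map_mul, op_mul]

lemma opN_apply (φ : A →ₙₐ[k] B) (a : A) : opN φ (op a) = op (φ a) := rfl
lemma opN_one (φ : A →ₙₐ[k] B) : opN φ 1 = op (φ 1) := rfl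
end

namespace Setup
variable {C : CartanDatum k I} {Λ β : I → ℕ} {i : I} {n : ℕ} {A B : Type} [Ring A]
    [Algebra k A] [Ring B] [Algebra k B] {e : (Fin n → I) → A} {x τ : ℕ → A}
    {π : Alg C (n+1) →ₐ[k] B} {φ : A →ₙₐ[k] B}

/-- opposite of `π` -/
noncomputable def opPi (π : Alg C (n+1) →ₐ[k] B) : Alg C (n+1) →ₐ[k] Bᵐᵒᵖ :=
  (AlgHom.op π).comp (psi C (n+1))

lemma opPi_apply (π : Alg C (n+1) →ₐ[k] B) (r) :
    opPi π r = op (π (unop (psi C (n+1) r))) := rfl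

lemma opp (H : Setup C Λ β i n e x τ π φ) : Setup C Λ β i n (fun ν => op (e ν))
    (fun a => op (x a)) (fun a => op (τ a)) (opPi π) (opN φ) := by
  have h1 : φ 1 = π (∑ ν : Fin n → I, Ee C (Fin.snoc ν i : Fin (n+1) → I)) := by
    rw [H.phi1, map_sum]
  constructor
  case HA => exact H.HA.opp
  case nil =>
    intro a ha
    obtain ⟨m, hm⟩ := H.nil a ha
    exact ⟨m, by rw [← op_pow, hm, op_zero]⟩
  case cyc =>
    intro h ν
    have hc : Commute (x 0) (e ν) := H.HA.xe 0 ν h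
    rw [← op_pow, ← op_mul, ← (hc.pow_left _).eq, H.cyc h ν, op_zero]
  case surj =>
    intro b
    obtain ⟨r, hr⟩ := H.surj b.unop
    exact ⟨unop (psi C n r), by rw [op_hom H.HA, hr, op_unop]⟩
  case ez =>
    intro ν h
    rw [H.ez ν h, op_zero]
  case phe =>
    intro ν
    rw [opN_apply, opPi_apply, psi_E, H.phe, unop_op]
  case phx =>
    intro a ha
    rw [opN_apply, opPi_apply, psi_X _ _ _ (by omega), unop_op, opN_one, ← op_mul, H.phx a ha, h1,
      ← map_mul, ← map_mul, (eN_X i a ha).eq]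
  case pht =>
    intro a ha
    rw [opN_apply, opPi_apply, psi_T _ _ _ (by omega), unop_op, opN_one, ← op_mul, H.pht a ha, h1,
      ← map_mul, ← map_mul, (eN_T i a ha).eq]
  case psurj =>
    intro b
    obtain ⟨r, hr⟩ := H.psurj b.unop
    exact ⟨unop (psi C (n+1) r), by rw [opPi_apply, psi_psi, hr, op_unop]⟩
  case pa => rw [opPi_apply, psi_aF, unop_op, H.pa, op_zero]
  case pz =>
    intro μ h
    rw [opPi_apply, psi_E, unop_op, H.pz μ h, op_zero]
  case pker =>
    intro S hl hr ha hz r h0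
    let S' : AddSubgroup (Alg C (n+1)) :=
      { carrier := {s | unop (psi C (n+1) s) ∈ S}
        add_mem' := fun {a b} h1 h2 => by
          show unop (psi C (n+1) (a + b)) ∈ S
          rw [map_add, unop_add]; exact S.add_mem h1 h2
        zero_mem' := by
          show unop (psi C (n+1) 0) ∈ S
          rw [map_zero, unop_zero]; exact S.zero_mem
        neg_mem' := fun {a} h1 => by
          show unop (psi C (n+1) (-a)) ∈ S
          rw [map_neg, unop_neg]; exact S.neg_mem h1 }
    have key := H.pker S'
      (fun a s hs => by
        show unop (psi C (n+1) (a * s)) ∈ S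
        rw [map_mul, unop_mul]; exact hr _ _ hs)
      (fun a s hs => by
        show unop (psi C (n+1) (s * a)) ∈ S
        rw [map_mul, unop_mul]; exact hl _ _ hs)
      (by show unop (psi C (n+1) (aF C Λ n)) ∈ S
          rw [psi_aF]; exact ha)
      (fun μ h => by
        show unop (psi C (n+1) (Ee C μ)) ∈ S
        rw [psi_E]; exact hz μ h)
      (unop (psi C (n+1) r)) (by
        rw [opPi_apply] at h0
        exact op_injective h0)
    have h3 : unop (psi C (n+1) (unop (psi C (n+1) r))) ∈ S := key
    rwa [psi_psi] at h3
end Setup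

end KLR

set_option linter.unusedSectionVars false
set_option linter.unusedSimpArgs false
set_option linter.unusedVariables false
namespace KLR
variable {k : Type} [Field k] {I : Type} [Fintype I] [DecidableEq I]
open MulOpposite

section inst
variable (C : CartanDatum k I)

lemma toCB_surj (Λ : I → ℕ) (n : ℕ) (β : I → ℕ) :
    Function.Surjective (toCB C Λ (n := n) (β := β)) := by
  intro b
  obtain ⟨y, rfl⟩ := RingQuot.mkAlgHom_surjective k (CRel C Λ n β) b
  exact ⟨_, toCB_mk C Λ n β y⟩

lemma hom_toCB (Λ : I → ℕ) (n : ℕ) (β : I → ℕ) (r : Alg C n) :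
    (cAlg_isKLR C Λ n β).hom r = toCB C Λ r := by
  induction r using alg_induction with
  | hc c => rw [AlgHom.commutes, AlgHom.commutes]
  | hE ν => rw [IsKLR.hom_E]; rfl
  | hX a h => rw [IsKLR.hom_X _ _ a h]; rfl
  | hT a h => rw [IsKLR.hom_T _ _ a h]; rfl
  | ha r s hr hs => rw [map_add, map_add, hr, hs]
  | hm r s hr hs => rw [map_mul, map_mul, hr, hs]

lemma toCB_ker (Λ : I → ℕ) (n : ℕ) (β : I → ℕ) (S : AddSubgroup (Alg C (n+1)))
    (hl : ∀ a s, s ∈ S → a * s ∈ S) (hr : ∀ a s, s ∈ S → s * a ∈ S) (ha : aF C Λ n ∈ S)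
    (hz : ∀ μ, content μ ≠ β → Ee C μ ∈ S) (r : Alg C (n+1))
    (h0 : toCB C Λ (β := β) r = 0) : r ∈ S := by
  let J : Ideal (Alg C (n+1)) :=
    { carrier := S, add_mem' := S.add_mem, zero_mem' := S.zero_mem, smul_mem' := hl }
  have hJ : J.IsTwoSided := ⟨fun b h => hr b _ h⟩
  let p : Alg C (n+1) →+* Alg C (n+1) ⧸ J := Ideal.Quotient.mk J
  have hp : ∀ r, p r = 0 ↔ r ∈ S := fun r => Ideal.Quotient.eq_zero_iff_mem
  let f : FA k I (n+1) →+* Alg C (n+1) ⧸ J :=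
    p.comp (RingQuot.mkAlgHom k (Rel C (n+1)) : FA k I (n+1) →+* Alg C (n+1))
  have hf : ∀ y, f y = p (RingQuot.mkAlgHom k (Rel C (n+1)) y) := fun y => rfl
  have hrel : ∀ ⦃x y⦄, CRel C Λ (n+1) β x y → f x = f y := by
    intro x y h
    cases h with
    | base hb => rw [hf, hf, RingQuot.mkAlgHom_rel k hb]
    | unit =>
      rw [hf, hf, map_one, ← (alg_isKLR C (n+1)).esum, map_sum, map_sum, map_sum]
      refine Finset.sum_subset (Finset.subset_univ _) fun μ _ hμ => ?_
      exact (hp _).2 (hz μ fun h => hμ (by simpa [seqs] using h))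
    | cyc =>
      rw [hf, hf, map_zero, map_zero, aLamF, dif_pos (Nat.succ_pos n), map_sum, map_sum]
      have h2 := (hp _).2 ha
      rw [aF, map_sum] at h2
      rw [← h2]
      have e : ∀ μ : Fin (n+1) → I, p ((RingQuot.mkAlgHom k (Rel C (n+1)))
          (gx k (⟨0, Nat.succ_pos n⟩ : Fin (n+1)) ^ Λ (μ ⟨0, Nat.succ_pos n⟩) * ge k μ)) =
          p (XN C (n+1) 0 ^ Λ (μ 0) * Ee C μ) := by
        intro μ
        rw [map_mul (RingQuot.mkAlgHom k (Rel C (n+1))), map_pow (RingQuot.mkAlgHom k (Rel C (n+1))),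
          XN_eq C (Nat.succ_pos n)]
        rfl
      simp only [e]
      refine Finset.sum_subset (Finset.subset_univ _) fun μ _ hμ => ?_
      exact (hp _).2 (hl _ _ (hz μ fun h => hμ (by simpa [seqs] using h)))
  let g := RingQuot.lift (r := CRel C Λ (n+1) β) ⟨f, hrel⟩
  obtain ⟨y, rfl⟩ := RingQuot.mkAlgHom_surjective k (Rel C (n+1)) r
  rw [toCB_mk] at h0
  have h1 : g (RingQuot.mkRingHom (CRel C Λ (n+1) β) y) = f y := by
    simp only [g, RingQuot.lift_mkRingHom_apply]
  have h3 : RingQuot.mkRingHom (CRel C Λ (n+1) β) y = 0 := by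
    rw [← h0, ← RingQuot.mkAlgHom_coe k]; rfl
  rw [h3, map_zero] at h1
  exact (hp _).1 (by rw [← hf, ← h1])

lemma eRc_eq (Λ β : I → ℕ) (i : I) (n : ℕ) :
    eRc C Λ n β i = ∑ ν : Fin n → I, toCB C Λ (Ee C (Fin.snoc ν i : Fin (n+1) → I)) := by
  unfold eRc eR
  rw [map_sum, Finset.sum_filter]
  have h : ∀ μ : Fin (n+1) → I, μ ∉ seqs (addA β i) (n+1) →
      toCB C Λ (β := addA β i) (Ee C μ) = 0 := fun μ hμ =>
    eA_zero Λ (n+1) (addA β i) μ fun h => hμ (by simpa [seqs] using h)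
  rw [Finset.sum_subset (Finset.subset_univ _) fun μ _ hμ => by rw [h μ hμ, ite_self],
    ← Finset.sum_filter]
  refine Finset.sum_nbij' (fun μ => rm μ n) (fun ν => Fin.snoc ν i) (by simp) (by simp)
    (fun μ hμ => ?_) (fun ν _ => rm_snoc _ _) (fun μ hμ => ?_)
  · have := (Finset.mem_filter.1 hμ).2
    rw [← this, snoc_rm]
  · have := (Finset.mem_filter.1 hμ).2
    rw [← this, snoc_rm]

variable {C} {Λ β : I → ℕ} {i : I} {n : ℕ}
  {φ : cAlg C Λ n β →ₙₐ[k] cAlg C Λ (n + 1) (addA β i)}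

lemma phi_one (hφ : IsUpRc C Λ i φ) : φ 1 = eRc C Λ n β i := by
  rw [eRc_eq, ← (cAlg_isKLR C Λ n β).esum, map_sum]
  exact Finset.sum_congr rfl fun ν _ => hφ.1 ν

lemma setup (hφ : IsUpRc C Λ i φ) : Setup C Λ β i n (eA C Λ n β) (xA C Λ n β) (tA C Λ n β)
    (toCB C Λ) φ := by
  constructor
  case HA => exact cAlg_isKLR C Λ n β
  case nil => exact xA_nil Λ n β
  case cyc => exact cyc_E Λ n β
  case surj =>
    intro b
    obtain ⟨r, hr⟩ := toCB_surj C Λ n β b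
    exact ⟨r, by rw [hom_toCB, hr]⟩
  case ez => exact eA_zero Λ n β
  case phe => exact hφ.1
  case phx =>
    intro a ha
    have := hφ.2.1 ⟨a, ha⟩
    rw [phi_one hφ]
    unfold xA eRc
    rw [XN_eq C ha, this, map_mul, XN_eq C (Nat.lt_succ_of_lt ha)]
    rfl
  case pht =>
    intro a ha
    have := hφ.2.2 a ha
    rw [phi_one hφ]
    unfold tA eRc
    rw [TN_eq C ha, this, map_mul, TN_eq C (Nat.lt_succ_of_lt ha)]
  case psurj => exact toCB_surj C Λ (n+1) (addA β i)
  case pa =>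
    rw [aF, map_sum]
    refine Finset.sum_eq_zero fun μ _ => ?_
    rw [map_mul, map_pow]
    exact cyc_E Λ (n+1) (addA β i) (Nat.succ_pos n) μ
  case pz => exact eA_zero Λ (n+1) (addA β i)
  case pker => exact toCB_ker C Λ n (addA β i)
end inst

section modl
variable {A B : Type} [Ring A] [Algebra k A] [Ring B] [Algebra k B] (φ : A →ₙₐ[k] B)

lemma mem_lId {x : B} : x ∈ lId (k := k) (φ 1) ↔ φ 1 * x = x := by
  constructor
  · rintro ⟨w, rfl⟩
    show φ 1 * (φ 1 * w) = φ 1 * w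
    rw [← mul_assoc, ← map_mul, one_mul]
  · intro h
    exact ⟨x, h⟩

/-- the left module structure -/
@[reducible] noncomputable def lMod : Module A ↥(lId (k := k) (φ 1)) where
  smul r x := ⟨φ r * x.1, (mem_lId φ).2 (by rw [← mul_assoc, ← map_mul, one_mul])⟩
  one_smul x := Subtype.ext ((mem_lId φ).1 x.2)
  mul_smul a b x := Subtype.ext (by
    show φ (a * b) * x.1 = φ a * (φ b * x.1)
    rw [map_mul, mul_assoc])
  smul_zero a := Subtype.ext (mul_zero _)
  smul_add a x y := Subtype.ext (mul_add _ _ _)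
  add_smul a b x := Subtype.ext (by
    show φ (a + b) * x.1 = φ a * x.1 + φ b * x.1
    rw [map_add, add_mul])
  zero_smul x := Subtype.ext (by
    show φ 0 * x.1 = 0
    rw [map_zero, zero_mul])

/-- double opposite -/
def oo (A : Type) [Ring A] : Aᵐᵒᵖᵐᵒᵖ →+* A := ((RingEquiv.opOp A).symm : Aᵐᵒᵖᵐᵒᵖ ≃+* A)
/-- double opposite -/
def oo' (A : Type) [Ring A] : A →+* Aᵐᵒᵖᵐᵒᵖ := ((RingEquiv.opOp A) : A ≃+* Aᵐᵒᵖᵐᵒᵖ)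

instance : RingHomInvPair (oo A) (oo' A) := ⟨rfl, rfl⟩
instance : RingHomInvPair (oo' A) (oo A) := ⟨rfl, rfl⟩

/-- comparison of the left module with the right module over the opposite -/
noncomputable def lEquiv : letI := lMod φ; letI := rMod (opN φ);
    ↥(rId (k := k) (opN φ 1)) ≃ₛₗ[oo A] ↥(lId (k := k) (φ 1)) :=
  letI := lMod φ; letI := rMod (opN φ)
  { toFun := fun x => ⟨unop x.1, (mem_lId φ).2 (congrArg unop ((mem_rId (opN φ)).1 x.2))⟩
    invFun := fun x => ⟨op x.1, (mem_rId (opN φ)).2 (congrArg op ((mem_lId φ).1 x.2))⟩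
    map_add' := fun x y => rfl
    map_smul' := fun r x => rfl
    left_inv := fun x => rfl
    right_inv := fun x => rfl }

lemma lproj (h : letI := rMod (opN φ); Module.Projective Aᵐᵒᵖᵐᵒᵖ ↥(rId (k := k) (opN φ 1))) :
    letI := lMod φ; Module.Projective A ↥(lId (k := k) (φ 1)) := by
  letI := lMod φ; letI := rMod (opN φ)
  exact Module.Projective.of_equiv (lEquiv φ)

lemma lfin (h : letI := rMod (opN φ); Module.Finite Aᵐᵒᵖᵐᵒᵖ ↥(rId (k := k) (opN φ 1))) :
    letI := lMod φ; Module.Finite A ↥(lId (k := k) (φ 1)) := by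
  letI := lMod φ; letI := rMod (opN φ)
  haveI : RingHomSurjective (oo A) := ⟨fun a => ⟨op (op a), rfl⟩⟩
  exact Module.Finite.of_surjective (σ := oo A) (lEquiv φ).toLinearMap (lEquiv φ).surjective
end modl

end KLR

open KLR MulOpposite in
set_option maxHeartbeats 1000000 in
/-- `F^Λ = R^Λ(β+α_i) e(β,α_i)` is a finitely generated projective right
`R^Λ(β)`-module, and `e(β,α_i) R^Λ(β+α_i)` is a finitely generated projective left
`R^Λ(β)`-module; the `R^Λ(β)`-actions are through the non-unital homomorphism
`φ : R^Λ(β) → R^Λ(β+α_i)`. -/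
theorem cyclotomic_idempotent_projective {k : Type} [Field k] {I : Type} [Fintype I]
    [DecidableEq I] (C : CartanDatum k I) (Λ : I → ℕ) (β : I → ℕ) (i : I) (n : ℕ)
    (hn : ht I β = n)
    (φ : cAlg C Λ n β →ₙₐ[k] cAlg C Λ (n + 1) (addA β i))
    (hφ : IsUpRc C Λ i φ) :
    (∃ inst : Module (cAlg C Λ n β)ᵐᵒᵖ ↥(rId (k := k) (eRc C Λ n β i)),
      letI := inst
      (∀ (r : cAlg C Λ n β) (x : ↥(rId (k := k) (eRc C Λ n β i))),
          (op r • x).val = x.val * φ r) ∧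
        Module.Finite (cAlg C Λ n β)ᵐᵒᵖ ↥(rId (k := k) (eRc C Λ n β i)) ∧
        Module.Projective (cAlg C Λ n β)ᵐᵒᵖ ↥(rId (k := k) (eRc C Λ n β i))) ∧
    (∃ inst : Module (cAlg C Λ n β) ↥(lId (k := k) (eRc C Λ n β i)),
      letI := inst
      (∀ (r : cAlg C Λ n β) (x : ↥(lId (k := k) (eRc C Λ n β i))),
          (r • x).val = φ r * x.val) ∧
        Module.Finite (cAlg C Λ n β) ↥(lId (k := k) (eRc C Λ n β i)) ∧
        Module.Projective (cAlg C Λ n β) ↥(lId (k := k) (eRc C Λ n β i))) := by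
  rw [← phi_one hφ]
  have H := setup hφ
  have hz : IsNilpotent (toCB C Λ (β := addA β i) (XN C (n+1) n)) :=
    xA_nil Λ (n+1) (addA β i) n (Nat.lt_succ_self n)
  have hz' : IsNilpotent (Setup.opPi (toCB C Λ (β := addA β i)) (XN C (n+1) n)) := by
    obtain ⟨m, hm⟩ := hz
    refine ⟨m, ?_⟩
    rw [Setup.opPi_apply, psi_X _ _ _ (Nat.lt_succ_self n), unop_op, ← op_pow, hm, op_zero]
  exact ⟨⟨rMod φ, fun r x => rfl, H.fin hz, H.proj⟩,
    ⟨lMod φ, fun r x => rfl, lfin φ (H.opp.fin hz'), lproj φ H.opp.proj⟩⟩
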